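/- arXiv:1410.1224 — 4 statements merged into one kernel-verified Lean document; each statement's English description precedes it below -/
import Mathlib

section
/- If T is a complete first-order theory of cardinality ℵ₁ in which the isolated types are dense, then T has an atomic model (of cardinality at most ℵ₁). -/
open FirstOrder FirstOrder.Language

/-- A formula (in `n` free variables) is consistent with the theory `T` if it is realized by
some tuple in some model of `T`. -/
def ConsistentWith {L : FirstOrder.Language.{0,0}} (T : L.Theory) {n : ℕ} (φ : L.Formula (Fin n)) : Prop :=
  ∃ (M : Theory.ModelType.{0,0,0} T) (v : Fin n → M), φ.Realize v

/-- `φ` isolates a complete type in `T`: `T ∪ {∃x̄ φ}` is consistent, and for every formula `ψ`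
in the same variables, either `T ⊢ φ → ψ` or `T ⊢ φ → ¬ψ` (semantically). -/
def Isolates {L : FirstOrder.Language.{0,0}} (T : L.Theory) {n : ℕ} (φ : L.Formula (Fin n)) : Prop :=
  ConsistentWith T φ ∧
    ∀ ψ : L.Formula (Fin n),
      (∀ (M : Theory.ModelType.{0,0,0} T) (v : Fin n → M), φ.Realize v → ψ.Realize v) ∨
      (∀ (M : Theory.ModelType.{0,0,0} T) (v : Fin n → M), φ.Realize v → ¬ ψ.Realize v)

/-- The isolated types are dense in `T`: every formula consistent with `T` is implied, modulo
`T`, by a formula isolating a complete type. -/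
def IsolatedTypesDense {L : FirstOrder.Language.{0,0}} (T : L.Theory) : Prop :=
  ∀ (n : ℕ) (φ : L.Formula (Fin n)), ConsistentWith T φ →
    ∃ θ : L.Formula (Fin n), Isolates T θ ∧
      ∀ (M : Theory.ModelType.{0,0,0} T) (v : Fin n → M), θ.Realize v → φ.Realize v

/-- `M` is an atomic model of `T`: `M ⊨ T` and the type of every finite tuple from `M`
is isolated in `T`. -/
def IsAtomicModel {L : FirstOrder.Language.{0,0}} (T : L.Theory) (M : Type*) [L.Structure M] : Prop :=
  M ⊨ T ∧ ∀ (n : ℕ) (a : Fin n → M), ∃ φ : L.Formula (Fin n), φ.Realize a ∧ Isolates T φ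

namespace AtomicProof

/-- Prepend an element to a sequence. -/
def consN {N : Type} (c : N) (a : ℕ → N) : ℕ → N
  | 0 => c
  | k + 1 => a k

/-- The tuple `v` realizes an isolated type. -/
def Atom {L : FirstOrder.Language.{0,0}} (T : L.Theory) {N : Type} [L.Structure N] {n : ℕ}
    (v : Fin n → N) : Prop :=
  ∃ φ : L.Formula (Fin n), φ.Realize v ∧ Isolates T φ

/-- Every finite tuple of `A` realizes an isolated type. -/
def AtomSet {L : FirstOrder.Language.{0,0}} (T : L.Theory) {N : Type} [L.Structure N]
    (A : Set N) : Prop :=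
  ∀ (n : ℕ) (v : Fin n → N), (∀ i, v i ∈ A) → Atom T v

/-- Countable compactness of a structure. -/
def CC (L : FirstOrder.Language.{0,0}) (N : Type) [L.Structure N] : Prop :=
  ∀ (ψ : ℕ → L.Formula ℕ) (a : ℕ → N),
    (∀ k, ∃ c, ∀ j ≤ k, (ψ j).Realize (consN c a)) → ∃ c, ∀ k, (ψ k).Realize (consN c a)

theorem cc_ultrapower {L : FirstOrder.Language.{0,0}} (M : Type) [L.Structure M] [Nonempty M] :
    CC L ((Filter.hyperfilter ℕ : Filter ℕ).Product (fun _ => M)) := by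
  intro ψ a h
  obtain ⟨a', rfl⟩ : ∃ a' : ℕ → ℕ → M, a = fun i =>
      ((a' i : ℕ → M) : (Filter.hyperfilter ℕ : Filter ℕ).Product (fun _ => M)) := by
    choose a' ha' using fun i => Quotient.exists_rep (a i)
    exact ⟨a', funext fun i => (ha' i).symm⟩
  have key : ∀ (φ : L.Formula ℕ) (c : ℕ → M),
      φ.Realize (consN (c : (Filter.hyperfilter ℕ : Filter ℕ).Product (fun _ => M)) fun i =>
        ((a' i : ℕ → M) : (Filter.hyperfilter ℕ : Filter ℕ).Product (fun _ => M))) ↔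
      ∀ᶠ u in (Filter.hyperfilter ℕ : Filter ℕ), φ.Realize (consN (c u) fun i => a' i u) := by
    intro φ c
    have := Ultraproduct.realize_formula_cast (L := L) (u := Filter.hyperfilter ℕ)
      (M := fun _ => M) φ (fun i => consN c a' i)
    have e1 : (consN (c : (Filter.hyperfilter ℕ : Filter ℕ).Product (fun _ => M)) fun i =>
        ((a' i : ℕ → M) : (Filter.hyperfilter ℕ : Filter ℕ).Product (fun _ => M))) =
        fun i => ((consN c a' i : ℕ → M) :
          (Filter.hyperfilter ℕ : Filter ℕ).Product (fun _ => M)) := by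
      funext i; cases i <;> rfl
    have e2 : ∀ u, (consN (c u) fun i => a' i u) = fun i => consN c a' i u := by
      intro u; funext i; cases i <;> rfl
    rw [e1]
    simp only [e2]
    exact this
  have hE : ∀ k, ∀ᶠ u in (Filter.hyperfilter ℕ : Filter ℕ),
      ∃ x : M, ∀ j ≤ k, (ψ j).Realize (consN x fun i => a' i u) := by
    intro k
    obtain ⟨c, hc⟩ := h k
    obtain ⟨c, rfl⟩ := Quotient.exists_rep c
    have : ∀ᶠ u in (Filter.hyperfilter ℕ : Filter ℕ), ∀ j ∈ Set.Iic k,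
        (ψ j).Realize (consN (c u) fun i => a' i u) := by
      rw [Filter.eventually_all_finite (Set.finite_Iic k)]
      intro j hj
      exact (key _ c).1 (hc j hj)
    exact this.mono fun u hu => ⟨c u, hu⟩
  have hb : ∀ u m : ℕ, ∃ x : M, ∀ k ≤ m, 
      (∃ x : M, ∀ j ≤ k, (ψ j).Realize (consN x fun i => a' i u)) →
      ∀ j ≤ k, (ψ j).Realize (consN x fun i => a' i u) := by
    intro u m
    induction m with
    | zero =>
      by_cases h0 : (∃ x : M, ∀ j ≤ 0, (ψ j).Realize (consN x fun i => a' i u))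
      · obtain ⟨x, hx⟩ := h0
        refine ⟨x, fun k hk _ j hj => hx j (hj.trans hk)⟩
      · refine ⟨Classical.arbitrary M, fun k hk hx => ?_⟩
        obtain rfl : k = 0 := by omega
        exact absurd hx h0
    | succ m ih =>
      by_cases h0 : (∃ x : M, ∀ j ≤ m + 1, (ψ j).Realize (consN x fun i => a' i u))
      · obtain ⟨x, hx⟩ := h0
        refine ⟨x, fun k hk _ j hj => hx j (hj.trans hk)⟩
      · obtain ⟨x, hx⟩ := ih
        refine ⟨x, fun k hk hk' => ?_⟩
        rcases Nat.lt_or_ge m k with h1 | h1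
        · obtain rfl : k = m + 1 := by omega
          exact absurd hk' h0
        · exact hx k h1 hk'
  choose b hb using fun u => hb u u
  refine ⟨((b : ℕ → M) : (Filter.hyperfilter ℕ : Filter ℕ).Product (fun _ => M)), fun k => ?_⟩
  refine (key (ψ k) b).2 ?_
  have h2 : ∀ᶠ u in (Filter.hyperfilter ℕ : Filter ℕ), k ≤ u := by
    have : (Filter.hyperfilter ℕ : Filter ℕ) ≤ Filter.atTop := by
      rw [← Nat.cofinite_eq_atTop]; exact Filter.hyperfilter_le_cofinite
    exact this (Filter.eventually_ge_atTop k)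
  filter_upwards [hE k, h2] with u hu hk
  exact hb u k hk hu k le_rfl

section
variable {L : FirstOrder.Language.{0,0}} {T : L.Theory} {N : Type} [L.Structure N] [N ⊨ T]
  [Nonempty N]

theorem Atom.comp {m n : ℕ} {w : Fin n → N} (h : Atom T w)
    (f : Fin m → Fin n) : Atom T (w ∘ f) := by
  obtain ⟨φ, hφ, hc, hi⟩ := h
  let φ' : L.Formula (Fin m) := Formula.iExs (Fin n)
    ((φ.relabel Sum.inr) ⊓ Formula.iInf fun i : Fin m =>
      (Term.var (Sum.inl i) : L.Term (Fin m ⊕ Fin n)).equal (Term.var (Sum.inr (f i))))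
  have key : ∀ (K : Type) [L.Structure K] (v : Fin m → K), φ'.Realize v ↔
      ∃ y : Fin n → K, φ.Realize y ∧ v = y ∘ f := by
    intro K _ v
    simp only [φ', Formula.realize_iExs, Formula.realize_inf, Formula.realize_relabel,
      Formula.realize_iInf, Formula.realize_equal, Term.realize_var, Sum.elim_inl, Sum.elim_inr,
      Sum.elim_comp_inr, funext_iff, Function.comp]
  refine ⟨φ', (key _ _).2 ⟨w, hφ, rfl⟩,
    ⟨Theory.ModelType.of T N, w ∘ f, (key _ _).2 ⟨w, hφ, rfl⟩⟩, fun ψ => ?_⟩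
  rcases hi (ψ.relabel f) with h | h
  · left
    intro M v hv
    obtain ⟨y, hy, rfl⟩ := (key _ _).1 hv
    exact Formula.realize_relabel.1 (h M y hy)
  · right
    intro M v hv
    obtain ⟨y, hy, rfl⟩ := (key _ _).1 hv
    exact fun h' => h M y hy (Formula.realize_relabel.2 h')

theorem next (hd : IsolatedTypesDense T) (a : ℕ → N)
    (ha : ∀ m, Atom T (fun i : Fin m => a i)) (m : ℕ) (θ : L.Formula (Fin (m + 1)))
    (hθ : ∃ c, θ.Realize (fun i => consN c a i)) :
    ∃ θ' : L.Formula (Fin (m + 2)), Isolates T θ' ∧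
      (∃ c, θ'.Realize (fun i => consN c a i)) ∧
      (∀ c, θ'.Realize (fun i => consN c a i) → θ.Realize (fun i => consN c a i)) := by
  obtain ⟨χ, hχ, -, hχi⟩ := ha (m + 1)
  obtain ⟨c, hc⟩ := hθ
  obtain ⟨θ', hi, himp⟩ := hd (m + 2) (θ.relabel Fin.castSucc ⊓ χ.relabel Fin.succ)
    ⟨Theory.ModelType.of T N, fun i => consN c a i, by
      simp only [Formula.realize_inf, Formula.realize_relabel]
      exact ⟨hc, hχ⟩⟩
  refine ⟨θ', hi, ?_, ?_⟩
  · let ε : L.Formula (Fin (m + 1)) := Formula.iExs (Fin 1)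
      (θ'.relabel (Fin.cons (Sum.inr 0) Sum.inl))
    have key : ∀ (K : Type) [L.Structure K] (v : Fin (m + 1) → K), ε.Realize v ↔
        ∃ y : K, θ'.Realize (Fin.cons y v : Fin (m + 2) → K) := by
      intro K _ v
      have e : ∀ y : Fin 1 → K, (Sum.elim v y ∘ (Fin.cons (Sum.inr 0) Sum.inl :
          Fin (m + 2) → Fin (m + 1) ⊕ Fin 1)) = (Fin.cons (y 0) v : Fin (m + 2) → K) := by
        intro y
        funext i
        refine Fin.cases ?_ (fun i => ?_) i <;> simp
      simp only [ε, Formula.realize_iExs, Formula.realize_relabel, e]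
      exact ⟨fun ⟨y, hy⟩ => ⟨y 0, hy⟩, fun ⟨y, hy⟩ => ⟨fun _ => y, hy⟩⟩
    have hε : ε.Realize (fun i : Fin (m + 1) => a i) := by
      rcases hχi ε with h | h
      · exact h (Theory.ModelType.of T N) _ hχ
      · exfalso
        obtain ⟨M, v, hv⟩ := hi.1
        have h1 := himp M v hv
        simp only [Formula.realize_inf, Formula.realize_relabel] at h1
        refine h M _ h1.2 ((key _ _).2 ⟨v 0, ?_⟩)
        convert hv using 1
        exact Fin.cons_self_tail v
    obtain ⟨y, hy⟩ := (key _ _).1 hε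
    refine ⟨y, ?_⟩
    convert hy using 1
    funext i
    refine Fin.cases ?_ (fun i => ?_) i <;> simp [consN]
  · intro c hc
    have := himp (Theory.ModelType.of T N) _ hc
    exact Formula.realize_relabel.1 (Formula.realize_inf.1 this).1

theorem step (hd : IsolatedTypesDense T) (hcc : CC L N) (a : ℕ → N)
    (ha : ∀ m, Atom T (fun i : Fin m => a i)) (n : ℕ) (φ : L.Formula (Fin (n + 1)))
    (hφ : ∃ c, φ.Realize (fun i => consN c a i)) :
    ∃ b, φ.Realize (fun i => consN b a i) ∧ ∀ m, Atom T (fun i : Fin m => consN b a i) := by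
  choose! nx h1 h2 h3 using next hd a ha
  let Θ : ∀ k, L.Formula (Fin (n + k + 1)) := fun k =>
    Nat.rec φ (fun k θ => nx (n + k) θ) k
  have hΘ : ∀ k, ∃ c, (Θ k).Realize (fun i => consN c a i) := by
    intro k
    induction k with
    | zero => exact hφ
    | succ k ih => exact h2 (n + k) _ ih
  have hdec : ∀ k c, (Θ k).Realize (fun i => consN c a i) →
      ∀ j ≤ k, (Θ j).Realize (fun i => consN c a i) := by
    intro k
    induction k with
    | zero =>
      intro c hc j hj
      obtain rfl : j = 0 := by omega
      exact hc
    | succ k ih =>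
      intro c hc j hj
      rcases Nat.lt_or_ge k j with h | h
      · obtain rfl : j = k + 1 := by omega
        exact hc
      · exact ih c (h3 (n + k) _ (hΘ k) c hc) j h
  obtain ⟨b, hb⟩ := hcc (fun k => (Θ k).relabel (fun i : Fin (n + k + 1) => (i : ℕ))) a (by
    intro k
    obtain ⟨c, hc⟩ := hΘ k
    refine ⟨c, fun j hj => Formula.realize_relabel.2 (hdec k c hc j hj)⟩)
  have hb' : ∀ k, (Θ k).Realize (fun i => consN b a i) :=
    fun k => Formula.realize_relabel.1 (hb k)
  refine ⟨b, hb' 0, fun m => ?_⟩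
  have : Atom T (fun i : Fin (n + m + 1 + 1) => consN b a i) :=
    ⟨Θ (m + 1), hb' (m + 1), h1 (n + m) _ (hΘ m)⟩
  exact this.comp (Fin.castLE (by omega))

theorem atomSet_range {a : ℕ → N} (ha : ∀ m, Atom T (fun i : Fin m => a i)) :
    AtomSet T (Set.range a) := by
  intro n v hv
  choose g hg using hv
  obtain ⟨B, hB⟩ : ∃ B, ∀ i, g i < B :=
    ⟨Finset.univ.sup g + 1, fun i => Nat.lt_succ_of_le (Finset.le_sup (Finset.mem_univ i))⟩
  have := (ha B).comp (fun i => (⟨g i, hB i⟩ : Fin B))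
  convert this using 1
  funext i
  exact (hg i).symm

theorem stepSet (hd : IsolatedTypesDense T) (hcc : CC L N) (A : Set N) (hA : A.Countable)
    (hne : A.Nonempty) (hat : AtomSet T A) (n : ℕ) (φ : L.Formula (Fin (n + 1)))
    (s : Fin n → N) (hs : ∀ i, s i ∈ A) (hφ : ∃ c, φ.Realize (Fin.cons c s : Fin (n + 1) → N)) :
    ∃ b, φ.Realize (Fin.cons b s : Fin (n + 1) → N) ∧ AtomSet T (insert b A) := by
  obtain ⟨e, rfl⟩ := hA.exists_eq_range hne
  let a : ℕ → N := fun i => if h : i < n then s ⟨i, h⟩ else e (i - n)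
  have hea : Set.range e = Set.range a := by
    ext x
    constructor
    · rintro ⟨i, rfl⟩
      exact ⟨i + n, by simp [a]⟩
    · rintro ⟨i, rfl⟩
      by_cases h : i < n
      · simp only [a, dif_pos h]; exact hs _
      · simp only [a, dif_neg h]; exact ⟨_, rfl⟩
  have hc : ∀ c, (fun i : Fin (n + 1) => consN c a i) = (Fin.cons c s : Fin (n + 1) → N) := by
    intro c
    funext i
    refine Fin.cases ?_ (fun i => ?_) i <;> simp [consN, a]
  obtain ⟨b, hb, hb'⟩ := step hd hcc a
    (fun m => hat m _ fun i => hea ▸ Set.mem_range_self _) n φ (by simpa only [hc] using hφ)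
  refine ⟨b, by simpa only [hc] using hb, ?_⟩
  have := atomSet_range hb'
  convert this using 1
  rw [hea]
  ext x
  constructor
  · rintro (rfl | ⟨i, rfl⟩)
    · exact ⟨0, rfl⟩
    · exact ⟨i + 1, rfl⟩
  · rintro ⟨i, rfl⟩
    cases i with
    | zero => exact Or.inl rfl
    | succ i => exact Or.inr ⟨i, rfl⟩

theorem seed (hT : T.IsComplete) (hd : IsolatedTypesDense T) : ∃ a₀ : N, AtomSet T {a₀} := by
  obtain ⟨θ, hi, -⟩ := hd 1 ⊤ ⟨Theory.ModelType.of T N, fun _ => Classical.arbitrary N,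
    BoundedFormula.realize_top.2 trivial⟩
  obtain ⟨M, v, hv⟩ := hi.1
  let ε : L.Sentence := Formula.iExs (Fin 1) (θ.relabel Sum.inr)
  have key : ∀ (K : Type) [L.Structure K], K ⊨ ε ↔ ∃ y : Fin 1 → K, θ.Realize y := by
    intro K _
    simp only [Sentence.Realize, ε, Formula.realize_iExs, Formula.realize_relabel,
      Sum.elim_comp_inr]
  have h1 : N ⊨ ε := (hT.realize_sentence_iff ε N).2
    ((hT.realize_sentence_iff ε M).1 ((key M).2 ⟨v, hv⟩))
  obtain ⟨y, hy⟩ := (key N).1 h1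
  refine ⟨y 0, fun n w hw => ?_⟩
  have : Atom T y := ⟨θ, hy, hi⟩
  convert this.comp (fun _ : Fin n => (0 : Fin 1)) using 1
  funext i
  exact hw i

/-- The bookkeeping tasks. -/
abbrev Task (L : FirstOrder.Language.{0,0}) (I : Type) : Type :=
  Σ n : ℕ, L.Formula (Fin (n + 1)) × (Fin n → I)

theorem mk_task (hL : Cardinal.mk L.Symbols ≤ Cardinal.aleph 1) (I : Type)
    (hI : Cardinal.mk I = Cardinal.aleph 1) : Cardinal.mk (Task L I) ≤ Cardinal.aleph 1 := by
  have h0 : Cardinal.aleph0 ≤ Cardinal.aleph 1 := Cardinal.aleph0_le_aleph 1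
  rw [Cardinal.mk_sigma]
  refine (Cardinal.sum_le_sum _ (fun _ => Cardinal.aleph 1) fun n => ?_).trans ?_
  · rw [Cardinal.mk_prod, Cardinal.lift_id, Cardinal.lift_id]
    refine Cardinal.mul_le_of_le h0 ?_ ?_
    · have h1 : Cardinal.mk (L.Formula (Fin (n + 1))) ≤
          Cardinal.mk (Σ k, L.BoundedFormula (Fin (n + 1)) k) :=
        Cardinal.mk_le_of_injective (f := fun φ => ⟨0, φ⟩) (fun x y h => by simpa using h)
      refine h1.trans (BoundedFormula.card_le.trans (max_le h0 ?_))
      simp only [Cardinal.lift_id]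
      refine Cardinal.add_le_of_le h0 ?_ hL
      simp
    · rw [← Cardinal.power_def, hI, Cardinal.mk_fin, Cardinal.power_natCast]
      exact Cardinal.power_nat_le h0
  · simp only [Cardinal.sum_const, Cardinal.mk_nat, Cardinal.lift_id]
    exact Cardinal.mul_le_of_le h0 h0 le_rfl

theorem construct (hL : Cardinal.mk L.Symbols ≤ Cardinal.aleph 1) (hT : T.IsComplete)
    (hd : IsolatedTypesDense T) (hcc : CC L N) :
    ∃ A : Set N, A.Nonempty ∧ Cardinal.mk A ≤ Cardinal.aleph 1 ∧ AtomSet T A ∧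
      ∀ (n : ℕ) (φ : L.Formula (Fin (n + 1))) (s : Fin n → N), (∀ i, s i ∈ A) →
        (∃ c, φ.Realize (Fin.cons c s : Fin (n + 1) → N)) →
        ∃ b ∈ A, φ.Realize (Fin.cons b s : Fin (n + 1) → N) := by
  obtain ⟨a₀, ha₀⟩ := seed (N := N) hT hd
  have h0 : Cardinal.aleph0 ≤ Cardinal.aleph 1 := Cardinal.aleph0_le_aleph 1
  obtain ⟨I, hlin, hwf, hI, hIcount⟩ : ∃ (I : Type) (_ : LinearOrder I) (_ : WellFoundedLT I),
      Cardinal.mk I = Cardinal.aleph 1 ∧ ∀ i : I, (Set.Iio i).Countable := by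
    refine ⟨(Cardinal.aleph 1).ord.ToType, inferInstance, inferInstance, by simp, fun i => ?_⟩
    have : Cardinal.mk (Set.Iio i) < Cardinal.aleph 1 := by
      simpa using Cardinal.mk_Iio_lt i (by simp)
    rw [← Cardinal.le_aleph0_iff_set_countable]
    exact Order.lt_succ_iff.1 (this.trans_eq Cardinal.succ_aleph0.symm)
  have hIinf : Infinite I := Cardinal.infinite_iff.2 (hI ▸ h0)
  have hIunc : ¬ (Set.univ : Set I).Countable := by
    rw [← Cardinal.le_aleph0_iff_set_countable, Cardinal.mk_univ, hI, not_le]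
    exact Cardinal.aleph0_lt_aleph_one
  obtain ⟨g, hg⟩ : ∃ g : I → Task L I × I, Function.Surjective g := by
    have hne : Nonempty (Task L I × I) := ⟨⟨⟨0, ⊤, Fin.elim0⟩, Classical.arbitrary I⟩⟩
    have hle : Cardinal.mk (Task L I × I) ≤ Cardinal.mk I := by
      rw [Cardinal.mk_prod, Cardinal.lift_id, Cardinal.lift_id, hI]
      exact Cardinal.mul_le_of_le h0 (mk_task hL I hI) le_rfl
    obtain ⟨f⟩ := hle
    exact ⟨Function.invFun f, Function.invFun_surjective f.injective⟩
  let P : ∀ i : I, (∀ j, j < i → N) → N → Prop := fun i r x =>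
    AtomSet T (insert x (insert a₀ {y | ∃ j, ∃ h : j < i, y = r j h})) ∧
    ∀ h : ∀ k, (g i).1.2.2 k < i,
      (∃ c, (g i).1.2.1.Realize
        (Fin.cons c (fun k => r _ (h k)) : Fin ((g i).1.1 + 1) → N)) →
      (g i).1.2.1.Realize (Fin.cons x (fun k => r _ (h k)) : Fin ((g i).1.1 + 1) → N)
  let b : I → N := hwf.wf.fix fun i r => Classical.epsilon (P i r)
  have hb : ∀ i, b i = Classical.epsilon (P i fun j _ => b j) := fun i =>
    hwf.wf.fix_eq _ i
  have hset : ∀ i, {y | ∃ j, ∃ _ : j < i, y = b j} = b '' Set.Iio i := by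
    intro i
    ext y
    simp only [Set.mem_ofPred_eq, Set.mem_image, Set.mem_Iio]
    exact ⟨fun ⟨j, h, e⟩ => ⟨j, h, e.symm⟩, fun ⟨j, h, e⟩ => ⟨j, h, e.symm⟩⟩
  -- finite character
  have hfin : ∀ J : Set I, (∀ j ∈ J, AtomSet T (insert a₀ (b '' Set.Iic j))) →
      AtomSet T (insert a₀ (b '' J)) := by
    intro J hJ n v hv
    have hex : ∀ S : Finset (Fin n), (∀ k ∈ S, v k = a₀) ∨
        ∃ j ∈ J, ∀ k ∈ S, v k ∈ insert a₀ (b '' Set.Iic j) := by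
      classical
      intro S
      induction S using Finset.induction_on with
      | empty => left; simp
      | insert k S _ ih =>
        rcases hv k with hk | ⟨j, hj, hk⟩
        · rcases ih with ih | ⟨j', hj', ih⟩
          · left
            intro k' hk'
            rcases Finset.mem_insert.1 hk' with rfl | h
            · exact hk
            · exact ih _ h
          · right
            refine ⟨j', hj', fun k' hk' => ?_⟩
            rcases Finset.mem_insert.1 hk' with rfl | h
            · exact Or.inl hk
            · exact ih _ h
        · right
          rcases ih with ih | ⟨j', hj', ih⟩
          · refine ⟨j, hj, fun k' hk' => ?_⟩
            rcases Finset.mem_insert.1 hk' with rfl | h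
            · exact Or.inr ⟨j, le_rfl, hk⟩
            · exact Or.inl (ih _ h)
          · have hm : ∀ x, x ≤ max j j' → b x ∈ insert a₀ (b '' Set.Iic (max j j')) :=
              fun x hx => Or.inr ⟨x, hx, rfl⟩
            refine ⟨max j j', by rcases max_choice j j' with h | h <;> rw [h] <;> assumption,
              fun k' hk' => ?_⟩
            rcases Finset.mem_insert.1 hk' with rfl | h
            · rw [← hk]; exact hm j (le_max_left _ _)
            · rcases ih _ h with h | ⟨x, hx, h⟩
              · exact Or.inl h
              · rw [← h]; exact hm x (le_trans hx (le_max_right _ _))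
    rcases hex Finset.univ with h | ⟨j, hj, h⟩
    · exact ha₀ n v fun i => h i (Finset.mem_univ i)
    · exact hJ j hj n v fun i => h i (Finset.mem_univ i)
  have hex : ∀ i, AtomSet T (insert a₀ (b '' Set.Iio i)) → P i (fun j _ => b j) (b i) := by
    intro i hi
    rw [hb i]
    apply Classical.epsilon_spec (p := P i fun j _ => b j)
    have hcnt : (insert a₀ (b '' Set.Iio i)).Countable := ((hIcount i).image b).insert a₀
    have hne : (insert a₀ (b '' Set.Iio i)).Nonempty := Set.insert_nonempty _ _
    by_cases hc : ∃ h : ∀ k, (g i).1.2.2 k < i, (∃ c, (g i).1.2.1.Realize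
        (Fin.cons c (fun k => b ((g i).1.2.2 k)) : Fin ((g i).1.1 + 1) → N))
    · obtain ⟨h, hc⟩ := hc
      obtain ⟨x, hx, hx'⟩ := stepSet hd hcc _ hcnt hne hi _ (g i).1.2.1
        (fun k => b ((g i).1.2.2 k)) (fun k => Or.inr ⟨_, h k, rfl⟩) hc
      refine ⟨x, ?_, fun _ _ => hx⟩
      rw [hset]; exact hx'
    · refine ⟨a₀, ?_, fun h h' => absurd ⟨h, h'⟩ hc⟩
      rw [hset, Set.insert_idem]; exact hi
  have hIic : ∀ i, AtomSet T (insert a₀ (b '' Set.Iic i)) := by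
    intro i
    induction i using hwf.wf.induction with
    | _ i ih =>
      have h1 := (hex i (hfin _ fun j hj => ih j hj)).1
      rw [hset] at h1
      convert h1 using 1
      rw [← Set.Iio_insert, Set.image_insert_eq, Set.insert_comm]
  have hP : ∀ i, P i (fun j _ => b j) (b i) := fun i => hex i (hfin _ fun j _ => hIic j)
  refine ⟨Set.range b, Set.range_nonempty b, Cardinal.mk_range_le.trans hI.le, ?_, ?_⟩
  · have := hfin Set.univ fun j _ => hIic j
    intro n v hv
    refine this n v fun i => Or.inr ?_
    rw [Set.image_univ]; exact hv i
  · intro n φ s hs hc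
    choose t ht using hs
    obtain rfl : (fun k => b (t k)) = s := funext ht
    obtain ⟨B, hB⟩ : ∃ B, ∀ k, t k ≤ B := Finite.exists_le t
    obtain ⟨i, hi, hBi⟩ : ∃ i, (g i).1 = ⟨n, φ, t⟩ ∧ B < i := by
      by_contra hcon
      push Not at hcon
      apply hIunc
      have hIic' : (Set.Iic B).Countable := by
        rw [← Set.Iio_insert]; exact (hIcount B).insert B
      refine (hIic'.image fun i => (g i).2).mono fun x _ => ?_
      obtain ⟨i, hi⟩ := hg (⟨n, φ, t⟩, x)
      exact ⟨i, hcon i (by rw [hi]), by simp only [hi]⟩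
    have h2 := (hP i).2
    rw [hi] at h2
    exact ⟨b i, ⟨i, rfl⟩, h2 (fun k => (hB k).trans_lt hBi) hc⟩

theorem main (hL : Cardinal.mk L.Symbols ≤ Cardinal.aleph 1) (hT : T.IsComplete)
    (hd : IsolatedTypesDense T) (hcc : CC L N) :
    ∃ (M : Type) (_ : L.Structure M), Cardinal.mk M ≤ Cardinal.aleph 1 ∧ Nonempty M ∧
      IsAtomicModel T M := by
  obtain ⟨A, hne, hcard, hat, htv⟩ := construct (N := N) hL hT hd hcc
  let S : L.Substructure N := ⟨A, by
    intro n f x hx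
    obtain ⟨b, hb, hb'⟩ := htv n ((Term.var 0 : L.Term (Fin (n + 1))).equal
      (Term.func f fun i => Term.var i.succ)) x hx ⟨Structure.funMap f x, by
        simp [Formula.realize_equal]⟩
    simp [Formula.realize_equal] at hb'
    rwa [← hb']⟩
  let S' : L.ElementarySubstructure N := S.toElementarySubstructure (by
    intro n φ x a h
    have key : ∀ c : N, (φ.toFormula.relabel (Sum.elim (fun e : Empty => e.elim)
        (Fin.snoc Fin.succ 0 : Fin (n + 1) → Fin (n + 1)))).Realize
          (Fin.cons c (fun i => (x i : N)) : Fin (n + 1) → N) ↔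
        φ.Realize default (Fin.snoc ((↑) ∘ x) c : _ → N) := by
      intro c
      rw [Formula.realize_relabel, BoundedFormula.realize_toFormula, iff_eq_eq]
      congr 1
      · exact Subsingleton.elim _ _
      · funext i
        refine Fin.lastCases ?_ (fun i => ?_) i <;> simp
    obtain ⟨b, hb, hb'⟩ := htv n _ (fun i => (x i : N)) (fun i => (x i).2) ⟨a, (key a).2 h⟩
    exact ⟨⟨b, hb⟩, (key b).1 hb'⟩)
  refine ⟨S', inferInstance, hcard, hne.to_subtype, (S'.theory_model_iff T).2 inferInstance, ?_⟩
  intro n a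
  obtain ⟨φ, hφ, hi⟩ := hat n (fun i => (a i : N)) fun i => (a i).2
  exact ⟨φ, (S'.isElementary φ a).1 hφ, hi⟩

end

theorem product_model {L : FirstOrder.Language.{0,0}} {T : L.Theory} (M : Type) [L.Structure M]
    [Nonempty M] [M ⊨ T] :
    ((Filter.hyperfilter ℕ : Filter ℕ).Product (fun _ => M)) ⊨ T := by
  refine ⟨fun φ hφ => ?_⟩
  rw [Ultraproduct.sentence_realize]
  exact Filter.Eventually.of_forall fun _ => Theory.realize_sentence_of_mem T hφ

end AtomicProof

/-- if `T` is a complete first-order theory of cardinality at most `ℵ₁`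
(in a language of size at most `ℵ₁`) in which the isolated types are dense, then `T` has an
atomic model of cardinality at most `ℵ₁`. -/
theorem statement2 {L : FirstOrder.Language.{0,0}} (hL : Cardinal.mk L.Symbols ≤ Cardinal.aleph 1)
    (T : L.Theory) (hTcard : Cardinal.mk T ≤ Cardinal.aleph 1)
    (hT : T.IsComplete) (hdense : IsolatedTypesDense T) :
    ∃ (M : Type) (_ : L.Structure M), Cardinal.mk M ≤ Cardinal.aleph 1 ∧ Nonempty M ∧
      IsAtomicModel T M := by
  obtain ⟨M⟩ := hT.1
  have := AtomicProof.product_model (T := T) M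
  exact AtomicProof.main (N := (Filter.hyperfilter ℕ : Filter ℕ).Product (fun _ => M)) hL hT hdense
    (AtomicProof.cc_ultrapower M)
end

section
/- Let P₁, P₂ be forcing notions in V, τ₁ a P₁-name and τ₂ a P₂-name, and τ₁', τ₂' the corresponding names in the product P₁ × P₂. If some condition (p,q) ∈ P₁ × P₂ forces τ₁' = τ₂', then there is x ∈ V such that p ⊩_{P₁} τ₁ = x̌ and q ⊩_{P₂} τ₂ = x̌. -/
open FirstOrder FirstOrder.Language

/-! A self-contained rendering of forcing over transitive models of ZFC, inside the ambient
universe of `ZFSet`. A "transitive model of ZFC" is a countable transitive set of `ZFSet`s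
satisfying the ZFC axioms (with separation and replacement for all first-order formulas of
the language of set theory, interpreted by true membership). Forcing is treated semantically:
`p ⊩ τ = x̌` means that `τ` evaluates to `x` under every generic filter containing `p`. -/

/-- The language of set theory: a single binary relation `∈`. -/
def memRl : ℕ → Type
  | 2 => Unit
  | _ => Empty

def memLang : FirstOrder.Language.{0,0} := ⟨fun _ => Empty, memRl⟩

/-- Any collection `U` of sets is a `memLang`-structure via true membership. -/
instance memStructure (U : Set ZFSet) : memLang.Structure U where
  funMap {n} f _ := Empty.elim f
  RelMap {n} r v :=
    match n, r, v with
    | 2, _, v => (v 0 : ZFSet) ∈ (v 1 : ZFSet)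

/-- `U` is a transitive model of ZFC: it is transitive, contains `ω`, and satisfies pairing,
union, powerset, full first-order separation and replacement, and choice. -/
def IsZFCModel (U : Set ZFSet) : Prop :=
  (∀ x ∈ U, ∀ y : ZFSet, y ∈ x → y ∈ U) ∧
  ZFSet.omega ∈ U ∧
  (∀ x ∈ U, ∀ y ∈ U, ({x, y} : ZFSet) ∈ U) ∧
  (∀ x ∈ U, ZFSet.sUnion x ∈ U) ∧
  (∀ x ∈ U, ∃ P ∈ U, ∀ y ∈ U, (y ∈ P ↔ y ⊆ x)) ∧
  (∀ (n : ℕ) (φ : memLang.Formula (Fin (n + 1))) (par : Fin n → ↥U) (a : ZFSet), a ∈ U →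
    ∃ b ∈ U, ∀ z : ↥U, ((z : ZFSet) ∈ b ↔
      ((z : ZFSet) ∈ a ∧ Formula.Realize φ (Fin.snoc par z)))) ∧
  (∀ (n : ℕ) (φ : memLang.Formula (Fin (n + 2))) (par : Fin n → ↥U) (a : ZFSet), a ∈ U →
    (∀ x : ↥U, (x : ZFSet) ∈ a → ∃! y : ↥U, Formula.Realize φ (Fin.snoc (Fin.snoc par x) y)) →
    ∃ b ∈ U, ∀ y : ↥U, ((y : ZFSet) ∈ b ↔
      ∃ x : ↥U, (x : ZFSet) ∈ a ∧ Formula.Realize φ (Fin.snoc (Fin.snoc par x) y))) ∧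
  (∀ a ∈ U, (∀ x : ZFSet, x ∈ a → x ≠ ∅) →
    ∃ f ∈ U, ZFSet.IsFunc a (ZFSet.sUnion a) f ∧
      ∀ x : ZFSet, x ∈ a → ∀ y : ZFSet, ZFSet.pair x y ∈ f → y ∈ x)

/-- A forcing notion: a preordered set of conditions, coded by `ZFSet`s. `pair q p ∈ le`
means that `q` is stronger than `p`. -/
structure ForcingNotion where
  P : ZFSet
  le : ZFSet
  refl : ∀ p ∈ P, ZFSet.pair p p ∈ le
  trans : ∀ p q r : ZFSet, ZFSet.pair p q ∈ le → ZFSet.pair q r ∈ le → ZFSet.pair p r ∈ le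
  le_dom : ∀ p q : ZFSet, ZFSet.pair p q ∈ le → p ∈ P ∧ q ∈ P

/-- The forcing notion belongs to the model `U`. -/
def ForcingNotion.InModel (F : ForcingNotion) (U : Set ZFSet) : Prop :=
  F.P ∈ U ∧ F.le ∈ U

/-- `G` is a filter on the forcing notion `F`. -/
def IsFilterOn (F : ForcingNotion) (G : Set ZFSet) : Prop :=
  (∀ p ∈ G, p ∈ F.P) ∧
  (∀ p ∈ G, ∀ q : ZFSet, ZFSet.pair p q ∈ F.le → q ∈ G) ∧
  (∀ p ∈ G, ∀ q ∈ G, ∃ r ∈ G, ZFSet.pair r p ∈ F.le ∧ ZFSet.pair r q ∈ F.le)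

/-- `G` is an `F`-generic filter over `U`: a filter meeting every dense subset of `F`
belonging to `U`. -/
def IsGenericOver (U : Set ZFSet) (F : ForcingNotion) (G : Set ZFSet) : Prop :=
  IsFilterOn F G ∧
  ∀ D : ZFSet, D ∈ U → (∀ d : ZFSet, d ∈ D → d ∈ F.P) →
    (∀ p ∈ F.P, ∃ q : ZFSet, q ∈ D ∧ ZFSet.pair q p ∈ F.le) →
    ∃ q ∈ G, q ∈ D

/-- Evaluation of a `P`-name `τ` by a filter `G`:
`τ[G] = { σ[G] : ∃ p ∈ G, (σ, p) ∈ τ }`, by `∈`-recursion. -/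
noncomputable def nameVal (G : Set ZFSet) : ZFSet → ZFSet :=
  WellFounded.fix ZFSet.mem_wf.transGen fun τ ih =>
    @ZFSet.image (fun σ => @dite _ (Relation.TransGen (· ∈ ·) σ τ) (Classical.dec _) (fun h => ih σ h) (fun _ => ∅))
      (Classical.allZFSetDefinable _)
      (ZFSet.sep (fun σ => ∃ p ∈ G, ZFSet.pair σ p ∈ τ) (ZFSet.sUnion (ZFSet.sUnion τ)))

/-- The generic extension `U[G]`: all values of names from `U`. -/
def genExt (U : Set ZFSet) (G : Set ZFSet) : Set ZFSet :=
  {x | ∃ τ ∈ U, nameVal G τ = x}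

/-- The semantic forcing relation `p ⊩ τ = x̌` (over the model `U`). -/
def ForcesEqCheck (U : Set ZFSet) (F : ForcingNotion) (p τ x : ZFSet) : Prop :=
  ∀ G : Set ZFSet, IsGenericOver U F G → p ∈ G → nameVal G τ = x

/-- `(G₁, G₂)` is generic for the product forcing `F₁ × F₂` over `U`: both are filters and
`G₁ × G₂` meets every dense subset of the product belonging to `U`. -/
def IsProductGeneric (U : Set ZFSet) (F₁ F₂ : ForcingNotion) (G₁ G₂ : Set ZFSet) : Prop :=
  IsFilterOn F₁ G₁ ∧ IsFilterOn F₂ G₂ ∧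
  ∀ D : ZFSet, D ∈ U →
    (∀ d : ZFSet, d ∈ D → ∃ p q : ZFSet, p ∈ F₁.P ∧ q ∈ F₂.P ∧ d = ZFSet.pair p q) →
    (∀ p ∈ F₁.P, ∀ q ∈ F₂.P, ∃ p' q' : ZFSet, ZFSet.pair p' q' ∈ D ∧
      ZFSet.pair p' p ∈ F₁.le ∧ ZFSet.pair q' q ∈ F₂.le) →
    ∃ p ∈ G₁, ∃ q ∈ G₂, ZFSet.pair p q ∈ D

namespace Fc

universe u

variable {V : Set ZFSet.{u}}

/-- Definability with parameters over the structure `V`. -/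
def Dfn {α : Type} (P : (α → V) → Prop) : Prop :=
  ∃ φ : memLang.Formula (α ⊕ V), ∀ v, φ.Realize (Sum.elim v id) ↔ P v

theorem Dfn.congr {α : Type} {P Q : (α → V) → Prop} (h : Dfn P) (e : ∀ v, P v ↔ Q v) : Dfn Q := by
  obtain ⟨φ, hφ⟩ := h
  exact ⟨φ, fun v => (hφ v).trans (e v)⟩

theorem Dfn.ren {α β : Type} {P : (α → V) → Prop} (h : Dfn P) (f : α → β) :
    Dfn (fun w : β → V => P (fun i => w (f i))) := by
  obtain ⟨φ, hφ⟩ := h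
  refine ⟨φ.relabel (Sum.map f id), fun v => ?_⟩
  rw [Formula.realize_relabel]
  refine Iff.trans ?_ (hφ _)
  have : (Sum.elim v id ∘ Sum.map f id : α ⊕ V → V) = Sum.elim (fun i => v (f i)) id := by
    funext x; cases x <;> rfl
  rw [this]

theorem Dfn.not {α : Type} {P : (α → V) → Prop} (h : Dfn P) : Dfn (fun v => ¬ P v) := by
  obtain ⟨φ, hφ⟩ := h
  exact ⟨φ.not, fun v => by rw [Formula.realize_not, hφ]⟩

theorem Dfn.imp {α : Type} {P Q : (α → V) → Prop} (h : Dfn P) (h' : Dfn Q) :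
    Dfn (fun v => P v → Q v) := by
  obtain ⟨φ, hφ⟩ := h
  obtain ⟨ψ, hψ⟩ := h'
  exact ⟨φ.imp ψ, fun v => by rw [Formula.realize_imp, hφ, hψ]⟩

theorem Dfn.and {α : Type} {P Q : (α → V) → Prop} (h : Dfn P) (h' : Dfn Q) :
    Dfn (fun v => P v ∧ Q v) :=
  (h.imp h'.not).not.congr fun v => by tauto

theorem Dfn.or {α : Type} {P Q : (α → V) → Prop} (h : Dfn P) (h' : Dfn Q) :
    Dfn (fun v => P v ∨ Q v) :=
  (h.not.imp h').congr fun v => by tauto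

theorem Dfn.iff {α : Type} {P Q : (α → V) → Prop} (h : Dfn P) (h' : Dfn Q) :
    Dfn (fun v => P v ↔ Q v) :=
  ((h.imp h').and (h'.imp h)).congr fun v => by tauto

theorem Dfn.ex {α : Type} {P : (α → V) → V → Prop}
    (h : Dfn (fun w : Option α → V => P (fun i => w (some i)) (w none))) :
    Dfn (fun v => ∃ x, P v x) := by
  obtain ⟨φ, hφ⟩ := h
  refine ⟨(φ.relabel (Sum.elim (fun o => o.elim (Sum.inr ()) (fun a => Sum.inl (Sum.inl a)))
    (fun c => Sum.inl (Sum.inr c)) : Option α ⊕ V → (α ⊕ V) ⊕ Unit)).iExs Unit, fun v => ?_⟩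
  rw [Formula.realize_iExs]
  have key : ∀ x : Unit → V, (Sum.elim (Sum.elim v id) x ∘
      (Sum.elim (fun o => o.elim (Sum.inr ()) (fun a => Sum.inl (Sum.inl a)))
    (fun c => Sum.inl (Sum.inr c)) : Option α ⊕ V → (α ⊕ V) ⊕ Unit)) =
      Sum.elim (fun o : Option α => o.elim (x ()) v) id := by
    intro x; funext o; rcases o with (_ | o) | o <;> rfl
  constructor
  · rintro ⟨x, hx⟩
    rw [Formula.realize_relabel, key, hφ] at hx
    exact ⟨_, hx⟩
  · rintro ⟨x, hx⟩
    refine ⟨fun _ => x, ?_⟩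
    rw [Formula.realize_relabel, key, hφ]
    exact hx

theorem Dfn.all {α : Type} {P : (α → V) → V → Prop}
    (h : Dfn (fun w : Option α → V => P (fun i => w (some i)) (w none))) :
    Dfn (fun v => ∀ x, P v x) :=
  (Dfn.ex (P := fun v x => ¬ P v x) h.not).not.congr fun v => by simp

/-- Membership between elements of the model. -/
def mm (a b : V) : Prop := (a : ZFSet) ∈ (b : ZFSet)

def memSym : memLang.Relations 2 := ()

theorem Dfn.mm_var {α : Type} (i j : α) : Dfn (fun v : α → V => mm (v i) (v j)) := by
  refine ⟨memSym.formula₂ (Term.var (Sum.inl i)) (Term.var (Sum.inl j)), fun v => ?_⟩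
  rw [Formula.realize_rel₂]
  exact Iff.rfl

theorem Dfn.eq_var {α : Type} (i j : α) : Dfn (fun v : α → V => v i = v j) := by
  refine ⟨Term.equal (Term.var (Sum.inl i)) (Term.var (Sum.inl j)), fun v => ?_⟩
  rw [Formula.realize_equal]
  exact Iff.rfl

theorem Dfn.eq_const {α : Type} (i : α) (c : V) : Dfn (fun v : α → V => v i = c) := by
  refine ⟨Term.equal (Term.var (Sum.inl i)) (Term.var (Sum.inr c)), fun v => ?_⟩
  rw [Formula.realize_equal]
  exact Iff.rfl

/-- Definable functions. -/
def DF {α : Type} (t : (α → V) → V) : Prop :=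
  Dfn (fun w : Option α → V => w none = t (fun i => w (some i)))

theorem DF.var {α : Type} (i : α) : DF (fun v : α → V => v i) := Dfn.eq_var _ _

theorem DF.const {α : Type} (c : V) : DF (fun _ : α → V => c) := Dfn.eq_const _ _

theorem DF.subst1 {α : Type} {t : (α → V) → V} (ht : DF t) {P : (α → V) → V → Prop}
    (h : Dfn (fun w : Option α → V => P (fun i => w (some i)) (w none))) :
    Dfn (fun v => P v (t v)) :=
  (Dfn.ex (P := fun v x => x = t v ∧ P v x) (Dfn.and ht h)).congr fun v => by simp

theorem DF.ren {α β : Type} {t : (α → V) → V} (h : DF t) (f : α → β) :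
    DF (fun w : β → V => t (fun i => w (f i))) :=
  (Dfn.ren h (Option.map f) : _)

theorem Dfn.mem {α : Type} {s t : (α → V) → V} (hs : DF s) (ht : DF t) :
    Dfn (fun v => mm (s v) (t v)) :=
  hs.subst1 (P := fun v x => mm x (t v)) ((ht.ren some).subst1
    (P := fun w y => mm (w none) y) (Dfn.mm_var _ _))

theorem Dfn.eq {α : Type} {s t : (α → V) → V} (hs : DF s) (ht : DF t) :
    Dfn (fun v => s v = t v) :=
  hs.subst1 (P := fun v x => x = t v) ((ht.ren some).subst1
    (P := fun w y => w none = y) (Dfn.eq_var _ _))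

theorem Dfn.fin_par {α : Type} [Nonempty V] {P : (α → V) → Prop} (h : Dfn P) :
    ∃ (n : ℕ) (par : Fin n → V) (ψ : memLang.Formula (α ⊕ Fin n)),
      ∀ v, ψ.Realize (Sum.elim v par) ↔ P v := by
  classical
  obtain ⟨φ, hφ⟩ := h
  let e := Fintype.equivFin φ.freeVarFinset
  refine ⟨Fintype.card φ.freeVarFinset,
    fun i => Sum.elim (fun _ => Classical.arbitrary V) id (e.symm i).1,
    BoundedFormula.restrictFreeVar φ (fun x => Sum.elim (fun a => Sum.inl a)
      (fun _ => Sum.inr (e x)) x.1), fun v => ?_⟩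
  rw [← hφ]
  refine BoundedFormula.realize_restrictFreeVar _ ?_
  rintro ⟨a | a, ha⟩ <;> simp

variable [hM : Fact (IsZFCModel V)]

theorem trans_mem {x y : ZFSet} (hy : y ∈ V) (h : x ∈ y) : x ∈ V := hM.out.1 _ hy _ h

instance : Nonempty V := ⟨⟨_, hM.out.2.1⟩⟩

theorem mext {a b : V} (h : ∀ z : V, mm z a ↔ mm z b) : a = b := by
  apply Subtype.ext
  ext z
  exact ⟨fun hz => (h ⟨z, trans_mem a.2 hz⟩).1 hz, fun hz => (h ⟨z, trans_mem b.2 hz⟩).2 hz⟩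

theorem sep (a : V) (P : V → Prop) (h : Dfn (fun v : Unit → V => P (v ()))) :
    ∃ b : V, ∀ z, mm z b ↔ mm z a ∧ P z := by
  obtain ⟨n, par, ψ, hψ⟩ := h.fin_par
  obtain ⟨b, hb, hb'⟩ := hM.out.2.2.2.2.2.1 n
    (ψ.relabel (Sum.elim (fun _ => Fin.last n) Fin.castSucc)) par a a.2
  refine ⟨⟨b, hb⟩, fun z => (hb' z).trans (and_congr Iff.rfl ?_)⟩
  rw [Formula.realize_relabel, ← hψ (fun _ => z)]
  have : (Fin.snoc par z ∘ Sum.elim (fun _ => Fin.last n) Fin.castSucc : Unit ⊕ Fin n → V)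
      = Sum.elim (fun _ => z) par := by
    funext x; rcases x with x | x <;> simp
  rw [← this]

theorem repl (a : V) (P : V → V → Prop)
    (h : Dfn (fun v : Bool → V => P (v false) (v true)))
    (hu : ∀ x, mm x a → ∃! y, P x y) :
    ∃ b : V, ∀ y, mm y b ↔ ∃ x, mm x a ∧ P x y := by
  obtain ⟨n, par, ψ, hψ⟩ := h.fin_par
  let χ : memLang.Formula (Fin (n + 2)) := ψ.relabel (Sum.elim (fun t : Bool => if t then
      Fin.last (n+1) else (Fin.last n).castSucc) (fun i => i.castSucc.castSucc))
  have key : ∀ x y : V, (Formula.Realize χ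
      (Fin.snoc (Fin.snoc par x : Fin (n+1) → V) y : Fin (n+2) → V)) ↔ P x y := by
    intro x y
    rw [Formula.realize_relabel]
    have : ((Fin.snoc (Fin.snoc par x : Fin (n+1) → V) y : Fin (n+2) → V) ∘
      Sum.elim (fun t : Bool => if t then
      Fin.last (n+1) else (Fin.last n).castSucc) (fun i => i.castSucc.castSucc))
      = Sum.elim (fun t : Bool => if t then y else x) par := by
      funext t; rcases t with (_ | _) | t <;> simp
    rw [this, hψ]
    simp
  obtain ⟨b, hb, hb'⟩ := hM.out.2.2.2.2.2.2.1 n χ par a a.2 (fun x hx => by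
    obtain ⟨y, hy, hy'⟩ := hu x hx
    exact ⟨y, (key x y).2 hy, fun z hz => hy' z ((key x z).1 hz)⟩)
  refine ⟨⟨b, hb⟩, fun y => (hb' y).trans ?_⟩
  exact exists_congr fun x => and_congr Iff.rfl (key x y)

/-- unordered pair -/
def up (a b : V) : V := ⟨{a.1, b.1}, hM.out.2.2.1 _ a.2 _ b.2⟩

theorem mm_up {a b z : V} : mm z (up a b) ↔ z = a ∨ z = b := by
  simp [mm, up, Subtype.ext_iff]

/-- ordered pair -/
def pr (a b : V) : V := ⟨ZFSet.pair a b, by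
  have : ZFSet.pair a b = (up (up a a) (up a b) : V).1 := by
    simp [up, ZFSet.pair]
  rw [this]; exact Subtype.property _⟩

theorem pr_eq (a b : V) : pr a b = up (up a a) (up a b) := by
  apply Subtype.ext; simp [pr, up, ZFSet.pair]

theorem pr_inj {a b c d : V} : pr a b = pr c d ↔ a = c ∧ b = d := by
  simp [pr, Subtype.ext_iff, ZFSet.pair_inj]

theorem DF.up {α : Type} {s t : (α → V) → V} (hs : DF s) (ht : DF t) :
    DF (fun v => up (s v) (t v)) := by
  have : Dfn (fun w : Option α → V => ∀ z, mm z (w none) ↔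
    (z = s (fun i => w (some i)) ∨ z = t (fun i => w (some i)))) := by
    apply Dfn.all
    apply Dfn.iff
    · exact Dfn.mm_var _ _
    · apply Dfn.or
      · exact Dfn.eq (DF.var _) (hs.ren (fun i => some (some i)))
      · exact Dfn.eq (DF.var _) (ht.ren (fun i => some (some i)))
  refine this.congr fun w => ?_
  constructor
  · intro h; apply mext; intro z; rw [h, mm_up]
  · intro h z; rw [h, mm_up]

theorem DF.pr {α : Type} {s t : (α → V) → V} (hs : DF s) (ht : DF t) :
    DF (fun v => pr (s v) (t v)) := by
  simp only [pr_eq]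
  exact DF.up (DF.up hs hs) (DF.up hs ht)

theorem ex_union (a : V) : ∃ b : V, ∀ z, mm z b ↔ ∃ y, mm y a ∧ mm z y := by
  refine ⟨⟨_, hM.out.2.2.2.1 _ a.2⟩, fun z => ?_⟩
  simp only [mm, ZFSet.mem_sUnion]
  exact ⟨fun ⟨y, h, h'⟩ => ⟨⟨y, trans_mem a.2 h⟩, h, h'⟩, fun ⟨y, h, h'⟩ => ⟨y, h, h'⟩⟩

theorem ex_un (a b : V) : ∃ c : V, ∀ z, mm z c ↔ mm z a ∨ mm z b := by
  obtain ⟨c, hc⟩ := ex_union (up a b)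
  refine ⟨c, fun z => ?_⟩
  rw [hc]; simp [mm_up]

theorem ex_pow (a : V) : ∃ b : V, ∀ z, mm z b ↔ ∀ y, mm y z → mm y a := by
  obtain ⟨b, hb, h⟩ := hM.out.2.2.2.2.1 _ a.2
  refine ⟨⟨b, hb⟩, fun z => (h z z.2).trans ?_⟩
  exact ⟨fun h y hy => h hy, fun h y hy => h ⟨y, trans_mem z.2 hy⟩ hy⟩

/-- a set containing the product -/
theorem ex_prod (a b : V) : ∃ c : V, ∀ x y, mm x a → mm y b → mm (pr x y) c := by
  obtain ⟨u, hu⟩ := ex_un a b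
  obtain ⟨p, hp⟩ := ex_pow u
  obtain ⟨q, hq⟩ := ex_pow p
  refine ⟨q, fun x y hx hy => ?_⟩
  rw [hq, pr_eq]
  intro z hz
  rw [hp]
  intro w hw
  rw [hu]
  rw [mm_up] at hz
  rcases hz with rfl | rfl <;> rw [mm_up] at hw <;> rcases hw with rfl | rfl <;> simp [*]

def Tr (t : V) : Prop := ∀ x y : V, mm x t → mm y x → mm y t

theorem mm_wf : WellFounded (mm : V → V → Prop) :=
  InvImage.wf (fun x : V => (x : ZFSet)) ZFSet.mem_wf

/-- `t` is the transitive closure of `b`. -/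
def IsTC (b t : V) : Prop := (Tr t ∧ ∀ x, mm x b → mm x t) ∧
    ∀ t', (Tr t' ∧ ∀ x, mm x b → mm x t') → ∀ x, mm x t → mm x t'

theorem ex_min_tc (b t : V) (ht : Tr t) (ht' : ∀ x, mm x b → mm x t) : ∃ s, IsTC b s := by
  obtain ⟨s, hs⟩ := sep t (fun z => ∀ t', (Tr t' ∧ ∀ x, mm x b → mm x t') → mm z t') (by
    simp only [Tr]
    repeat' first | apply Dfn.all | apply Dfn.and | apply Dfn.imp | apply Dfn.mm_var | exact Dfn.mem (DF.const _) (DF.var _) | exact Dfn.mem (DF.var _) (DF.const _))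
  refine ⟨s, ⟨⟨fun x y hx hy => ?_, fun x hx => ?_⟩, fun t' h' x hx => ((hs x).1 hx).2 _ h'⟩⟩
  · rw [hs] at hx ⊢
    exact ⟨ht _ _ hx.1 hy, fun t' h' => h'.1 _ _ (hx.2 t' h') hy⟩
  · rw [hs]
    exact ⟨ht' _ hx, fun t' h' => h'.2 _ hx⟩

theorem ex_tc (a : V) : ∃ t : V, Tr t ∧ ∀ x, mm x a → mm x t := by
  refine mm_wf.induction (C := fun a : V => ∃ t : V, Tr t ∧ ∀ x, mm x a → mm x t) a ?_
  intro a ih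
  obtain ⟨c, hc⟩ := repl a IsTC (by
    simp only [IsTC, Tr]
    repeat' first | apply Dfn.all | apply Dfn.and | apply Dfn.imp | apply Dfn.mm_var) (by
    intro b hb
    obtain ⟨t, ht, ht'⟩ := ih b hb
    obtain ⟨s, hs⟩ := ex_min_tc b t ht ht'
    refine ⟨s, hs, ?_⟩
    rintro s' hs'
    apply mext
    intro z
    exact ⟨hs'.2 _ hs.1 _, hs.2 _ hs'.1 _⟩)
  obtain ⟨d, hd⟩ := ex_union c
  obtain ⟨t, ht⟩ := ex_un a d
  refine ⟨t, fun x y hx hy => ?_, fun x hx => (ht x).2 (Or.inl hx)⟩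
  rw [ht] at hx ⊢
  right
  rw [hd]
  rcases hx with hx | hx
  · obtain ⟨s, hs, hs'⟩ := ih x hx
    obtain ⟨s, hs⟩ := ex_min_tc x s hs hs'
    exact ⟨s, (hc s).2 ⟨x, hx, hs⟩, hs.1.2 _ hy⟩
  · rw [hd] at hx
    obtain ⟨s, hs, hxs⟩ := hx
    obtain ⟨b, hb, hQ⟩ := (hc s).1 hs
    exact ⟨s, hs, hQ.1.1 _ _ hxs hy⟩

theorem Dfn.sub3 {Q : V → V → V → Prop}
    (h : Dfn (fun v : Fin 3 → V => Q (v 0) (v 1) (v 2)))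
    {α : Type} {s t x : (α → V) → V} (hs : DF s) (ht : DF t) (hx : DF x) :
    Dfn (fun v => Q (s v) (t v) (x v)) := by
  refine hs.subst1 (P := fun v a => Q a (t v) (x v)) ?_
  refine (ht.ren _).subst1 (P := fun w a => Q (w none) a (x (fun i => w (some i)))) ?_
  refine (hx.ren (fun i => some (some i))).subst1
    (P := fun w a => Q (w (some none)) (w none) a) ?_
  exact h.ren ![some (some none), some none, none]

theorem Dfn.sub4 {Q : V → V → V → V → Prop}
    (h : Dfn (fun v : Fin 4 → V => Q (v 0) (v 1) (v 2) (v 3)))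
    {α : Type} {s t x y : (α → V) → V} (hs : DF s) (ht : DF t) (hx : DF x) (hy : DF y) :
    Dfn (fun v => Q (s v) (t v) (x v) (y v)) := by
  refine hs.subst1 (P := fun v a => Q a (t v) (x v) (y v)) ?_
  refine (ht.ren _).subst1 (P := fun w a => Q (w none) a (x (fun i => w (some i)))
    (y (fun i => w (some i)))) ?_
  refine (hx.ren (fun i => some (some i))).subst1
    (P := fun w a => Q (w (some none)) (w none) a (y (fun i => w (some (some i))))) ?_
  refine (hy.ren (fun i => some (some (some i)))).subst1
    (P := fun w a => Q (w (some (some none))) (w (some none)) (w none) a) ?_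
  exact h.ren ![some (some (some none)), some (some none), some none, none]

/-- `c` is in the domain of the name `a`. -/
def Dm (c a : V) : Prop := ∃ r, mm (pr c r) a

theorem mm_pr (c r : V) : mm c (up c c) ∧ mm (up c c) (pr c r) := by
  rw [pr_eq]; simp [mm_up]

theorem Tr.dm {t a c : V} (ht : Tr t) (ha : mm a t) (h : Dm c a) : mm c t := by
  obtain ⟨r, hr⟩ := h
  exact ht _ _ (ht _ _ (ht _ _ ha hr) (mm_pr c r).2) (mm_pr c r).1

theorem dm_wf : WellFounded (Dm : V → V → Prop) := by
  refine Subrelation.wf (r := Relation.TransGen mm) ?_ mm_wf.transGen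
  rintro c a ⟨r, hr⟩
  exact ((Relation.TransGen.single (mm_pr c r).1).tail (mm_pr c r).2).tail hr

theorem ex_tc' (a : V) : ∃ t : V, Tr t ∧ mm a t := by
  obtain ⟨t, ht, h⟩ := ex_tc (up a a)
  exact ⟨t, ht, h _ (by simp [mm_up])⟩

variable (V) in
/-- Forcing notions inside the model. -/
structure PO where
  C : V
  L : V
  refl : ∀ p, mm p C → mm (pr p p) L
  trans : ∀ p q r, mm (pr p q) L → mm (pr q r) L → mm (pr p r) L
  dom : ∀ p q, mm (pr p q) L → mm p C ∧ mm q C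

def PO.le (A : PO V) (p q : V) : Prop := mm (pr p q) A.L

theorem PO.tr (A : PO V) {p q r : V} (h : A.le p q) (h' : A.le q r) : A.le p r := A.trans _ _ _ h h'

def HE (A B : PO V) (X : V → V → V → V → Prop) (p q a b : V) : Prop :=
  ∀ c r, mm (pr c r) a → ∀ p', A.le p' p → A.le p' r → ∀ q', B.le q' q →
    ∃ p'', A.le p'' p' ∧ ∃ q'', B.le q'' q' ∧ ∃ d s, mm (pr d s) b ∧ B.le q'' s ∧ X p'' q'' c d

def PhE (A B : PO V) (X : V → V → V → V → Prop) (p q a b : V) : Prop :=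
  HE A B X p q a b ∧ HE B A (fun q p b a => X p q a b) q p b a

def E (A B : PO V) (p q a b : V) : Prop :=
  ∃ R, mm (pr (pr p q) (pr a b)) R ∧ ∀ p q a b, mm (pr (pr p q) (pr a b)) R →
    PhE A B (fun p q a b => mm (pr (pr p q) (pr a b)) R) p q a b

theorem HE.mono {A B : PO V} {X Y : V → V → V → V → Prop} {p q a b : V}
    (h : ∀ p q c d, mm p A.C → mm q B.C → Dm c a → Dm d b → X p q c d → Y p q c d)
    (hX : HE A B X p q a b) : HE A B Y p q a b := by
  intro c r hc p' h1 h2 q' h3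
  obtain ⟨p'', h4, q'', h5, d, s, h6, h7, h8⟩ := hX c r hc p' h1 h2 q' h3
  exact ⟨p'', h4, q'', h5, d, s, h6, h7,
    h _ _ _ _ (A.dom _ _ h4).1 (B.dom _ _ h5).1 ⟨_, hc⟩ ⟨_, h6⟩ h8⟩

theorem PhE.mono {A B : PO V} {X Y : V → V → V → V → Prop} {p q a b : V}
    (h : ∀ p q c d, mm p A.C → mm q B.C → Dm c a → Dm d b → X p q c d → Y p q c d)
    (hX : PhE A B X p q a b) : PhE A B Y p q a b :=
  ⟨hX.1.mono h, hX.2.mono fun _ _ _ _ h1 h2 h3 h4 => h _ _ _ _ h2 h1 h4 h3⟩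

theorem HE.down {A B : PO V} {X : V → V → V → V → Prop} {p q a b p' q' : V}
    (hX : HE A B X p q a b) (hp : A.le p' p) (hq : B.le q' q) : HE A B X p' q' a b :=
  fun c r hc p'' h1 h2 q'' h3 => hX c r hc p'' (A.tr h1 hp) h2 q'' (B.tr h3 hq)

theorem E.unfold {A B : PO V} {p q a b : V} (h : E A B p q a b) : PhE A B (E A B) p q a b := by
  obtain ⟨R, h1, h2⟩ := h
  exact (h2 _ _ _ _ h1).mono fun p q c d _ _ _ _ h => ⟨R, h, h2⟩

theorem E.dfn (A B : PO V) : Dfn (fun v : Fin 4 → V => E A B (v 0) (v 1) (v 2) (v 3)) := by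
  simp only [E, PhE, HE, PO.le]
  with_reducible repeat' first | apply Dfn.all | apply Dfn.ex | apply Dfn.and | apply Dfn.imp | apply Dfn.mem | exact DF.var _ | apply DF.pr | exact DF.const _

theorem E.fold {A B : PO V} {p q a b : V} (hp : mm p A.C) (hq : mm q B.C)
    (h : PhE A B (E A B) p q a b) : E A B p q a b := by
  obtain ⟨T, hT, haT⟩ := ex_tc' a
  obtain ⟨U, hU, hbU⟩ := ex_tc' b
  obtain ⟨S1, hS1⟩ := ex_prod A.C B.C
  obtain ⟨S2, hS2⟩ := ex_prod T U
  obtain ⟨S, hS⟩ := ex_prod S1 S2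
  obtain ⟨R, hR⟩ := sep S (fun u => ∃ p' q' a' b', u = pr (pr p' q') (pr a' b') ∧ mm a' T ∧ mm b' U ∧
    (E A B p' q' a' b' ∨ u = pr (pr p q) (pr a b))) (by
    with_reducible repeat' first | apply Dfn.ex | apply Dfn.and | apply Dfn.or | apply Dfn.mem | apply Dfn.eq | apply (E.dfn A B).sub4 | exact DF.var _ | apply DF.pr | exact DF.const _)
  refine ⟨R, (hR _).2 ⟨hS _ _ (hS1 _ _ hp hq) (hS2 _ _ haT hbU), p, q, a, b, rfl, haT, hbU, Or.inr rfl⟩, ?_⟩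
  intro p' q' a' b' h'
  obtain ⟨-, p1, q1, a1, b1, e, ha, hb, h'⟩ := (hR _).1 h'
  simp only [pr_inj] at e h'
  obtain ⟨⟨rfl, rfl⟩, rfl, rfl⟩ := e
  have : PhE A B (E A B) p' q' a' b' := by
    rcases h' with h' | ⟨⟨rfl, rfl⟩, rfl, rfl⟩
    · exact h'.unfold
    · exact h
  refine this.mono fun p2 q2 c d hp2 hq2 hc hd hE => (hR _).2 ?_
  have hc' := hT.dm ha hc
  have hd' := hU.dm hb hd
  exact ⟨hS _ _ (hS1 _ _ hp2 hq2) (hS2 _ _ hc' hd'), p2, q2, c, d, rfl, hc', hd', Or.inl hE⟩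

/-! Check-forcing -/

def PhF (A : PO V) (X : V → V → V → Prop) (p a y : V) : Prop :=
  (∀ z, mm z y → ∀ p', A.le p' p → ∃ p'', A.le p'' p' ∧ ∃ c r, mm (pr c r) a ∧ A.le p'' r ∧ X p'' c z) ∧
  (∀ c r, mm (pr c r) a → ∀ p', A.le p' p → A.le p' r → ∃ p'', A.le p'' p' ∧ ∃ z, mm z y ∧ X p'' c z)

def F (A : PO V) (p a y : V) : Prop :=
  ∃ R, mm (pr p (pr a y)) R ∧ ∀ p a y, mm (pr p (pr a y)) R →
    PhF A (fun p a y => mm (pr p (pr a y)) R) p a y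

theorem PhF.mono {A : PO V} {X Y : V → V → V → Prop} {p a y : V}
    (h : ∀ p c z, mm p A.C → Dm c a → mm z y → X p c z → Y p c z)
    (hX : PhF A X p a y) : PhF A Y p a y := by
  constructor
  · intro z hz p' h1
    obtain ⟨p'', h2, c, r, h3, h4, h5⟩ := hX.1 z hz p' h1
    exact ⟨p'', h2, c, r, h3, h4, h _ _ _ (A.dom _ _ h2).1 ⟨_, h3⟩ hz h5⟩
  · intro c r hc p' h1 h2
    obtain ⟨p'', h3, z, h4, h5⟩ := hX.2 c r hc p' h1 h2
    exact ⟨p'', h3, z, h4, h _ _ _ (A.dom _ _ h3).1 ⟨_, hc⟩ h4 h5⟩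

theorem F.unfold {A : PO V} {p a y : V} (h : F A p a y) : PhF A (F A) p a y := by
  obtain ⟨R, h1, h2⟩ := h
  exact (h2 _ _ _ h1).mono fun p c z _ _ _ h => ⟨R, h, h2⟩

theorem F.dfn (A : PO V) : Dfn (fun v : Fin 3 → V => F A (v 0) (v 1) (v 2)) := by
  simp only [F, PhF, PO.le]
  with_reducible repeat' first | apply Dfn.all | apply Dfn.ex | apply Dfn.and | apply Dfn.imp | apply Dfn.mem | exact DF.var _ | apply DF.pr | exact DF.const _

theorem F.fold {A : PO V} {p a y : V} (hp : mm p A.C)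
    (h : PhF A (F A) p a y) : F A p a y := by
  obtain ⟨T, hT, haT⟩ := ex_tc' a
  obtain ⟨U, hU, hbU⟩ := ex_tc' y
  obtain ⟨S2, hS2⟩ := ex_prod T U
  obtain ⟨S, hS⟩ := ex_prod A.C S2
  obtain ⟨R, hR⟩ := sep S (fun u => ∃ p' a' y', u = pr p' (pr a' y') ∧ mm a' T ∧ mm y' U ∧
    (F A p' a' y' ∨ u = pr p (pr a y))) (by
    with_reducible repeat' first | apply Dfn.ex | apply Dfn.and | apply Dfn.or | apply Dfn.mem | apply Dfn.eq | apply (F.dfn A).sub3 | exact DF.var _ | apply DF.pr | exact DF.const _)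
  refine ⟨R, (hR _).2 ⟨hS _ _ hp (hS2 _ _ haT hbU), p, a, y, rfl, haT, hbU, Or.inr rfl⟩, ?_⟩
  intro p' a' y' h'
  obtain ⟨-, p1, a1, b1, e, ha, hb, h'⟩ := (hR _).1 h'
  simp only [pr_inj] at e h'
  obtain ⟨rfl, rfl, rfl⟩ := e
  have : PhF A (F A) p' a' y' := by
    rcases h' with h' | ⟨rfl, rfl, rfl⟩
    · exact h'.unfold
    · exact h
  refine this.mono fun p2 c d hp2 hc hd hE => (hR _).2 ?_
  have hc' := hT.dm ha hc
  have hd' := hU _ _ hb hd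
  exact ⟨hS _ _ hp2 (hS2 _ _ hc' hd'), p2, c, d, rfl, hc', hd', Or.inl hE⟩

theorem F.down {A : PO V} {p a y p' : V} (h : F A p a y) (hp : A.le p' p) : F A p' a y :=
  F.fold (A.dom _ _ hp).1 ⟨fun z hz p'' h1 => h.unfold.1 z hz p'' (A.tr h1 hp),
    fun c r hc p'' h1 h2 => h.unfold.2 c r hc p'' (A.tr h1 hp) h2⟩

theorem F.uniq {A : PO V} (a : V) : ∀ {p y y' : V}, mm p A.C → F A p a y → F A p a y' → y = y' := by
  refine dm_wf.induction (C := fun a : V => ∀ {p y y' : V}, mm p A.C → F A p a y → F A p a y' → y = y') a ?_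
  intro a ih
  have half : ∀ {p y y' : V}, mm p A.C → F A p a y → F A p a y' → ∀ z, mm z y → mm z y' := by
    intro p y y' hp h h' z hz
    obtain ⟨p', h1, c, r, h2, h3, h4⟩ := h.unfold.1 z hz p (A.refl _ hp)
    obtain ⟨p'', h5, w, h6, h7⟩ := h'.unfold.2 c r h2 p' h1 h3
    rw [ih c ⟨_, h2⟩ (A.dom _ _ h5).1 (h4.down h5) h7]
    exact h6
  intro p y y' hp h h'
  exact mext fun z => ⟨half hp h h' z, half hp h' h z⟩

/-- The key combinatorial fact. -/
theorem E.val {A B : PO V} (a : V) : ∀ {p q b : V}, mm p A.C → mm q B.C → E A B p q a b →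
    ∃ y, F A p a y ∧ F B q b y := by
  refine dm_wf.induction (C := fun a : V => ∀ {p q b : V}, mm p A.C → mm q B.C → E A B p q a b →
    ∃ y, F A p a y ∧ F B q b y) a ?_
  intro a ih p q b hp hq hE
  obtain ⟨T, hT, haT⟩ := ex_tc' a
  obtain ⟨S, hS⟩ := ex_prod A.C T
  obtain ⟨I, hI⟩ := sep S (fun u => ∃ p c, u = pr p c ∧ mm p A.C ∧ ∃ z, F A p c z) (by
    with_reducible repeat' first | apply Dfn.ex | apply Dfn.and | apply Dfn.or | apply Dfn.mem | apply Dfn.eq | apply (F.dfn A).sub3 | exact DF.var _ | apply DF.pr | exact DF.const _)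
  obtain ⟨J, hJ⟩ := repl I (fun u z => ∃ p c, u = pr p c ∧ F A p c z) (by
    with_reducible repeat' first | apply Dfn.ex | apply Dfn.and | apply Dfn.or | apply Dfn.mem | apply Dfn.eq | apply (F.dfn A).sub3 | exact DF.var _ | apply DF.pr | exact DF.const _) (by
    intro u hu
    obtain ⟨-, p, c, rfl, hp, z, hz⟩ := (hI u).1 hu
    refine ⟨z, ⟨p, c, rfl, hz⟩, ?_⟩
    rintro z' ⟨p', c', e, hz'⟩
    obtain ⟨rfl, rfl⟩ := pr_inj.1 e
    exact F.uniq _ hp hz' hz)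
  obtain ⟨y, hy⟩ := sep J (fun z => ∃ c r p', mm (pr c r) a ∧ A.le p' p ∧ A.le p' r ∧ F A p' c z) (by
    simp only [PO.le]
    with_reducible repeat' first | apply Dfn.ex | apply Dfn.and | apply Dfn.or | apply Dfn.mem | apply Dfn.eq | apply (F.dfn A).sub3 | exact DF.var _ | apply DF.pr | exact DF.const _)
  have hyA : ∀ z, mm z y ↔ ∃ c r p', mm (pr c r) a ∧ A.le p' p ∧ A.le p' r ∧ F A p' c z := by
    intro z
    rw [hy]
    refine ⟨And.right, fun h => ⟨?_, h⟩⟩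
    obtain ⟨c, r, p', h1, h2, h3, h4⟩ := h
    have hp' := (A.dom _ _ h2).1
    exact (hJ z).2 ⟨pr p' c, (hI _).2 ⟨hS _ _ hp' (hT.dm haT ⟨_, h1⟩), p', c, rfl, hp', z, h4⟩,
      p', c, rfl, h4⟩
  have E1 := hE.unfold.1
  have E2 := hE.unfold.2
  have hyB : ∀ z, mm z y ↔ ∃ c r p', mm (pr c r) b ∧ B.le p' q ∧ B.le p' r ∧ F B p' c z := by
    intro z
    rw [hyA]
    constructor
    · rintro ⟨c, r, p', h1, h2, h3, h4⟩
      obtain ⟨p'', h5, q'', h6, d, s, h7, h8, h9⟩ := E1 c r h1 p' h2 h3 q (B.refl _ hq)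
      obtain ⟨w, hw, hw'⟩ := ih c ⟨_, h1⟩ (A.dom _ _ h5).1 (B.dom _ _ h6).1 h9
      obtain rfl := F.uniq _ (A.dom _ _ h5).1 hw (h4.down h5)
      exact ⟨d, s, q'', h7, h6, h8, hw'⟩
    · rintro ⟨c, r, p', h1, h2, h3, h4⟩
      obtain ⟨p'', h5, q'', h6, d, s, h7, h8, h9⟩ := E2 c r h1 p' h2 h3 p (A.refl _ hp)
      obtain ⟨w, hw, hw'⟩ := ih d ⟨_, h7⟩ (A.dom _ _ h6).1 (B.dom _ _ h5).1 h9
      obtain rfl := F.uniq _ (B.dom _ _ h5).1 hw' (h4.down h5)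
      exact ⟨d, s, q'', h7, h6, h8, hw⟩
  refine ⟨y, F.fold hp ⟨?_, ?_⟩, F.fold hq ⟨?_, ?_⟩⟩
  · intro z hz p' hp'
    obtain ⟨c, r, q', h1, h2, h3, h4⟩ := (hyB z).1 hz
    obtain ⟨p'', h5, q'', h6, d, s, h7, h8, h9⟩ := E2 c r h1 q' h2 h3 p' hp'
    obtain ⟨w, hw, hw'⟩ := ih d ⟨_, h7⟩ (A.dom _ _ h6).1 (B.dom _ _ h5).1 h9
    obtain rfl := F.uniq _ (B.dom _ _ h5).1 hw' (h4.down h5)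
    exact ⟨_, h6, d, s, h7, h8, hw⟩
  · intro c r hc p' h1 h2
    obtain ⟨p'', h5, q'', h6, d, s, h7, h8, h9⟩ := E1 c r hc p' h1 h2 q (B.refl _ hq)
    obtain ⟨w, hw, hw'⟩ := ih c ⟨_, hc⟩ (A.dom _ _ h5).1 (B.dom _ _ h6).1 h9
    exact ⟨p'', h5, w, (hyB w).2 ⟨d, s, q'', h7, h6, h8, hw'⟩, hw⟩
  · intro z hz q' hq'
    obtain ⟨c, r, p', h1, h2, h3, h4⟩ := (hyA z).1 hz
    obtain ⟨p'', h5, q'', h6, d, s, h7, h8, h9⟩ := E1 c r h1 p' h2 h3 q' hq'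
    obtain ⟨w, hw, hw'⟩ := ih c ⟨_, h1⟩ (A.dom _ _ h5).1 (B.dom _ _ h6).1 h9
    obtain rfl := F.uniq _ (A.dom _ _ h5).1 hw (h4.down h5)
    exact ⟨_, h6, d, s, h7, h8, hw'⟩
  · intro c r hc p' h1 h2
    obtain ⟨p'', h5, q'', h6, d, s, h7, h8, h9⟩ := E2 c r hc p' h1 h2 p (A.refl _ hp)
    obtain ⟨w, hw, hw'⟩ := ih d ⟨_, h7⟩ (A.dom _ _ h6).1 (B.dom _ _ h5).1 h9
    exact ⟨p'', h5, w, (hyA w).2 ⟨d, s, q'', h7, h6, h8, hw⟩, hw'⟩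

/-! Generic filters -/

def Fil (A : PO V) (g : V → Prop) : Prop :=
  (∀ p, g p → mm p A.C) ∧ (∀ p q, g p → A.le p q → g q) ∧
  (∀ p q, g p → g q → ∃ r, g r ∧ A.le r p ∧ A.le r q)

def Gen (A : PO V) (g : V → Prop) : Prop :=
  Fil A g ∧ ∀ D : V → Prop, Dfn (fun v : Unit → V => D (v ())) →
    (∀ p, mm p A.C → ∃ p', A.le p' p ∧ D p') → ∃ p, g p ∧ D p

def PG (A B : PO V) (g h : V → Prop) : Prop :=
  Fil A g ∧ Fil B h ∧ ∀ D : V → V → Prop, Dfn (fun v : Bool → V => D (v false) (v true)) →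
    (∀ p q, mm p A.C → mm q B.C → ∃ p' q', A.le p' p ∧ B.le q' q ∧ D p' q') →
    ∃ p q, g p ∧ h q ∧ D p q

theorem PG.symm {A B : PO V} {g h : V → Prop} (H : PG A B g h) : PG B A h g := by
  refine ⟨H.2.1, H.1, fun D hD hd => ?_⟩
  obtain ⟨p, q, h1, h2, h3⟩ := H.2.2 (fun p q => D q p) (hD.ren not) (fun p q hp hq => by
    obtain ⟨q', p', h1, h2, h3⟩ := hd q p hq hp
    exact ⟨p', q', h2, h1, h3⟩)
  exact ⟨q, p, h2, h1, h3⟩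

/-- `val` is the evaluation of names by `g`. -/
def IsVal (g : V → Prop) (val : V → ZFSet.{u}) : Prop :=
  ∀ a y, y ∈ val a ↔ ∃ c r, g r ∧ mm (pr c r) a ∧ val c = y

theorem F.sound {A : PO V} {g : V → Prop} (hg : Gen A g) {val : V → ZFSet.{u}} (hv : IsVal g val)
    (a : V) : ∀ {p y : V}, g p → F A p a y → val a = y := by
  refine dm_wf.induction (C := fun a : V => ∀ {p y : V}, g p → F A p a y → val a = y) a ?_
  intro a ih p y hp hF
  ext x
  rw [hv]
  constructor
  · rintro ⟨c, r, hr, hc, rfl⟩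
    obtain ⟨p', hp', h1, h2⟩ := hg.1.2.2 _ _ hp hr
    obtain ⟨p2, h3, h4⟩ := hg.2 (fun p2 => (∃ z, mm z y ∧ F A p2 c z) ∨
      ¬ ∃ p3, A.le p3 p2 ∧ A.le p3 p') (by
      simp only [PO.le]
      with_reducible repeat' first | apply Dfn.ex | apply Dfn.and | apply Dfn.or | apply Dfn.not | apply Dfn.mem | apply Dfn.eq | apply (F.dfn A).sub3 | exact DF.var _ | apply DF.pr | exact DF.const _) (by
      intro p0 hp0
      by_cases H : ∃ p3, A.le p3 p0 ∧ A.le p3 p'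
      · obtain ⟨p3, h3, h4⟩ := H
        obtain ⟨p4, h5, z, h6, h7⟩ := hF.unfold.2 c r hc p3 (A.tr h4 h1) (A.tr h4 h2)
        exact ⟨p4, A.tr h5 h3, Or.inl ⟨z, h6, h7⟩⟩
      · exact ⟨p0, A.refl _ hp0, Or.inr H⟩)
    rcases h4 with ⟨z, hz, hFz⟩ | H
    · rw [ih c ⟨_, hc⟩ h3 hFz]; exact hz
    · obtain ⟨r, -, h5, h6⟩ := hg.1.2.2 _ _ h3 hp'
      exact absurd ⟨r, h5, h6⟩ H
  · intro hx
    obtain ⟨z, rfl⟩ : ∃ z : V, z.1 = x := ⟨⟨x, trans_mem y.2 hx⟩, rfl⟩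
    obtain ⟨p2, h3, h4⟩ := hg.2 (fun p2 => (∃ c r, mm (pr c r) a ∧ A.le p2 r ∧ F A p2 c z) ∨
      ¬ ∃ p3, A.le p3 p2 ∧ A.le p3 p) (by
      simp only [PO.le]
      with_reducible repeat' first | apply Dfn.ex | apply Dfn.and | apply Dfn.or | apply Dfn.not | apply Dfn.mem | apply Dfn.eq | apply (F.dfn A).sub3 | exact DF.var _ | apply DF.pr | exact DF.const _) (by
      intro p0 hp0
      by_cases H : ∃ p3, A.le p3 p0 ∧ A.le p3 p
      · obtain ⟨p3, h3, h4⟩ := H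
        obtain ⟨p4, h5, h6⟩ := hF.unfold.1 z hx p3 h4
        exact ⟨p4, A.tr h5 h3, Or.inl h6⟩
      · exact ⟨p0, A.refl _ hp0, Or.inr H⟩)
    rcases h4 with ⟨c, r, hc, hr, hFz⟩ | H
    · exact ⟨c, r, hg.1.2.1 _ _ h3 hr, hc, ih c ⟨_, hc⟩ h3 hFz⟩
    · obtain ⟨r, -, h5, h6⟩ := hg.1.2.2 _ _ h3 hp
      exact absurd ⟨r, h5, h6⟩ H

def NE (A B : PO V) (X : V → V → V → V → Prop) (p q a b : V) : Prop :=
  ∃ c r, mm (pr c r) a ∧ A.le p r ∧ ∀ p' q' d s, A.le p' p → B.le q' q → mm (pr d s) b →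
    B.le q' s → ¬ X p' q' c d

theorem not_HE {A B : PO V} {X : V → V → V → V → Prop} {p q a b : V} (h : ¬ HE A B X p q a b) :
    ∃ p' q', A.le p' p ∧ B.le q' q ∧ NE A B X p' q' a b := by
  simp only [HE] at h
  push Not at h
  obtain ⟨c, r, h1, p', h2, h3, q', h4, h5⟩ := h
  exact ⟨p', q', h2, h4, c, r, h1, h3, fun p2 q2 d s h6 h7 h8 h9 => h5 p2 h6 q2 h7 d s h8 h9⟩

/-- one inclusion in the soundness of `E`. -/
theorem HE.sound {A B : PO V} {g h : V → Prop} (hg : PG A B g h) {v w : V → ZFSet.{u}}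
    (hv : IsVal g v) (hw : IsVal h w) {X : V → V → V → V → Prop}
    (hX : Dfn (fun v : Fin 4 → V => X (v 0) (v 1) (v 2) (v 3))) {a b p q : V}
    (ih : ∀ c d p q, Dm c a → Dm d b → g p → h q → X p q c d → v c = w d)
    (hp : g p) (hq : h q) (H : HE A B X p q a b) : v a ⊆ w b := by
  intro x hx
  obtain ⟨c, r, hr, hc, rfl⟩ := (hv _ _).1 hx
  obtain ⟨p', hp', h1, h2⟩ := hg.1.2.2 _ _ hp hr
  obtain ⟨p2, q2, h3, h4, h5⟩ := hg.2.2 (fun p2 q2 =>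
    (∃ d s, mm (pr d s) b ∧ B.le q2 s ∧ X p2 q2 c d) ∨
      ¬ ∃ p3 q3, A.le p3 p2 ∧ A.le p3 p' ∧ B.le q3 q2 ∧ B.le q3 q) (by
    simp only [PO.le]
    with_reducible repeat' first | apply Dfn.ex | apply Dfn.and | apply Dfn.or | apply Dfn.not | apply Dfn.mem | apply Dfn.eq | apply hX.sub4 | exact DF.var _ | apply DF.pr | exact DF.const _) (by
    intro p0 q0 hp0 hq0
    by_cases K : ∃ p3 q3, A.le p3 p0 ∧ A.le p3 p' ∧ B.le q3 q0 ∧ B.le q3 q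
    · obtain ⟨p3, q3, h3, h4, h5, h6⟩ := K
      obtain ⟨p4, h7, q4, h8, h9⟩ := H c r hc p3 (A.tr h4 h1) (A.tr h4 h2) q3 h6
      exact ⟨p4, q4, A.tr h7 h3, B.tr h8 h5, Or.inl h9⟩
    · exact ⟨p0, q0, A.refl _ hp0, B.refl _ hq0, Or.inr K⟩)
  rcases h5 with ⟨d, s, hd, hs, hx⟩ | K
  · rw [hw]
    exact ⟨d, s, hg.2.1.2.1 _ _ h4 hs, hd, (ih c d _ _ ⟨_, hc⟩ ⟨_, hd⟩ h3 h4 hx).symm⟩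
  · obtain ⟨p3, -, h5, h6⟩ := hg.1.2.2 _ _ h3 hp'
    obtain ⟨q3, -, h7, h8⟩ := hg.2.1.2.2 _ _ h4 hq
    exact absurd ⟨p3, q3, h5, h6, h7, h8⟩ K

theorem E.sound {A B : PO V} {g h : V → Prop} (hg : PG A B g h) {v w : V → ZFSet.{u}}
    (hv : IsVal g v) (hw : IsVal h w) (a : V) :
    ∀ b p q : V, g p → h q → E A B p q a b → v a = w b := by
  refine dm_wf.induction (C := fun a : V => ∀ b p q : V, g p → h q → E A B p q a b → v a = w b) a ?_
  intro a ih b p q hp hq H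
  have H := H.unfold
  refine subset_antisymm
    (HE.sound hg hv hw (E.dfn A B) (fun c d p q hc _ hp hq hX => ih c hc d p q hp hq hX) hp hq H.1)
    (HE.sound hg.symm hw hv ((E.dfn A B).ren ![1, 0, 3, 2])
      (fun c d p q _ hd hp hq hX => (ih d hd c q p hq hp hX).symm) hq hp H.2)

theorem NE.absurd {A B : PO V} {g h : V → Prop} (hg : PG A B g h) {v w : V → ZFSet.{u}}
    (hv : IsVal g v) (hw : IsVal h w) {X : V → V → V → V → Prop} {a b p q : V}
    (hX : ∀ p q a b p' q', X p q a b → A.le p' p → B.le q' q → X p' q' a b)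
    (ih : ∀ c d, Dm c a → Dm d b → v c = w d → ∃ p q, g p ∧ h q ∧ X p q c d)
    (hp : g p) (hq : h q) (H : NE A B X p q a b) (he : v a = w b) : False := by
  obtain ⟨c, r, hc, hr, H⟩ := H
  have : v c ∈ w b := he ▸ (hv _ _).2 ⟨c, r, hg.1.2.1 _ _ hp hr, hc, rfl⟩
  obtain ⟨d, s, hs, hd, e⟩ := (hw _ _).1 this
  obtain ⟨p1, q1, h1, h2, h3⟩ := ih c d ⟨_, hc⟩ ⟨_, hd⟩ e.symm
  obtain ⟨p2, h4, h5, h6⟩ := hg.1.2.2 _ _ hp h1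
  obtain ⟨q2, h7, h8, h9⟩ := hg.2.1.2.2 _ _ hq h2
  obtain ⟨q3, h10, h11, h12⟩ := hg.2.1.2.2 _ _ h7 hs
  exact H p2 q3 d s h5 (B.tr h11 h8) hd h12 (hX _ _ _ _ _ _ h3 h6 (B.tr h11 h9))

theorem E.down {A B : PO V} (p q a b p' q' : V) (h : E A B p q a b) (hp : A.le p' p)
    (hq : B.le q' q) : E A B p' q' a b :=
  E.fold (A.dom _ _ hp).1 (B.dom _ _ hq).1 ⟨h.unfold.1.down hp hq, h.unfold.2.down hq hp⟩

theorem not_E {A B : PO V} {p q a b : V} (hp : mm p A.C) (hq : mm q B.C)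
    (h : ¬ E A B p q a b) : ∃ p' q', A.le p' p ∧ B.le q' q ∧
      (NE A B (E A B) p' q' a b ∨ NE B A (fun q p b a => E A B p q a b) q' p' b a) := by
  by_cases h1 : HE A B (E A B) p q a b
  · have h2 : ¬ HE B A (fun q p b a => E A B p q a b) q p b a := fun h2 => h (E.fold hp hq ⟨h1, h2⟩)
    obtain ⟨q', p', h3, h4, h5⟩ := not_HE h2
    exact ⟨p', q', h4, h3, Or.inr h5⟩
  · obtain ⟨p', q', h3, h4, h5⟩ := not_HE h1
    exact ⟨p', q', h3, h4, Or.inl h5⟩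

theorem E.truth {A B : PO V} {g h : V → Prop} (hg : PG A B g h) {v w : V → ZFSet.{u}}
    (hv : IsVal g v) (hw : IsVal h w) (a : V) :
    ∀ b : V, v a = w b → ∃ p q, g p ∧ h q ∧ E A B p q a b := by
  refine dm_wf.induction (C := fun a : V => ∀ b : V, v a = w b → ∃ p q, g p ∧ h q ∧ E A B p q a b) a ?_
  intro a ih b he
  obtain ⟨p, q, hp, hq, H⟩ := hg.2.2 (fun p q => E A B p q a b ∨ NE A B (E A B) p q a b ∨
      NE B A (fun q p b a => E A B p q a b) q p b a) (by
    simp only [NE, PO.le]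
    with_reducible repeat' first | apply Dfn.all | apply Dfn.ex | apply Dfn.and | apply Dfn.or | apply Dfn.not | apply Dfn.imp | apply Dfn.mem | apply Dfn.eq | apply (E.dfn A B).sub4 | exact DF.var _ | apply DF.pr | exact DF.const _) (by
    intro p q hp hq
    by_cases K : E A B p q a b
    · exact ⟨p, q, A.refl _ hp, B.refl _ hq, Or.inl K⟩
    · obtain ⟨p', q', h1, h2, h3⟩ := not_E hp hq K
      exact ⟨p', q', h1, h2, Or.inr h3⟩)
  rcases H with H | H | H
  · exact ⟨p, q, hp, hq, H⟩
  · exact (H.absurd hg hv hw E.down (fun c d hc _ e => ih c hc d e) hp hq he).elim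
  · refine (NE.absurd (X := fun q p b a => E A B p q a b) hg.symm hw hv (fun _ _ _ _ _ _ h h1 h2 => E.down _ _ _ _ _ _ h h2 h1)
      (fun d c _ hc e => ?_) hq hp H he.symm).elim
    obtain ⟨p, q, h1, h2, h3⟩ := ih c hc d e.symm
    exact ⟨q, p, h2, h1, h3⟩

theorem E.complete {A B : PO V} (p q a b : V) (hp : mm p A.C) (hq : mm q B.C)
    (hex : ∀ p q, mm p A.C → mm q B.C → ∃ g h, PG A B g h ∧ g p ∧ h q)
    (val : (V → Prop) → V → ZFSet.{u}) (hval : ∀ g, IsVal g (val g))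
    (hf : ∀ g h, PG A B g h → g p → h q → val g a = val h b) : E A B p q a b := by
  by_contra K
  obtain ⟨p', q', h1, h2, H⟩ := not_E hp hq K
  obtain ⟨g, h, hg, hp', hq'⟩ := hex p' q' (A.dom _ _ h1).1 (B.dom _ _ h2).1
  have he := hf g h hg (hg.1.2.1 _ _ hp' h1) (hg.2.1.2.1 _ _ hq' h2)
  have ih := E.truth hg (hval g) (hval h)
  rcases H with H | H
  · exact (H.absurd hg (hval g) (hval h) E.down (fun c d hc _ e => ih c d e) hp' hq' he).elim
  · refine (NE.absurd (X := fun q p b a => E A B p q a b) hg.symm (hval h) (hval g) (fun _ _ _ _ _ _ h h1 h2 => E.down _ _ _ _ _ _ h h2 h1)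
      (fun d c _ hc e => ?_) hq' hp' H he.symm).elim
    obtain ⟨p, q, h1, h2, h3⟩ := ih c d e.symm
    exact ⟨q, p, h2, h1, h3⟩

/-- Conditions of the product. -/
structure PW (A B : PO V) where
  val : V × V
  property : mm val.1 A.C ∧ mm val.2 B.C

instance (A B : PO V) : Preorder (PW A B) where
  le := fun x y => A.le y.1.1 x.1.1 ∧ B.le y.1.2 x.1.2
  le_refl := fun x => ⟨A.refl _ x.2.1, B.refl _ x.2.2⟩
  le_trans := fun _ _ _ h h' => ⟨A.tr h'.1 h.1, B.tr h'.2 h.2⟩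

theorem PG.exists (hc : V.Countable) (A B : PO V) (p q : V) (hp : mm p A.C) (hq : mm q B.C) :
    ∃ g h, PG A B g h ∧ g p ∧ h q := by
  classical
  have : Countable V := hc.to_subtype
  let : Encodable V := Encodable.ofCountable V
  let S : V → Set (PW A B) := fun d => {x | mm (pr x.1.1 x.1.2) d}
  let 𝒟 : V → Order.Cofinal (PW A B) := fun d =>
    if h : IsCofinal (S d) then ⟨S d, h⟩ else ⟨Set.univ, fun a => ⟨a, trivial, le_rfl⟩⟩
  let w : PW A B := ⟨(p, q), hp, hq⟩
  let I := Order.idealOfCofinals w 𝒟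
  have hw : w ∈ I := Order.mem_idealOfCofinals w 𝒟
  have dir : ∀ x y : PW A B, x ∈ I → y ∈ I → ∃ z : PW A B, z ∈ I ∧ x ≤ z ∧ y ≤ z := by
    intro x y hx hy
    obtain ⟨z, hz, h1, h2⟩ := I.directed x hx y hy
    exact ⟨z, hz, h1, h2⟩
  have low : ∀ x y : PW A B, y ∈ I → x ≤ y → x ∈ I := fun x y hy h => I.lower h hy
  refine ⟨fun p => ∃ x : PW A B, x ∈ I ∧ x.1.1 = p, fun q => ∃ x : PW A B, x ∈ I ∧ x.1.2 = q,
    ⟨⟨?_, ?_, ?_⟩, ⟨?_, ?_, ?_⟩, ?_⟩, ⟨w, hw, rfl⟩, ⟨w, hw, rfl⟩⟩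
  · rintro _ ⟨x, -, rfl⟩; exact x.2.1
  · rintro _ p' ⟨x, hx, rfl⟩ hle
    exact ⟨⟨(p', x.1.2), (A.dom _ _ hle).2, x.2.2⟩, low _ x hx ⟨hle, B.refl _ x.2.2⟩, rfl⟩
  · rintro _ _ ⟨x, hx, rfl⟩ ⟨y, hy, rfl⟩
    obtain ⟨z, hz, h1, h2⟩ := dir x y hx hy
    exact ⟨_, ⟨z, hz, rfl⟩, h1.1, h2.1⟩
  · rintro _ ⟨x, -, rfl⟩; exact x.2.2
  · rintro _ p' ⟨x, hx, rfl⟩ hle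
    exact ⟨⟨(x.1.1, p'), x.2.1, (B.dom _ _ hle).2⟩, low _ x hx ⟨A.refl _ x.2.1, hle⟩, rfl⟩
  · rintro _ _ ⟨x, hx, rfl⟩ ⟨y, hy, rfl⟩
    obtain ⟨z, hz, h1, h2⟩ := dir x y hx hy
    exact ⟨_, ⟨z, hz, rfl⟩, h1.2, h2.2⟩
  · intro D hD hd
    obtain ⟨P, hP⟩ := ex_prod A.C B.C
    obtain ⟨d, hdd⟩ := sep P (fun u => ∃ p q, u = pr p q ∧ D p q) (by
      apply Dfn.ex
      apply Dfn.ex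
      apply Dfn.and
      · exact Dfn.eq (DF.var _) (DF.pr (DF.var _) (DF.var _))
      · exact hD.ren (fun t => if t then none else some none))
    have hcof : IsCofinal (S d) := by
      intro x
      obtain ⟨p', q', h1, h2, h3⟩ := hd _ _ x.2.1 x.2.2
      have h1' := (A.dom _ _ h1).1
      have h2' := (B.dom _ _ h2).1
      exact ⟨⟨(p', q'), h1', h2'⟩, (hdd _).2 ⟨hP _ _ h1' h2', p', q', rfl, h3⟩, h1, h2⟩
    obtain ⟨x, hx, hxI⟩ := Order.cofinal_meets_idealOfCofinals w 𝒟 d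
    have hx : x ∈ S d := by
      have : 𝒟 d = ⟨S d, hcof⟩ := dif_pos hcof
      rw [this] at hx
      exact hx
    obtain ⟨-, p1, q1, e, h1⟩ := (hdd _).1 hx
    obtain ⟨e1, e2⟩ := pr_inj.1 e
    exact ⟨p1, q1, ⟨x, hxI, e1⟩, ⟨x, hxI, e2⟩, h1⟩

theorem mem_nameVal (G : Set ZFSet.{u}) (τ y : ZFSet.{u}) :
    y ∈ nameVal G τ ↔ ∃ σ p, p ∈ G ∧ ZFSet.pair σ p ∈ τ ∧ nameVal G σ = y := by
  have key : ∀ σ p, ZFSet.pair σ p ∈ τ → Relation.TransGen (fun x y : ZFSet.{u} => x ∈ y) σ τ ∧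
      σ ∈ ZFSet.sUnion (ZFSet.sUnion τ) := by
    intro σ p h
    have h1 : σ ∈ ({σ} : ZFSet) := by simp
    have h2 : ({σ} : ZFSet) ∈ ZFSet.pair σ p := by simp [ZFSet.pair]
    refine ⟨Relation.TransGen.tail (b := ZFSet.pair σ p) (Relation.TransGen.tail (b := {σ})
      (Relation.TransGen.single h1) h2) h, ?_⟩
    exact ZFSet.mem_sUnion.2 ⟨_, ZFSet.mem_sUnion.2 ⟨_, h, h2⟩, h1⟩
  rw [nameVal, WellFounded.fix_eq]
  rw [@ZFSet.mem_image _ (Classical.allZFSetDefinable _)]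
  constructor
  · rintro ⟨σ, hσ, e⟩
    obtain ⟨-, p, hp, h⟩ := ZFSet.mem_sep.1 hσ
    refine ⟨σ, p, hp, h, ?_⟩
    rw [dif_pos (key _ _ h).1] at e
    exact e
  · rintro ⟨σ, p, hp, h, e⟩
    refine ⟨σ, ZFSet.mem_sep.2 ⟨(key _ _ h).2, p, hp, h⟩, ?_⟩
    rw [dif_pos (key _ _ h).1]
    exact e

end Fc

namespace Fc

variable {V : Set ZFSet.{0}} [hM : Fact (IsZFCModel V)]

/-- The forcing notion seen inside the model. -/
def toPO (P : ForcingNotion) (h : P.InModel V) : PO V where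
  C := ⟨P.P, h.1⟩
  L := ⟨P.le, h.2⟩
  refl p hp := P.refl p hp
  trans p q r := P.trans p q r
  dom p q := P.le_dom p q

def ext (g : V → Prop) : Set ZFSet := {x | ∃ p : V, g p ∧ p.1 = x}

theorem ext_mem {g : V → Prop} {p : V} : p.1 ∈ ext g ↔ g p :=
  ⟨fun ⟨_, h, e⟩ => Subtype.ext e ▸ h, fun h => ⟨p, h, rfl⟩⟩

theorem isVal_nameVal (G : Set ZFSet) :
    IsVal (fun p : V => p.1 ∈ G) (fun a : V => nameVal G a) := by
  intro a y
  rw [mem_nameVal]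
  constructor
  · rintro ⟨σ, p, hp, h, e⟩
    have h0 := trans_mem a.2 h
    have h1 : ({σ, p} : ZFSet) ∈ V := trans_mem h0 (by simp [ZFSet.pair])
    have h2 : σ ∈ V := trans_mem h1 (by simp)
    have h3 : p ∈ V := trans_mem h1 (by simp)
    exact ⟨⟨σ, h2⟩, ⟨p, h3⟩, hp, h, e⟩
  · rintro ⟨c, r, hr, hc, e⟩
    exact ⟨c, r, hr, hc, e⟩

theorem isVal_ext (g : V → Prop) : IsVal g (fun a : V => nameVal (ext g) a) := by
  have := isVal_nameVal (V := V) (ext g)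
  simp only [ext_mem] at this
  exact this

theorem fil_ext {P : ForcingNotion} (h : P.InModel V) {g : V → Prop} (hg : Fil (toPO P h) g) :
    IsFilterOn P (ext g) := by
  refine ⟨?_, ?_, ?_⟩
  · rintro _ ⟨p, hp, rfl⟩; exact hg.1 p hp
  · rintro _ ⟨p, hp, rfl⟩ q hq
    have : q ∈ V := trans_mem h.1 (P.le_dom _ _ hq).2
    exact ⟨⟨q, this⟩, hg.2.1 p _ hp hq, rfl⟩
  · rintro _ ⟨p, hp, rfl⟩ _ ⟨q, hq, rfl⟩
    obtain ⟨r, hr, h1, h2⟩ := hg.2.2 _ _ hp hq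
    exact ⟨r, ⟨r, hr, rfl⟩, h1, h2⟩

theorem pg_ext {P Q : ForcingNotion} (hP : P.InModel V) (hQ : Q.InModel V) {g h : V → Prop}
    (H : PG (toPO P hP) (toPO Q hQ) g h) : IsProductGeneric V P Q (ext g) (ext h) := by
  refine ⟨fil_ext hP H.1, fil_ext hQ H.2.1, fun D hD _ hd => ?_⟩
  obtain ⟨p, q, h1, h2, h3⟩ := H.2.2 (fun p q => mm (pr p q) ⟨D, hD⟩)
    (Dfn.mem (DF.pr (DF.var _) (DF.var _)) (DF.const _)) (by
    intro p q hp hq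
    obtain ⟨p', q', h1, h2, h3⟩ := hd p hp q hq
    exact ⟨⟨p', trans_mem hP.1 (P.le_dom _ _ h2).1⟩, ⟨q', trans_mem hQ.1 (Q.le_dom _ _ h3).1⟩,
      h2, h3, h1⟩)
  exact ⟨p, ⟨p, h1, rfl⟩, q, ⟨q, h2, rfl⟩, h3⟩

theorem gen_of {P : ForcingNotion} (h : P.InModel V) {G : Set ZFSet}
    (hG : IsGenericOver V P G) : Gen (toPO P h) (fun p : V => p.1 ∈ G) := by
  refine ⟨⟨fun p hp => hG.1.1 _ hp, fun p q hp hq => hG.1.2.1 _ hp _ hq, fun p q hp hq => ?_⟩,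
    fun D hD hd => ?_⟩
  · obtain ⟨r, hr, h1, h2⟩ := hG.1.2.2 _ hp _ hq
    exact ⟨⟨r, trans_mem h.1 (hG.1.1 _ hr)⟩, hr, h1, h2⟩
  · obtain ⟨d, hd'⟩ := sep (toPO P h).C D hD
    obtain ⟨q, hq, hqd⟩ := hG.2 d d.2 (fun x hx => ((hd' ⟨x, trans_mem d.2 hx⟩).1 hx).1) (by
      intro p hp
      obtain ⟨p', h1, h2⟩ := hd ⟨p, trans_mem h.1 hp⟩ hp
      exact ⟨p', (hd' p').2 ⟨(P.le_dom _ _ h1).1, h2⟩, h1⟩)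
    exact ⟨⟨q, trans_mem d.2 hqd⟩, hq, ((hd' ⟨q, trans_mem d.2 hqd⟩).1 hqd).2⟩

end Fc

/-- if `τ₁`, `τ₂` are `P₁`- and `P₂`-names in `V` and some condition `(p,q)`
of the product `P₁ × P₂` forces `τ₁' = τ₂'` (i.e. all product-generic evaluations agree),
then there is `x ∈ V` with `p ⊩ τ₁ = x̌` and `q ⊩ τ₂ = x̌`. -/
theorem statement13 (V : Set ZFSet) (hV : IsZFCModel V) (hcount : V.Countable)
    (F₁ F₂ : ForcingNotion) (hF₁ : F₁.InModel V) (hF₂ : F₂.InModel V)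
    (τ₁ τ₂ : ZFSet) (hτ₁ : τ₁ ∈ V) (hτ₂ : τ₂ ∈ V)
    (p q : ZFSet) (hp : p ∈ F₁.P) (hq : q ∈ F₂.P)
    (hforce : ∀ G₁ G₂ : Set ZFSet, IsProductGeneric V F₁ F₂ G₁ G₂ → p ∈ G₁ → q ∈ G₂ →
      nameVal G₁ τ₁ = nameVal G₂ τ₂) :
    ∃ x ∈ V, ForcesEqCheck V F₁ p τ₁ x ∧ ForcesEqCheck V F₂ q τ₂ x := by
  have : Fact (IsZFCModel V) := ⟨hV⟩
  have hp' : p ∈ V := Fc.trans_mem hF₁.1 hp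
  have hq' : q ∈ V := Fc.trans_mem hF₂.1 hq
  have hE : Fc.E (Fc.toPO F₁ hF₁) (Fc.toPO F₂ hF₂) ⟨p, hp'⟩ ⟨q, hq'⟩ ⟨τ₁, hτ₁⟩ ⟨τ₂, hτ₂⟩ := by
    refine Fc.E.complete _ _ _ _ hp hq (Fc.PG.exists hcount _ _)
      (fun g a => nameVal (Fc.ext g) a) Fc.isVal_ext ?_
    intro g h hg hgp hhq
    exact hforce _ _ (Fc.pg_ext hF₁ hF₂ hg) ⟨_, hgp, rfl⟩ ⟨_, hhq, rfl⟩
  obtain ⟨y, h1, h2⟩ := Fc.E.val (A := Fc.toPO F₁ hF₁) (B := Fc.toPO F₂ hF₂) ⟨τ₁, hτ₁⟩ (p := ⟨p, hp'⟩)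
    (q := ⟨q, hq'⟩) (b := ⟨τ₂, hτ₂⟩) hp hq hE
  refine ⟨y, y.2, fun G hG hpG => ?_, fun G hG hqG => ?_⟩
  · exact Fc.F.sound (Fc.gen_of hF₁ hG) (Fc.isVal_nameVal G) ⟨τ₁, hτ₁⟩ (p := ⟨p, hp'⟩) hpG h1
  · exact Fc.F.sound (Fc.gen_of hF₂ hG) (Fc.isVal_nameVal G) ⟨τ₂, hτ₂⟩ (p := ⟨q, hq'⟩) hqG h2
end

section
/- If G₁ × G₂ is a generic filter for the product forcing P₁ × P₂ over V, then V[G₁] ∩ V[G₂] = V. -/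
open FirstOrder FirstOrder.Language

/-! ### A small calculus of definable relations over `V` -/

/-- `S` is definable with parameters over `V`. -/
class Dfn (V : Set ZFSet.{0}) (n : ℕ) (S : (Fin n → ZFSet.{0}) → Prop) : Prop where
  out : ∃ φ : memLang.Formula (V ⊕ Fin n), ∀ xs : Fin n → V,
    S (fun i => (xs i : ZFSet)) ↔ φ.Realize (Sum.elim id xs)

/-- `f` is a definable function over `V`. -/
class DF (V : Set ZFSet.{0}) (n : ℕ) (f : (Fin n → ZFSet.{0}) → ZFSet.{0}) : Prop where
  val : ∀ xs : Fin n → V, f (fun i => (xs i : ZFSet)) ∈ V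
  dfn : Dfn V (n + 1) (fun w => w (Fin.last n) = f (fun i => w i.castSucc))

class InV (V : Set ZFSet.{0}) (c : ZFSet.{0}) : Prop where
  out : c ∈ V

class ZModel (V : Set ZFSet.{0}) : Prop where
  out : IsZFCModel V

section calculus

variable {V : Set ZFSet.{0}} {n : ℕ}

theorem Dfn.comp {k : ℕ} {S : (Fin k → ZFSet.{0}) → Prop} (hS : Dfn V k S)
    (F : Fin k → (Fin n → ZFSet.{0}) → ZFSet.{0}) (hF : ∀ i, DF V n (F i)) :
    Dfn V n (fun v => S (fun i => F i v)) := by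
  obtain ⟨φ, hφ⟩ := hS.out
  choose ψ hψ using fun i => (hF i).dfn.out
  refine ⟨⟨Formula.iExs (Fin k)
    ((φ.relabel (Sum.elim (fun c => Sum.inl (Sum.inl c)) (fun i => Sum.inr i))) ⊓
      Formula.iInf (fun i : Fin k => (ψ i).relabel (Sum.elim (fun c => Sum.inl (Sum.inl c))
        (fun j => Fin.lastCases (motive := fun _ => (V ⊕ Fin n) ⊕ Fin k)
          (Sum.inr i) (fun j => Sum.inl (Sum.inr j)) j)))), fun xs => ?_⟩⟩
  rw [Formula.realize_iExs]
  have key : ∀ (y : Fin k → V), (Formula.Realize (M := V)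
      ((φ.relabel (Sum.elim (fun c => Sum.inl (Sum.inl c)) (fun i => Sum.inr i))) ⊓
      Formula.iInf (fun i : Fin k => (ψ i).relabel (Sum.elim (fun c => Sum.inl (Sum.inl c))
        (fun j => Fin.lastCases (motive := fun _ => (V ⊕ Fin n) ⊕ Fin k)
          (Sum.inr i) (fun j => Sum.inl (Sum.inr j)) j))))
        (Sum.elim (Sum.elim id xs) y)) ↔
      (S (fun i => (y i : ZFSet)) ∧ ∀ i, (y i : ZFSet) = F i (fun j => (xs j : ZFSet))) := by
    intro y
    rw [Formula.realize_inf, Formula.realize_relabel, Formula.realize_iInf, hφ]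
    refine and_congr ?_ (forall_congr' fun i => ?_)
    · apply iff_of_eq; congr 1
      funext s; rcases s with c | j <;> rfl
    · rw [Formula.realize_relabel]
      have := hψ i (Fin.snoc (α := fun _ => V) xs (y i))
      simp only [Fin.snoc_last, Fin.snoc_castSucc] at this
      rw [this]
      apply iff_of_eq; congr 1
      funext s; rcases s with c | j
      · rfl
      · refine Fin.lastCases ?_ (fun j => ?_) j <;> simp
  constructor
  · intro h
    refine ⟨fun i => ⟨_, (hF i).val xs⟩, (key _).2 ⟨h, fun i => rfl⟩⟩
  · rintro ⟨y, hy⟩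
    obtain ⟨h1, h2⟩ := (key y).1 hy
    have : (fun i => (y i : ZFSet)) = fun i => F i (fun j => (xs j : ZFSet)) := funext h2
    rwa [this] at h1

theorem Dfn.congr {S T : (Fin n → ZFSet.{0}) → Prop} (hS : Dfn V n S)
    (h : ∀ v, (∀ i, v i ∈ V) → (T v ↔ S v)) : Dfn V n T := by
  obtain ⟨φ, hφ⟩ := hS.out
  exact ⟨⟨φ, fun xs => (h _ fun i => (xs i).2).trans (hφ xs)⟩⟩

theorem Dfn.eqv (i j : Fin n) : Dfn V n (fun v => v i = v j) :=
  ⟨⟨Term.equal (Term.var (Sum.inr i)) (Term.var (Sum.inr j)), fun xs => by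
    rw [Formula.realize_equal]; simp [Subtype.ext_iff]⟩⟩

theorem Dfn.memv (i j : Fin n) : Dfn V n (fun v => v i ∈ v j) :=
  ⟨⟨Relations.formula₂ (L := memLang) (show memLang.Relations 2 from ())
    (Term.var (Sum.inr i)) (Term.var (Sum.inr j)), fun xs => by
    rw [Formula.realize_rel₂]; rfl⟩⟩

instance DF.var (i : Fin n) : DF V n (fun v => v i) :=
  ⟨fun xs => (xs i).2, Dfn.eqv _ _⟩

instance DF.const (c : ZFSet.{0}) [h : InV V c] : DF V n (fun _ => c) :=
  ⟨fun _ => h.out, ⟨⟨Term.equal (Term.var (Sum.inr (Fin.last n))) (Term.var (Sum.inl ⟨c, h.out⟩)),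
    fun xs => by rw [Formula.realize_equal]; simp [Subtype.ext_iff]⟩⟩⟩

instance Dfn.and {S T : (Fin n → ZFSet.{0}) → Prop} [hS : Dfn V n S] [hT : Dfn V n T] :
    Dfn V n (fun v => S v ∧ T v) := by
  obtain ⟨φ, hφ⟩ := hS.out
  obtain ⟨ψ, hψ⟩ := hT.out
  exact ⟨⟨φ ⊓ ψ, fun xs => by rw [Formula.realize_inf, hφ, hψ]⟩⟩

instance Dfn.not {S : (Fin n → ZFSet.{0}) → Prop} [hS : Dfn V n S] :
    Dfn V n (fun v => ¬ S v) := by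
  obtain ⟨φ, hφ⟩ := hS.out
  exact ⟨⟨φ.not, fun xs => by rw [Formula.realize_not, hφ]⟩⟩

instance Dfn.imp {S T : (Fin n → ZFSet.{0}) → Prop} [hS : Dfn V n S] [hT : Dfn V n T] :
    Dfn V n (fun v => S v → T v) :=
  (inferInstance : Dfn V n (fun v => ¬ (S v ∧ ¬ T v))).congr fun v _ => by tauto

instance Dfn.or {S T : (Fin n → ZFSet.{0}) → Prop} [hS : Dfn V n S] [hT : Dfn V n T] :
    Dfn V n (fun v => S v ∨ T v) :=
  (inferInstance : Dfn V n (fun v => ¬ (¬ S v ∧ ¬ T v))).congr fun v _ => by tauto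

instance Dfn.iff {S T : (Fin n → ZFSet.{0}) → Prop} [hS : Dfn V n S] [hT : Dfn V n T] :
    Dfn V n (fun v => S v ↔ T v) :=
  (inferInstance : Dfn V n (fun v => (S v → T v) ∧ (T v → S v))).congr fun v _ => by tauto

instance Dfn.mem {f g : (Fin n → ZFSet.{0}) → ZFSet.{0}} [hf : DF V n f] [hg : DF V n g] :
    Dfn V n (fun v => f v ∈ g v) :=
  (Dfn.memv (V := V) (n := 2) 0 1).comp ![f, g] (fun i => by fin_cases i <;> assumption)

instance Dfn.eq {f g : (Fin n → ZFSet.{0}) → ZFSet.{0}} [hf : DF V n f] [hg : DF V n g] :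
    Dfn V n (fun v => f v = g v) :=
  (Dfn.eqv (V := V) (n := 2) 0 1).comp ![f, g] (fun i => by fin_cases i <;> assumption)

instance Dfn.exV {S : (Fin n → ZFSet.{0}) → ZFSet.{0} → Prop}
    [hS : Dfn V (n + 1) (fun w => S (fun i => w i.castSucc) (w (Fin.last n)))] :
    Dfn V n (fun v => ∃ x, x ∈ V ∧ S v x) := by
  obtain ⟨φ, hφ⟩ := hS.out
  refine ⟨⟨Formula.iExs (Fin 1) (φ.relabel (Sum.elim (fun c => Sum.inl (Sum.inl c))
        (fun j => Fin.lastCases (motive := fun _ => (V ⊕ Fin n) ⊕ Fin 1)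
          (Sum.inr 0) (fun j => Sum.inl (Sum.inr j)) j))), fun xs => ?_⟩⟩
  rw [Formula.realize_iExs]
  have key : ∀ y : Fin 1 → V, Formula.Realize (M := V)
      (φ.relabel (Sum.elim (fun c => Sum.inl (Sum.inl c))
        (fun j => Fin.lastCases (motive := fun _ => (V ⊕ Fin n) ⊕ Fin 1)
          (Sum.inr 0) (fun j => Sum.inl (Sum.inr j)) j)))
      (Sum.elim (Sum.elim id xs) y) ↔ S (fun i => (xs i : ZFSet)) (y 0) := by
    intro y
    rw [Formula.realize_relabel]
    have := hφ (Fin.snoc (α := fun _ => V) xs (y 0))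
    simp only [Fin.snoc_last, Fin.snoc_castSucc] at this
    rw [this]
    apply iff_of_eq; congr 1
    funext s; rcases s with c | j
    · rfl
    · refine Fin.lastCases ?_ (fun j => ?_) j <;> simp
  constructor
  · rintro ⟨x, hx, h⟩
    exact ⟨fun _ => ⟨x, hx⟩, (key _).2 h⟩
  · rintro ⟨y, hy⟩
    exact ⟨y 0, (y 0).2, (key y).1 hy⟩

instance Dfn.allV {S : (Fin n → ZFSet.{0}) → ZFSet.{0} → Prop}
    [hS : Dfn V (n + 1) (fun w => S (fun i => w i.castSucc) (w (Fin.last n)))] :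
    Dfn V n (fun v => ∀ x, x ∈ V → S v x) :=
  (inferInstance : Dfn V n (fun v => ¬ ∃ x, x ∈ V ∧ ¬ S v x)).congr fun v _ => by
    push Not; rfl

theorem DF.lift {f : (Fin n → ZFSet.{0}) → ZFSet.{0}} (hf : DF V n f) :
    DF V (n + 1) (fun w => f (fun i => w i.castSucc)) :=
  ⟨fun xs => hf.val (fun i => xs i.castSucc),
    (hf.dfn.comp (n := n + 1 + 1)
      (fun j => Fin.lastCases (motive := fun _ => (Fin (n + 1 + 1) → ZFSet.{0}) → ZFSet.{0})
        (fun w => w (Fin.last _)) (fun j => fun w => w j.castSucc.castSucc) j)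
      (fun j => by
        refine Fin.lastCases ?_ (fun j => ?_) j
        · simp only [Fin.lastCases_last]; infer_instance
        · simp only [Fin.lastCases_castSucc]; infer_instance)).congr
      (fun v _ => by simp)⟩

variable [hV : ZModel V]

theorem trV {x y : ZFSet.{0}} (hx : x ∈ V) (h : y ∈ x) : y ∈ V := hV.out.1 x hx y h

instance Dfn.exB {f : (Fin n → ZFSet.{0}) → ZFSet.{0}}
    {S : (Fin n → ZFSet.{0}) → ZFSet.{0} → Prop} [hf : DF V n f]
    [hS : Dfn V (n + 1) (fun w => S (fun i => w i.castSucc) (w (Fin.last n)))] :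
    Dfn V n (fun v => ∃ x, x ∈ f v ∧ S v x) := by
  have := hf.lift
  refine (inferInstance : Dfn V n (fun v => ∃ x, x ∈ V ∧ (x ∈ f v ∧ S v x))).congr fun v hv => ?_
  constructor
  · rintro ⟨x, hx, h⟩
    exact ⟨x, trV (hf.val (fun i => ⟨v i, hv i⟩)) hx, hx, h⟩
  · rintro ⟨x, _, h⟩
    exact ⟨x, h⟩

instance Dfn.allB {f : (Fin n → ZFSet.{0}) → ZFSet.{0}}
    {S : (Fin n → ZFSet.{0}) → ZFSet.{0} → Prop} [hf : DF V n f]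
    [hS : Dfn V (n + 1) (fun w => S (fun i => w i.castSucc) (w (Fin.last n)))] :
    Dfn V n (fun v => ∀ x, x ∈ f v → S v x) :=
  (inferInstance : Dfn V n (fun v => ¬ ∃ x, x ∈ f v ∧ ¬ S v x)).congr fun v _ => by
    push Not; rfl

theorem upairV {x y : ZFSet.{0}} (hx : x ∈ V) (hy : y ∈ V) : ({x, y} : ZFSet.{0}) ∈ V :=
  hV.out.2.2.1 x hx y hy

theorem singV {x : ZFSet.{0}} (hx : x ∈ V) : ({x} : ZFSet.{0}) ∈ V := by
  rw [← ZFSet.pair_eq_singleton]; exact upairV hx hx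

theorem pairV {x y : ZFSet.{0}} (hx : x ∈ V) (hy : y ∈ V) : ZFSet.pair x y ∈ V :=
  upairV (singV hx) (upairV hx hy)

theorem pairV_left {x y : ZFSet.{0}} (h : ZFSet.pair x y ∈ V) : x ∈ V :=
  trV (trV h (y := {x}) (by simp [ZFSet.pair])) (by simp)

theorem pairV_right {x y : ZFSet.{0}} (h : ZFSet.pair x y ∈ V) : y ∈ V :=
  trV (trV h (y := {x, y}) (by simp [ZFSet.pair])) (by simp)

theorem sUnionV {x : ZFSet.{0}} (hx : x ∈ V) : ZFSet.sUnion x ∈ V :=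
  hV.out.2.2.2.1 x hx

theorem unionV {x y : ZFSet.{0}} (hx : x ∈ V) (hy : y ∈ V) : x ∪ y ∈ V := by
  rw [← ZFSet.sUnion_pair]; exact sUnionV (upairV hx hy)

instance DF.upair {f g : (Fin n → ZFSet.{0}) → ZFSet.{0}} [hf : DF V n f] [hg : DF V n g] :
    DF V n (fun v => ({f v, g v} : ZFSet.{0})) := by
  have h1 := hf.lift
  have h2 := hg.lift
  have h3 := h1.lift
  have h4 := h2.lift
  refine ⟨fun xs => upairV (hf.val xs) (hg.val xs),
    (inferInstance : Dfn V (n + 1) (fun w => (f (fun i => w i.castSucc) ∈ w (Fin.last n) ∧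
      g (fun i => w i.castSucc) ∈ w (Fin.last n)) ∧ ∀ x, x ∈ w (Fin.last n) →
        (x = f (fun i => w i.castSucc) ∨ x = g (fun i => w i.castSucc)))).congr fun v hv => ?_⟩
  constructor
  · intro h; rw [h]; simp
  · rintro ⟨⟨h1, h2⟩, h3⟩
    ext z
    simp only [ZFSet.mem_pair]
    constructor
    · exact h3 z
    · rintro (rfl | rfl) <;> assumption

instance DF.pair {f g : (Fin n → ZFSet.{0}) → ZFSet.{0}} [hf : DF V n f] [hg : DF V n g] :
    DF V n (fun v => ZFSet.pair (f v) (g v)) := by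
  have : DF V n (fun v => ({{f v, f v}, {f v, g v}} : ZFSet.{0})) := inferInstance
  simpa only [ZFSet.pair, ZFSet.pair_eq_singleton] using this

end calculus

section model

variable {V : Set ZFSet.{0}} [hV : ZModel V]

theorem finite_params {n : ℕ} (φ : memLang.Formula (V ⊕ Fin n)) :
    ∃ (m : ℕ) (par : Fin m → V) (ψ : memLang.Formula (Fin m ⊕ Fin n)),
      ∀ xs : Fin n → V, φ.Realize (Sum.elim id xs) ↔ ψ.Realize (Sum.elim par xs) := by
  classical
  let s := BoundedFormula.freeVarFinset φ
  let e := s.equivFin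
  have om : ZFSet.omega ∈ V := hV.out.2.1
  refine ⟨s.card, fun i => Sum.elim id (fun _ => ⟨_, om⟩) (e.symm i : V ⊕ Fin n),
    BoundedFormula.restrictFreeVar φ
      (fun a => Sum.elim (fun _ => Sum.inl (e a)) (fun j => Sum.inr j) (a : V ⊕ Fin n)),
    fun xs => ?_⟩
  symm
  refine BoundedFormula.realize_restrictFreeVar (Sum.elim id xs) ?_
  rintro ⟨a | j, ha⟩
  · simp
  · simp

theorem sepV {a : ZFSet.{0}} (ha : a ∈ V) (S : ZFSet.{0} → Prop)
    (hS : Dfn V 1 (fun v => S (v 0))) : ∃ b ∈ V, ∀ z, z ∈ b ↔ z ∈ a ∧ S z := by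
  obtain ⟨φ, hφ⟩ := hS.out
  obtain ⟨m, par, ψ, hψ⟩ := finite_params φ
  obtain ⟨b, hb, h⟩ := hV.out.2.2.2.2.2.1 m
    (ψ.relabel (Sum.elim (fun i => i.castSucc) (fun _ => Fin.last m))) par a ha
  have key : ∀ z : V, Formula.Realize (M := V)
      (ψ.relabel (Sum.elim (fun i => i.castSucc) (fun _ => Fin.last m)))
      (Fin.snoc (α := fun _ => V) par z) ↔ S z := by
    intro z
    rw [Formula.realize_relabel]
    refine Iff.trans ?_ (((hφ fun _ => z).trans (hψ fun _ => z))).symm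
    apply iff_of_eq; congr 1
    funext s; rcases s with c | j <;> simp
  refine ⟨b, hb, fun z => ⟨fun hz => ?_, fun hz => ?_⟩⟩
  · have := (h ⟨z, trV hb hz⟩).1 hz
    exact ⟨this.1, (key _).1 this.2⟩
  · exact (h ⟨z, trV ha hz.1⟩).2 ⟨hz.1, (key _).2 hz.2⟩

theorem replV {a : ZFSet.{0}} (ha : a ∈ V) (R : ZFSet.{0} → ZFSet.{0} → Prop)
    (hR : Dfn V 2 (fun v => R (v 0) (v 1)))
    (hf : ∀ x ∈ a, ∀ y ∈ V, ∀ y' ∈ V, R x y → R x y' → y = y') :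
    ∃ b ∈ V, ∀ y, y ∈ b ↔ y ∈ V ∧ ∃ x ∈ a, R x y := by
  have hR' : Dfn V 1 (fun v => ∃ y, y ∈ V ∧ R (v 0) y) :=
    @Dfn.exV V 1 (fun v y => R (v 0) y) hR
  obtain ⟨a', ha', hmem⟩ := sepV ha (fun x => ∃ y, y ∈ V ∧ R x y) hR'
  obtain ⟨φ, hφ⟩ := hR.out
  obtain ⟨m, par, ψ, hψ⟩ := finite_params φ
  let χ : memLang.Formula (Fin (m + 2)) :=
    (ψ.relabel (Sum.elim (fun i => i.castSucc.castSucc) ![(Fin.last m).castSucc, Fin.last (m + 1)]))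
  have key : ∀ x y : V, Formula.Realize (M := V) χ
      (Fin.snoc (α := fun _ => V) (Fin.snoc (α := fun _ => V) par x) y) ↔ R x y := by
    intro x y
    rw [Formula.realize_relabel]
    refine Iff.trans ?_ (((hφ ![x, y]).trans (hψ ![x, y]))).symm
    apply iff_of_eq; congr 1
    funext s; rcases s with c | j
    · simp
    · fin_cases j
      · simp
      · simp only [Function.comp, Sum.elim_inr]
        exact Fin.snoc_last (α := fun _ => V) _ _
  obtain ⟨b, hb, h⟩ := hV.out.2.2.2.2.2.2.1 m χ par a' ha' (by
    rintro x hx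
    obtain ⟨hxa, y, hy, hxy⟩ := (hmem x).1 hx
    exact ⟨⟨y, hy⟩, (key _ _).2 hxy, fun y' hy' =>
      Subtype.ext (hf x hxa _ y'.2 _ hy ((key _ _).1 hy') hxy)⟩)
  refine ⟨b, hb, fun y => ⟨fun hy => ?_, ?_⟩⟩
  · obtain ⟨x, hx, hxy⟩ := (h ⟨y, trV hb hy⟩).1 hy
    exact ⟨trV hb hy, x, ((hmem x).1 hx).1, (key _ _).1 hxy⟩
  · rintro ⟨hy, x, hx, hxy⟩
    exact (h ⟨y, hy⟩).2 ⟨⟨x, trV ha hx⟩, (hmem x).2 ⟨hx, y, hy, hxy⟩, (key _ _).2 hxy⟩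

theorem prodV {a b : ZFSet.{0}} (ha : a ∈ V) (hb : b ∈ V) : ZFSet.prod a b ∈ V := by
  obtain ⟨P, hP, h1⟩ := hV.out.2.2.2.2.1 _ (unionV ha hb)
  obtain ⟨Q, hQ, h2⟩ := hV.out.2.2.2.2.1 _ hP
  have : InV V a := ⟨ha⟩
  have : InV V b := ⟨hb⟩
  obtain ⟨c, hc, h⟩ := sepV hQ (fun u => ∃ x, x ∈ a ∧ ∃ y, y ∈ b ∧ u = ZFSet.pair x y)
    inferInstance
  convert hc using 1
  ext u
  rw [ZFSet.mem_prod, h]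
  refine ⟨fun hu => ⟨?_, hu⟩, fun hu => hu.2⟩
  obtain ⟨x, hx, y, hy, rfl⟩ := hu
  have hxV := trV ha hx
  have hyV := trV hb hy
  rw [h2 _ (pairV hxV hyV)]
  intro w hw
  have hw' : w = {x} ∨ w = {x, y} := by simpa [ZFSet.pair] using hw
  rw [h1 _ (trV (pairV hxV hyV) hw)]
  intro z hz
  rw [ZFSet.mem_union]
  rcases hw' with rfl | rfl
  · left; rw [ZFSet.mem_singleton] at hz; rwa [hz]
  · rcases ZFSet.mem_pair.1 hz with rfl | rfl
    · exact Or.inl hx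
    · exact Or.inr hy

/-- Transitive closures exist in `V`. -/
theorem tcV (x : ZFSet.{0}) : x ∈ V → ∃ t ∈ V, x ∈ t ∧ (∀ y, y ∈ t → ∀ z, z ∈ y → z ∈ t) ∧
    ∀ t', t' ∈ V → (x ∈ t' ∧ ∀ y, y ∈ t' → ∀ z, z ∈ y → z ∈ t') → ∀ w, w ∈ t → w ∈ t' := by
  induction x using ZFSet.inductionOn with
  | h x ih =>
  intro hx
  obtain ⟨b, hb, h⟩ := replV hx (fun x t => x ∈ t ∧ (∀ y, y ∈ t → ∀ z, z ∈ y → z ∈ t) ∧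
    ∀ t', t' ∈ V → (x ∈ t' ∧ ∀ y, y ∈ t' → ∀ z, z ∈ y → z ∈ t') → ∀ w, w ∈ t → w ∈ t')
    inferInstance (by
      rintro x - t ht t' ht' ⟨h1, h2, h3⟩ ⟨h1', h2', h3'⟩
      ext w
      exact ⟨h3 t' ht' ⟨h1', h2'⟩ w, h3' t ht ⟨h1, h2⟩ w⟩)
  refine ⟨ZFSet.sUnion b ∪ {x}, unionV (sUnionV hb) (singV hx), by simp, ?_, ?_⟩
  · intro y hy z hz
    rw [ZFSet.mem_union] at hy ⊢
    left
    rw [ZFSet.mem_sUnion]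
    rcases hy with hy | hy
    · obtain ⟨t, ht, hyt⟩ := ZFSet.mem_sUnion.1 hy
      obtain ⟨_, _, _, _, h2, _⟩ := (h t).1 ht
      exact ⟨t, ht, h2 y hyt z hz⟩
    · rw [ZFSet.mem_singleton] at hy
      subst hy
      obtain ⟨t, ht, h1⟩ := ih z hz (trV hx hz)
      exact ⟨t, (h t).2 ⟨ht, z, hz, h1⟩, h1.1⟩
  · rintro t' ht' ⟨hxt, htr⟩ w hw
    rcases ZFSet.mem_union.1 hw with hw | hw
    · obtain ⟨t, ht, hwt⟩ := ZFSet.mem_sUnion.1 hw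
      obtain ⟨_, y, hy, _, _, h3⟩ := (h t).1 ht
      exact h3 t' ht' ⟨htr x hxt y hy, htr⟩ w hwt
    · rw [ZFSet.mem_singleton] at hw; rwa [hw]

/-- The union of the sets in `V` which are post-fixed points of an operator `Φ`. -/
def Cofix (V : Set ZFSet.{0}) (Φ : (ZFSet.{0} → ZFSet.{0} → Prop) → ZFSet.{0} → ZFSet.{0} → Prop)
    (i y : ZFSet.{0}) : Prop :=
  ∃ R, R ∈ V ∧ ((∀ j, j ∈ V → ∀ z, z ∈ V → (ZFSet.pair j z ∈ R →
    Φ (fun k w => ZFSet.pair k w ∈ R) j z)) ∧ ZFSet.pair i y ∈ R)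

variable {Φ : (ZFSet.{0} → ZFSet.{0} → Prop) → ZFSet.{0} → ZFSet.{0} → Prop}

theorem Cofix.inV {i y : ZFSet.{0}} (h : Cofix V Φ i y) : i ∈ V ∧ y ∈ V := by
  obtain ⟨R, hR, -, h⟩ := h
  have := trV hR h
  exact ⟨pairV_left this, pairV_right this⟩

theorem Cofix.unfold (mono : ∀ Q Q' : ZFSet.{0} → ZFSet.{0} → Prop,
      (∀ i y, Q i y → Q' i y) → ∀ i y, Φ Q i y → Φ Q' i y)
    {i y : ZFSet.{0}} (h : Cofix V Φ i y) : Φ (Cofix V Φ) i y := by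
  obtain ⟨hi, hy⟩ := h.inV
  obtain ⟨R, hR, hpost, h⟩ := h
  exact mono _ _ (fun k w hkw => ⟨R, hR, hpost, hkw⟩) _ _ (hpost i hi y hy h)

theorem Cofix.fold (mono : ∀ Q Q' : ZFSet.{0} → ZFSet.{0} → Prop,
      (∀ i y, Q i y → Q' i y) → ∀ i y, Φ Q i y → Φ Q' i y)
    (hdef : Dfn V 2 (fun v => Cofix V Φ (v 0) (v 1)))
    (func : ∀ i y y', Cofix V Φ i y → Cofix V Φ i y' → y = y')
    {i y d : ZFSet.{0}} (hi : i ∈ V) (hy : y ∈ V) (hd : d ∈ V) (hid : i ∈ d)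
    (hloc : ∀ j ∈ d, ∀ (Q : ZFSet.{0} → ZFSet.{0} → Prop) z,
      Φ Q j z → Φ (fun k w => k ∈ d ∧ Q k w) j z)
    (h : Φ (Cofix V Φ) i y) : Cofix V Φ i y := by
  have hdef' : Dfn V 3 (fun v => Cofix V Φ (v 0) (v 2)) :=
    hdef.comp ![fun v => v 0, fun v => v 2] (fun i => by
      fin_cases i
      · exact DF.var _
      · exact DF.var _)
  obtain ⟨T, hT, hTm⟩ := replV hd (fun j u => ∃ z, z ∈ V ∧ (Cofix V Φ j z ∧ u = ZFSet.pair j z))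
    (by
      refine @Dfn.exV V 2 (fun v z => Cofix V Φ (v 0) z ∧ v 1 = ZFSet.pair (v 0) z) ?_
      exact @Dfn.and V 3 _ _ hdef' inferInstance)
    (by
      rintro j - u - u' - ⟨z, -, h1, rfl⟩ ⟨z', -, h1', rfl⟩
      rw [func _ _ _ h1 h1'])
  have hTm' : ∀ j z, ZFSet.pair j z ∈ T ↔ j ∈ d ∧ Cofix V Φ j z := by
    intro j z
    rw [hTm]
    constructor
    · rintro ⟨-, j', hj', z', -, h1, h2⟩
      obtain ⟨rfl, rfl⟩ := ZFSet.pair_inj.1 h2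
      exact ⟨hj', h1⟩
    · rintro ⟨hj, h1⟩
      exact ⟨pairV h1.inV.1 h1.inV.2, j, hj, z, h1.inV.2, h1, rfl⟩
  refine ⟨T ∪ {ZFSet.pair i y}, unionV hT (singV (pairV hi hy)), ?_, by simp⟩
  intro j _ z _ hjz
  have hsub : ∀ k w, (k ∈ d ∧ Cofix V Φ k w) → ZFSet.pair k w ∈ T ∪ {ZFSet.pair i y} :=
    fun k w hkw => ZFSet.mem_union.2 (Or.inl ((hTm' k w).2 hkw))
  rcases ZFSet.mem_union.1 hjz with h1 | h1
  · obtain ⟨hj, h2⟩ := (hTm' j z).1 h1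
    exact mono _ _ hsub _ _ (hloc j hj _ z (h2.unfold mono))
  · rw [ZFSet.mem_singleton] at h1
    obtain ⟨rfl, rfl⟩ := ZFSet.pair_inj.1 h1
    exact mono _ _ hsub _ _ (hloc j hid _ z h)

end model

section forcing

theorem mem_nameVal (G : Set ZFSet.{0}) (τ y : ZFSet.{0}) :
    y ∈ nameVal G τ ↔ ∃ σ s, s ∈ G ∧ ZFSet.pair σ s ∈ τ ∧ nameVal G σ = y := by
  have hT : ∀ σ s, ZFSet.pair σ s ∈ τ → Relation.TransGen (· ∈ ·) σ τ ∧
      σ ∈ ZFSet.sUnion (ZFSet.sUnion τ) := by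
    intro σ s h
    have h1 : σ ∈ ({σ} : ZFSet.{0}) := by simp
    have h2 : ({σ} : ZFSet.{0}) ∈ ZFSet.pair σ s := by simp [ZFSet.pair]
    exact ⟨Relation.TransGen.tail (r := (· ∈ ·)) (Relation.TransGen.tail (r := (· ∈ ·)) (Relation.TransGen.single h1) h2) h,
      ZFSet.mem_sUnion_of_mem h1 (ZFSet.mem_sUnion_of_mem h2 h)⟩
  rw [nameVal, WellFounded.fix_eq]
  rw [@ZFSet.mem_image _ (Classical.allZFSetDefinable _)]
  constructor
  · rintro ⟨σ, hσ, h⟩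
    obtain ⟨-, s, hs, hst⟩ := ZFSet.mem_sep.1 hσ
    rw [dif_pos (hT σ s hst).1] at h
    exact ⟨σ, s, hs, hst, h⟩
  · rintro ⟨σ, s, hs, hst, h⟩
    refine ⟨σ, ZFSet.mem_sep.2 ⟨(hT σ s hst).2, s, hs, hst⟩, ?_⟩
    rw [dif_pos (hT σ s hst).1]
    exact h

theorem name_induction {p : ZFSet.{0} → Prop}
    (h : ∀ τ, (∀ σ s, ZFSet.pair σ s ∈ τ → p σ) → p τ) (τ : ZFSet.{0}) : p τ := by
  refine ZFSet.mem_wf.transGen.induction τ fun τ ih => h τ fun σ s hs => ih σ ?_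
  have h1 : σ ∈ ({σ} : ZFSet.{0}) := by simp
  have h2 : ({σ} : ZFSet.{0}) ∈ ZFSet.pair σ s := by simp [ZFSet.pair]
  exact Relation.TransGen.tail (r := (· ∈ ·)) (Relation.TransGen.tail (r := (· ∈ ·)) (Relation.TransGen.single h1) h2) hs

/-- Operator defining check names. -/
def chkOp (V : Set ZFSet.{0}) (p₀ : ZFSet.{0}) (Q : ZFSet.{0} → ZFSet.{0} → Prop)
    (y c : ZFSet.{0}) : Prop :=
  (∀ v, v ∈ c → ∃ y', y' ∈ y ∧ ∃ c', c' ∈ V ∧ (v = ZFSet.pair c' p₀ ∧ Q y' c')) ∧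
  (∀ y', y' ∈ y → ∃ d, d ∈ V ∧ (ZFSet.pair d p₀ ∈ c ∧ Q y' d))

/-- Operator defining the relation `p ⊩ σ = y̌`. -/
def forOp (V : Set ZFSet.{0}) (P le : ZFSet.{0}) (Q : ZFSet.{0} → ZFSet.{0} → Prop)
    (i y : ZFSet.{0}) : Prop :=
  ∃ p, p ∈ P ∧ ∃ σ, σ ∈ V ∧ (i = ZFSet.pair p σ ∧
    ((∀ π, π ∈ V → ∀ s, s ∈ V → (ZFSet.pair π s ∈ σ → ∀ r, r ∈ P →
      (ZFSet.pair r p ∈ le → ZFSet.pair r s ∈ le →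
        ∃ r', r' ∈ P ∧ (ZFSet.pair r' r ∈ le ∧ ∃ z, z ∈ y ∧ Q (ZFSet.pair r' π) z)))) ∧
    (∀ z, z ∈ y → ∀ r, r ∈ P → (ZFSet.pair r p ∈ le →
        ∃ r', r' ∈ P ∧ (ZFSet.pair r' r ∈ le ∧ ∃ π, π ∈ V ∧ ∃ s, s ∈ V ∧
          (ZFSet.pair π s ∈ σ ∧ ZFSet.pair r' s ∈ le ∧ Q (ZFSet.pair r' π) z))))))

theorem chkOp_mono (V : Set ZFSet.{0}) (p₀ : ZFSet.{0}) (Q Q' : ZFSet.{0} → ZFSet.{0} → Prop)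
    (h : ∀ i y, Q i y → Q' i y) (i y : ZFSet.{0}) (hq : chkOp V p₀ Q i y) :
    chkOp V p₀ Q' i y := by
  refine ⟨fun v hv => ?_, fun y' hy' => ?_⟩
  · obtain ⟨a, b, c, d, e, f⟩ := hq.1 v hv
    exact ⟨a, b, c, d, e, h _ _ f⟩
  · obtain ⟨c, d, e, f⟩ := hq.2 y' hy'
    exact ⟨c, d, e, h _ _ f⟩

theorem forOp_mono (V : Set ZFSet.{0}) (P le : ZFSet.{0}) (Q Q' : ZFSet.{0} → ZFSet.{0} → Prop)
    (h : ∀ i y, Q i y → Q' i y) (i y : ZFSet.{0}) (hq : forOp V P le Q i y) :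
    forOp V P le Q' i y := by
  obtain ⟨p, hp, σ, hσ, hi, h1, h2⟩ := hq
  refine ⟨p, hp, σ, hσ, hi, ?_, ?_⟩
  · intro π hπ s hs h3 r hr h4 h5
    obtain ⟨r', a, b, z, hz, c⟩ := h1 π hπ s hs h3 r hr h4 h5
    exact ⟨r', a, b, z, hz, h _ _ c⟩
  · intro z hz r hr h3
    obtain ⟨r', a, b, π, hπ, s, hs, c, d, e⟩ := h2 z hz r hr h3
    exact ⟨r', a, b, π, hπ, s, hs, c, d, h _ _ e⟩

variable {V : Set ZFSet.{0}} [hV : ZModel V]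

theorem chk_def (p₀ : ZFSet.{0}) [InV V p₀] :
    Dfn V 2 (fun v => Cofix V (chkOp V p₀) (v 0) (v 1)) := by
  unfold Cofix chkOp; infer_instance

set_option synthInstance.maxHeartbeats 400000 in
set_option synthInstance.maxSize 2000 in
theorem for_def (P le : ZFSet.{0}) [InV V P] [InV V le] :
    Dfn V 2 (fun v => Cofix V (forOp V P le) (v 0) (v 1)) := by
  unfold Cofix forOp; infer_instance

theorem chk_func (p₀ : ZFSet.{0}) : ∀ i y y', Cofix V (chkOp V p₀) i y →
    Cofix V (chkOp V p₀) i y' → y = y' := by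
  intro i
  induction i using ZFSet.inductionOn with
  | h i ih =>
  have key : ∀ y y', Cofix V (chkOp V p₀) i y → Cofix V (chkOp V p₀) i y' →
      ∀ z, z ∈ y → z ∈ y' := by
    intro y y' h h' z hz
    obtain ⟨j, hj, c, _, rfl, h1⟩ := (h.unfold (chkOp_mono V p₀)).1 z hz
    obtain ⟨c', _, h2, h3⟩ := (h'.unfold (chkOp_mono V p₀)).2 j hj
    rwa [ih j hj _ _ h1 h3]
  intro y y' h h'
  ext z
  exact ⟨key _ _ h h' z, key _ _ h' h z⟩

theorem chk_exists (p₀ : ZFSet.{0}) (hp : p₀ ∈ V) (x : ZFSet.{0}) : x ∈ V →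
    ∃ c, Cofix V (chkOp V p₀) x c := by
  have : InV V p₀ := ⟨hp⟩
  induction x using ZFSet.inductionOn with
  | h x ih =>
  intro hx
  have hdef := chk_def (V := V) p₀
  have hdef' : Dfn V 3 (fun v => Cofix V (chkOp V p₀) (v 0) (v 2)) :=
    hdef.comp ![fun v => v 0, fun v => v 2] (fun i => by
      fin_cases i
      · exact DF.var _
      · exact DF.var _)
  obtain ⟨T, hT, hTm⟩ := replV hx
    (fun j v => ∃ z, z ∈ V ∧ (Cofix V (chkOp V p₀) j z ∧ v = ZFSet.pair z p₀))
    (by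
      refine @Dfn.exV V 2
        (fun v z => Cofix V (chkOp V p₀) (v 0) z ∧ v 1 = ZFSet.pair z p₀) ?_
      exact @Dfn.and V 3 _ _ hdef' inferInstance)
    (by
      rintro j - v - v' - ⟨z, -, h1, rfl⟩ ⟨z', -, h1', rfl⟩
      rw [chk_func _ _ _ _ h1 h1'])
  obtain ⟨d, hd, hxd, htr, -⟩ := tcV x hx
  refine ⟨T, Cofix.fold (chkOp_mono V p₀) hdef (chk_func p₀) hx hT hd hxd ?_ ⟨?_, ?_⟩⟩
  · rintro j hj Q z ⟨h1, h2⟩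
    refine ⟨fun v hv => ?_, fun y' hy' => ?_⟩
    · obtain ⟨a, b, c, d, e, f⟩ := h1 v hv
      exact ⟨a, b, c, d, e, htr j hj _ b, f⟩
    · obtain ⟨c, d, e, f⟩ := h2 y' hy'
      exact ⟨c, d, e, htr j hj _ hy', f⟩
  · intro v hv
    obtain ⟨-, j, hj, z, hz, h1, h2⟩ := (hTm v).1 hv
    exact ⟨j, hj, z, hz, h2, h1⟩
  · intro j hj
    obtain ⟨c, hc⟩ := ih j hj (trV hx hj)
    have := hc.inV.2
    exact ⟨c, this, (hTm _).2 ⟨pairV this hp, j, hj, c, this, hc, rfl⟩, hc⟩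

theorem chk_val (p₀ : ZFSet.{0}) (G : Set ZFSet.{0}) (hG : p₀ ∈ G) (x : ZFSet.{0}) :
    ∀ c, Cofix V (chkOp V p₀) x c → nameVal G c = x := by
  induction x using ZFSet.inductionOn with
  | h x ih =>
  intro c hc
  have h := hc.unfold (chkOp_mono V p₀)
  ext w
  rw [mem_nameVal]
  constructor
  · rintro ⟨σ, s, hs, h1, rfl⟩
    obtain ⟨y, hy, c', _, h2, h3⟩ := h.1 _ h1
    obtain ⟨rfl, rfl⟩ := ZFSet.pair_inj.1 h2
    rwa [ih y hy _ h3]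
  · intro hw
    obtain ⟨c', _, h1, h2⟩ := h.2 w hw
    exact ⟨c', p₀, hG, h1, ih w hw _ h2⟩

theorem subset_genExt (p₀ : ZFSet.{0}) (hp : p₀ ∈ V) (G : Set ZFSet.{0}) (hG : p₀ ∈ G)
    {x : ZFSet.{0}} (hx : x ∈ V) : x ∈ genExt V G := by
  obtain ⟨c, hc⟩ := chk_exists p₀ hp x hx
  exact ⟨c, hc.inV.2, chk_val p₀ G hG x c hc⟩

/-- `p ⊩ σ = y̌`. -/
def Fo (V : Set ZFSet.{0}) (F : ForcingNotion) (p σ y : ZFSet.{0}) : Prop :=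
  Cofix V (forOp V F.P F.le) (ZFSet.pair p σ) y

variable {F : ForcingNotion} [hP : InV V F.P] [hle : InV V F.le]

instance Fo.dfn {n : ℕ} {f g h : (Fin n → ZFSet.{0}) → ZFSet.{0}} [hf : DF V n f] [hg : DF V n g]
    [hh : DF V n h] : Dfn V n (fun v => Fo V F (f v) (g v) (h v)) :=
  (for_def (V := V) F.P F.le).comp ![fun v => ZFSet.pair (f v) (g v), h] (fun i => by
    fin_cases i
    · exact DF.pair
    · exact hh)

theorem Fo.inV {p σ y : ZFSet.{0}} (h : Fo V F p σ y) : p ∈ V ∧ σ ∈ V ∧ y ∈ V :=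
  ⟨pairV_left (Cofix.inV h).1, pairV_right (Cofix.inV h).1, (Cofix.inV h).2⟩

theorem Fo.unfold {p σ y : ZFSet.{0}} (h : Fo V F p σ y) : p ∈ F.P ∧
    (∀ π s, ZFSet.pair π s ∈ σ → ∀ r, ZFSet.pair r p ∈ F.le → ZFSet.pair r s ∈ F.le →
        ∃ r', ZFSet.pair r' r ∈ F.le ∧ ∃ z ∈ y, Fo V F r' π z) ∧
    (∀ z ∈ y, ∀ r, ZFSet.pair r p ∈ F.le →
        ∃ r', ZFSet.pair r' r ∈ F.le ∧ ∃ π s,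
          ZFSet.pair π s ∈ σ ∧ ZFSet.pair r' s ∈ F.le ∧ Fo V F r' π z) := by
  obtain ⟨p', hp', σ', hσ, hi, h1, h2⟩ := Cofix.unfold (forOp_mono V F.P F.le) h
  obtain ⟨rfl, rfl⟩ := ZFSet.pair_inj.1 hi
  refine ⟨hp', ?_, ?_⟩
  · intro π s hs r h3 h4
    have := trV hσ hs
    obtain ⟨r', -, h5⟩ := h1 π (pairV_left this) s (pairV_right this) hs r (F.le_dom _ _ h3).1 h3 h4
    exact ⟨r', h5⟩
  · intro z hz r h3
    obtain ⟨r', _, h4, π, _, s, _, h5⟩ := h2 z hz r (F.le_dom _ _ h3).1 h3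
    exact ⟨r', h4, π, s, h5⟩


theorem Fo.func (i : ZFSet.{0}) : ∀ p p' r y y', ZFSet.pair r p ∈ F.le → ZFSet.pair r p' ∈ F.le →
    Fo V F p i y → Fo V F p' i y' → y = y' := by
  induction i using name_induction with
  | h i ih =>
  have key : ∀ p p' r y y', ZFSet.pair r p ∈ F.le → ZFSet.pair r p' ∈ F.le →
      Fo V F p i y → Fo V F p' i y' → ∀ z, z ∈ y → z ∈ y' := by
    intro p p' r y y' hr hr' h h' z hz
    obtain ⟨r1, h1, π, s, hs, h2, h3⟩ := h.unfold.2.2 z hz r hr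
    obtain ⟨r2, h4, z', hz', h5⟩ := h'.unfold.2.1 π s hs r1 (F.trans _ _ _ h1 hr') h2
    have := ih π s hs r1 r2 r2 z z' h4 (F.refl _ (F.le_dom _ _ h4).1) h3 h5
    rwa [this]
  intro p p' r y y' hr hr' h h'
  ext z
  exact ⟨key _ _ _ _ _ hr hr' h h' z, key _ _ _ _ _ hr' hr h' h z⟩

theorem Fo.func' (i : ZFSet.{0}) (p y y' : ZFSet.{0})
    (h : Fo V F p i y) (h' : Fo V F p i y') : y = y' :=
  Fo.func i p p p y y' (F.refl _ h.unfold.1) (F.refl _ h.unfold.1) h h'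

theorem for_func (i y y' : ZFSet.{0}) (h : Cofix V (forOp V F.P F.le) i y)
    (h' : Cofix V (forOp V F.P F.le) i y') : y = y' := by
  obtain ⟨p, _, σ, _, rfl, _⟩ := Cofix.unfold (forOp_mono V F.P F.le) h
  exact Fo.func' σ p y y' h h'

theorem Fo.fold {p σ y : ZFSet.{0}} (hp : p ∈ F.P) (hσ : σ ∈ V) (hy : y ∈ V)
    (h1 : ∀ π s, ZFSet.pair π s ∈ σ → ∀ r, ZFSet.pair r p ∈ F.le → ZFSet.pair r s ∈ F.le →
        ∃ r', ZFSet.pair r' r ∈ F.le ∧ ∃ z ∈ y, Fo V F r' π z)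
    (h2 : ∀ z ∈ y, ∀ r, ZFSet.pair r p ∈ F.le →
        ∃ r', ZFSet.pair r' r ∈ F.le ∧ ∃ π s,
          ZFSet.pair π s ∈ σ ∧ ZFSet.pair r' s ∈ F.le ∧ Fo V F r' π z) : Fo V F p σ y := by
  obtain ⟨t, ht, hxt, htr, -⟩ := tcV σ hσ
  have htr' : ∀ σ' ∈ t, ∀ π s, ZFSet.pair π s ∈ σ' → π ∈ t := by
    intro σ' hσ' π s hs
    exact htr {π} (htr (ZFSet.pair π s) (htr σ' hσ' _ hs) _ (by simp [ZFSet.pair])) _ (by simp)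
  refine Cofix.fold (forOp_mono V F.P F.le) (for_def _ _) for_func
    (pairV (trV hP.out hp) hσ) hy (prodV hP.out ht) (ZFSet.pair_mem_prod.2 ⟨hp, hxt⟩) ?_ ?_
  · rintro j hj Q z ⟨p', hp', σ', hσ', rfl, h3, h4⟩
    have hσt := (ZFSet.pair_mem_prod.1 hj).2
    refine ⟨p', hp', σ', hσ', rfl, ?_, ?_⟩
    · intro π hπ s hs h5 r hr h6 h7
      obtain ⟨r', a, b, z, hz, c⟩ := h3 π hπ s hs h5 r hr h6 h7
      exact ⟨r', a, b, z, hz, ZFSet.pair_mem_prod.2 ⟨a, htr' _ hσt _ _ h5⟩, c⟩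
    · intro z hz r hr h5
      obtain ⟨r', a, b, π, hπ, s, hs, c, d, e⟩ := h4 z hz r hr h5
      exact ⟨r', a, b, π, hπ, s, hs, c, d, ZFSet.pair_mem_prod.2 ⟨a, htr' _ hσt _ _ c⟩, e⟩
  · refine ⟨p, hp, σ, hσ, rfl, ?_, ?_⟩
    · intro π _ s _ h5 r _ h6 h7
      obtain ⟨r', b, c⟩ := h1 π s h5 r h6 h7
      exact ⟨r', (F.le_dom _ _ b).1, b, c⟩
    · intro z hz r _ h5
      obtain ⟨r', b, π, s, c, d, e⟩ := h2 z hz r h5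
      have := trV hσ c
      exact ⟨r', (F.le_dom _ _ b).1, b, π, pairV_left this, s, pairV_right this, c, d, e⟩

theorem Fo.mono {p q σ y : ZFSet.{0}} (hq : ZFSet.pair q p ∈ F.le) (h : Fo V F p σ y) :
    Fo V F q σ y := by
  obtain ⟨_, h1, h2⟩ := h.unfold
  exact Fo.fold (F.le_dom _ _ hq).1 h.inV.2.1 h.inV.2.2
    (fun π s hs r hr hrs => h1 π s hs r (F.trans _ _ _ hr hq) hrs)
    (fun z hz r hr => h2 z hz r (F.trans _ _ _ hr hq))

variable {G : Set ZFSet.{0}}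

theorem gdense (hG : IsGenericOver V F G) {p : ZFSet.{0}} (hp : p ∈ G) (S : ZFSet.{0} → Prop)
    (hS : Dfn V 1 (fun v => S (v 0)))
    (hd : ∀ r, ZFSet.pair r p ∈ F.le → ∃ r', ZFSet.pair r' r ∈ F.le ∧ S r') : ∃ r ∈ G, S r := by
  have hpP := hG.1.1 p hp
  have : InV V p := ⟨trV hP.out hpP⟩
  obtain ⟨D, hD, h⟩ := sepV hP.out
    (fun d => S d ∨ ¬ ∃ e, e ∈ F.P ∧ (ZFSet.pair e d ∈ F.le ∧ ZFSet.pair e p ∈ F.le))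
    (@Dfn.or V 1 _ _ hS inferInstance)
  obtain ⟨q, hq, hqD⟩ := hG.2 D hD (fun d hd => ((h d).1 hd).1) (by
    intro q hq
    by_cases hc : ∃ e, e ∈ F.P ∧ (ZFSet.pair e q ∈ F.le ∧ ZFSet.pair e p ∈ F.le)
    · obtain ⟨e, _, h1, h2⟩ := hc
      obtain ⟨r', h3, h4⟩ := hd e h2
      exact ⟨r', (h r').2 ⟨(F.le_dom _ _ h3).1, Or.inl h4⟩, F.trans _ _ _ h3 h1⟩
    · exact ⟨q, (h q).2 ⟨hq, Or.inr hc⟩, F.refl q hq⟩)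
  refine ⟨q, hq, ?_⟩
  rcases ((h q).1 hqD).2 with h1 | h1
  · exact h1
  · exfalso
    obtain ⟨r, hr, h2, h3⟩ := hG.1.2.2 q hq p hp
    exact h1 ⟨r, hG.1.1 r hr, h2, h3⟩

theorem truth_a (hG : IsGenericOver V F G) (σ : ZFSet.{0}) : ∀ p ∈ G, ∀ y, Fo V F p σ y →
    nameVal G σ = y := by
  induction σ using name_induction with
  | h σ ih =>
  intro p hp y h
  obtain ⟨_, h1, h2⟩ := h.unfold
  have : InV V σ := ⟨h.inV.2.1⟩
  have : InV V y := ⟨h.inV.2.2⟩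
  ext w
  rw [mem_nameVal]
  constructor
  · rintro ⟨π, s, hs, hπ, rfl⟩
    have : InV V π := ⟨pairV_left (trV h.inV.2.1 hπ)⟩
    obtain ⟨r, hr, hrp, hrs⟩ := hG.1.2.2 p hp s hs
    obtain ⟨r', hr', z, hz, h3⟩ := gdense hG hr (fun r' => ∃ z, z ∈ y ∧ Fo V F r' π z)
      inferInstance
      (fun q hq => h1 π s hπ q (F.trans _ _ _ hq hrp) (F.trans _ _ _ hq hrs))
    rwa [ih π s hπ r' hr' z h3]
  · intro hw
    have : InV V w := ⟨trV h.inV.2.2 hw⟩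
    obtain ⟨r, hr, π, _, s, _, h3, h4, h5⟩ := gdense hG hp (fun r' => ∃ π, π ∈ V ∧ ∃ s, s ∈ V ∧
        (ZFSet.pair π s ∈ σ ∧ ZFSet.pair r' s ∈ F.le ∧ Fo V F r' π w)) inferInstance
      (fun q hq => by
        obtain ⟨r', h3, π, s, h4, h5⟩ := h2 w hw q hq
        have := trV h.inV.2.1 h4
        exact ⟨r', h3, π, pairV_left this, s, pairV_right this, h4, h5⟩)
    exact ⟨π, s, hG.1.2.1 r hr s h4, h3, ih π s h3 r hr w h5⟩

theorem truth_b (hG : IsGenericOver V F G) {p₀ : ZFSet.{0}} (hp₀ : p₀ ∈ G) (σ : ZFSet.{0}) :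
    σ ∈ V → nameVal G σ ∈ V → ∃ p ∈ G, Fo V F p σ (nameVal G σ) := by
  induction σ using name_induction with
  | h σ ih =>
  intro hσ hyV
  generalize hy : nameVal G σ = y at hyV ⊢
  have : InV V σ := ⟨hσ⟩
  have : InV V y := ⟨hyV⟩
  have hc : ∃ p ∈ G, Fo V F p σ y ∨ ((∃ π, π ∈ V ∧ ∃ s, s ∈ V ∧ (ZFSet.pair π s ∈ σ ∧
      ZFSet.pair p s ∈ F.le ∧ ∀ r, r ∈ F.P → (ZFSet.pair r p ∈ F.le → ∀ z, z ∈ y →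
        ¬ Fo V F r π z))) ∨
      (∃ z, z ∈ y ∧ ∀ π, π ∈ V → ∀ s, s ∈ V → (ZFSet.pair π s ∈ σ → ∀ r, r ∈ F.P →
        (ZFSet.pair r p ∈ F.le → ZFSet.pair r s ∈ F.le → ¬ Fo V F r π z)))) := by
    refine gdense hG hp₀ _ inferInstance ?_
    intro r hr
    by_contra hno
    push Not at hno
    refine (hno r (F.refl _ (F.le_dom _ _ hr).1)).1 ?_
    refine Fo.fold (F.le_dom _ _ hr).1 hσ hyV ?_ ?_
    · intro π s hπ r1 hr1 hr1s
      have h := trV hσ hπ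
      obtain ⟨r2, _, h2, z, hz, h3⟩ := (hno r1 hr1).2.1 π (pairV_left h) s (pairV_right h) hπ hr1s
      exact ⟨r2, h2, z, hz, h3⟩
    · intro z hz r1 hr1
      obtain ⟨π, _, s, _, hπ, r2, _, h1, h2, h3⟩ := (hno r1 hr1).2.2 z hz
      exact ⟨r2, h1, π, s, hπ, h2, h3⟩
  obtain ⟨p, hp, h | ⟨π, hπ, s, hs, hπs, hps, h⟩ | ⟨z, hz, h⟩⟩ := hc
  · exact ⟨p, hp, h⟩
  · exfalso
    have hsG := hG.1.2.1 p hp s hps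
    have hm : nameVal G π ∈ y := by rw [← hy, mem_nameVal]; exact ⟨π, s, hsG, hπs, rfl⟩
    obtain ⟨q, hq, hF⟩ := ih π s hπs hπ (trV hyV hm)
    obtain ⟨r, hr, h1, h2⟩ := hG.1.2.2 p hp q hq
    exact h r (hG.1.1 r hr) h1 _ hm (hF.mono h2)
  · exfalso
    rw [← hy, mem_nameVal] at hz
    obtain ⟨π, s, hsG, hπs, rfl⟩ := hz
    have hm : nameVal G π ∈ y := by rw [← hy, mem_nameVal]; exact ⟨π, s, hsG, hπs, rfl⟩
    have h' := trV hσ hπs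
    obtain ⟨q, hq, hF⟩ := ih π s hπs (pairV_left h') (trV hyV hm)
    obtain ⟨r, hr, h1, h2⟩ := hG.1.2.2 p hp q hq
    obtain ⟨r', hr', h3, h4⟩ := hG.1.2.2 r hr s hsG
    exact h π (pairV_left h') s (pairV_right h') hπs r' (hG.1.1 _ hr') (F.trans _ _ _ h3 h1) h4
      (hF.mono (F.trans _ _ _ h3 h2))

/-- `p` forces `y̌ ∈ τ`, witnessed by an element of `τ`. -/
def Wi (V : Set ZFSet.{0}) (F : ForcingNotion) (τ p y : ZFSet.{0}) : Prop :=
  ∃ π, π ∈ V ∧ ∃ s, s ∈ V ∧ (ZFSet.pair π s ∈ τ ∧ ZFSet.pair p s ∈ F.le ∧ Fo V F p π y)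

instance Wi.dfn {n : ℕ} {f g : (Fin n → ZFSet.{0}) → ZFSet.{0}} {τ : ZFSet.{0}} [InV V τ]
    [hf : DF V n f] [hg : DF V n g] : Dfn V n (fun v => Wi V F τ (f v) (g v)) := by
  have h1 : Dfn V 2 (fun v => Wi V F τ (v 0) (v 1)) := by unfold Wi; infer_instance
  exact h1.comp ![f, g] (fun i => by fin_cases i <;> assumption)

theorem Wi.mem (hG : IsGenericOver V F G) {τ p y : ZFSet.{0}} (hp : p ∈ G) (h : Wi V F τ p y) :
    y ∈ nameVal G τ := by
  obtain ⟨π, _, s, _, h1, h2, h3⟩ := h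
  rw [mem_nameVal]
  exact ⟨π, s, hG.1.2.1 p hp s h2, h1, truth_a hG π p hp y h3⟩

theorem Wi.of_mem (hG : IsGenericOver V F G) {τ p y : ZFSet.{0}} (hp : p ∈ G) (hτ : τ ∈ V)
    (hy : y ∈ V) (h : y ∈ nameVal G τ) : ∃ r ∈ G, ZFSet.pair r p ∈ F.le ∧ Wi V F τ r y := by
  rw [mem_nameVal] at h
  obtain ⟨π, s, hs, hπ, rfl⟩ := h
  have h' := trV hτ hπ
  obtain ⟨q, hq, hF⟩ := truth_b hG hp π (pairV_left h') hy
  obtain ⟨r, hr, h1, h2⟩ := hG.1.2.2 p hp q hq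
  obtain ⟨r', hr', h3, h4⟩ := hG.1.2.2 r hr s hs
  exact ⟨r', hr', F.trans _ _ _ h3 h1, π, pairV_left h', s, pairV_right h', hπ, h4,
    hF.mono (F.trans _ _ _ h3 h2)⟩

end forcing

section product

variable {V : Set ZFSet.{0}} [hV : ZModel V] {F₁ F₂ : ForcingNotion}
  [hP₁ : InV V F₁.P] [hle₁ : InV V F₁.le] [hP₂ : InV V F₂.P] [hle₂ : InV V F₂.le]
  {G₁ G₂ : Set ZFSet.{0}}

theorem prod_nonempty (h : IsProductGeneric V F₁ F₂ G₁ G₂) : (∃ p, p ∈ G₁) ∧ ∃ q, q ∈ G₂ := by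
  obtain ⟨p, hp, q, hq, -⟩ := h.2.2 (ZFSet.prod F₁.P F₂.P) (prodV hP₁.out hP₂.out)
    (fun d hd => by
      obtain ⟨a, ha, b, hb, h⟩ := ZFSet.mem_prod.1 hd
      exact ⟨a, b, ha, hb, h⟩)
    (fun p hp q hq => ⟨p, q, ZFSet.pair_mem_prod.2 ⟨hp, hq⟩, F₁.refl p hp, F₂.refl q hq⟩)
  exact ⟨⟨p, hp⟩, ⟨q, hq⟩⟩

theorem prod_left (h : IsProductGeneric V F₁ F₂ G₁ G₂) : IsGenericOver V F₁ G₁ := by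
  refine ⟨h.1, fun D hD hsub hdense => ?_⟩
  obtain ⟨p, hp, q, hq, hm⟩ := h.2.2 (ZFSet.prod D F₂.P) (prodV hD hP₂.out)
    (fun d hd => by
      obtain ⟨a, ha, b, hb, h⟩ := ZFSet.mem_prod.1 hd
      exact ⟨a, b, hsub a ha, hb, h⟩)
    (fun p hp q hq => by
      obtain ⟨p', h1, h2⟩ := hdense p hp
      exact ⟨p', q, ZFSet.pair_mem_prod.2 ⟨h1, hq⟩, h2, F₂.refl q hq⟩)
  exact ⟨p, hp, (ZFSet.pair_mem_prod.1 hm).1⟩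

theorem prod_right (h : IsProductGeneric V F₁ F₂ G₁ G₂) : IsGenericOver V F₂ G₂ := by
  refine ⟨h.2.1, fun D hD hsub hdense => ?_⟩
  obtain ⟨p, hp, q, hq, hm⟩ := h.2.2 (ZFSet.prod F₁.P D) (prodV hP₁.out hD)
    (fun d hd => by
      obtain ⟨a, ha, b, hb, h⟩ := ZFSet.mem_prod.1 hd
      exact ⟨a, b, ha, hsub b hb, h⟩)
    (fun p hp q hq => by
      obtain ⟨q', h1, h2⟩ := hdense q hq
      exact ⟨p, q', ZFSet.pair_mem_prod.2 ⟨hp, h1⟩, F₁.refl p hp, h2⟩)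
  exact ⟨q, hq, (ZFSet.pair_mem_prod.1 hm).2⟩

/-- `(p, q)` forces some `y` into `τ₁` and out of `τ₂`. -/
def Disag (V : Set ZFSet.{0}) (F₁ F₂ : ForcingNotion) (τ₁ τ₂ p q : ZFSet.{0}) : Prop :=
  ∃ y, y ∈ V ∧ (Wi V F₁ τ₁ p y ∧ ∀ r, r ∈ F₂.P → (ZFSet.pair r q ∈ F₂.le → ¬ Wi V F₂ τ₂ r y))

instance Disag.dfn {n : ℕ} {f g : (Fin n → ZFSet.{0}) → ZFSet.{0}} {τ₁ τ₂ : ZFSet.{0}} [InV V τ₁]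
    [InV V τ₂] [hf : DF V n f] [hg : DF V n g] :
    Dfn V n (fun v => Disag V F₁ F₂ τ₁ τ₂ (f v) (g v)) := by
  have h1 : Dfn V 2 (fun v => Disag V F₁ F₂ τ₁ τ₂ (v 0) (v 1)) := by unfold Disag; infer_instance
  exact h1.comp ![f, g] (fun i => by fin_cases i <;> assumption)

theorem inter_subset (h : IsProductGeneric V F₁ F₂ G₁ G₂) (x : ZFSet.{0}) :
    x ∈ genExt V G₁ → x ∈ genExt V G₂ → x ∈ V := by
  induction x using ZFSet.inductionOn with
  | h x ih =>
  rintro ⟨τ₁, hτ₁, hx₁⟩ ⟨τ₂, hτ₂, hx₂⟩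
  have hG₁ := prod_left h
  have hG₂ := prod_right h
  have : InV V τ₁ := ⟨hτ₁⟩
  have : InV V τ₂ := ⟨hτ₂⟩
  have hsub : ∀ y ∈ x, y ∈ V := by
    intro y hy
    refine ih y hy ?_ ?_
    · rw [← hx₁, mem_nameVal] at hy
      obtain ⟨π, s, _, hπ, hv⟩ := hy
      exact ⟨π, pairV_left (trV hτ₁ hπ), hv⟩
    · rw [← hx₂, mem_nameVal] at hy
      obtain ⟨π, s, _, hπ, hv⟩ := hy
      exact ⟨π, pairV_left (trV hτ₂ hπ), hv⟩
  obtain ⟨D, hD, hDm⟩ := sepV (prodV hP₁.out hP₂.out) (fun d => ∃ p, p ∈ F₁.P ∧ ∃ q, q ∈ F₂.P ∧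
      (d = ZFSet.pair p q ∧ (Disag V F₁ F₂ τ₁ τ₂ p q ∨ ∀ p', p' ∈ F₁.P → ∀ q', q' ∈ F₂.P →
        (ZFSet.pair p' p ∈ F₁.le → ZFSet.pair q' q ∈ F₂.le → ¬ Disag V F₁ F₂ τ₁ τ₂ p' q'))))
    inferInstance
  obtain ⟨p, hp, q, hq, hpq⟩ := h.2.2 D hD
    (fun d hd => by
      obtain ⟨_, p, hp, q, hq, hd, _⟩ := (hDm d).1 hd
      exact ⟨p, q, hp, hq, hd⟩)
    (fun p hp q hq => by
      by_cases hc : ∃ p' q', ZFSet.pair p' p ∈ F₁.le ∧ ZFSet.pair q' q ∈ F₂.le ∧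
        Disag V F₁ F₂ τ₁ τ₂ p' q'
      · obtain ⟨p', q', h1, h2, h3⟩ := hc
        have hp' := (F₁.le_dom _ _ h1).1
        have hq' := (F₂.le_dom _ _ h2).1
        exact ⟨p', q', (hDm _).2 ⟨ZFSet.pair_mem_prod.2 ⟨hp', hq'⟩, p', hp', q', hq', rfl,
          Or.inl h3⟩, h1, h2⟩
      · exact ⟨p, q, (hDm _).2 ⟨ZFSet.pair_mem_prod.2 ⟨hp, hq⟩, p, hp, q, hq, rfl,
          Or.inr fun p' _ q' _ h1 h2 h3 => hc ⟨p', q', h1, h2, h3⟩⟩,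
          F₁.refl p hp, F₂.refl q hq⟩)
  obtain ⟨_, p', hpP, q', hqP, heq, hcase⟩ := (hDm _).1 hpq
  obtain ⟨rfl, rfl⟩ := ZFSet.pair_inj.1 heq
  rcases hcase with ⟨y, hy, hW, hN⟩ | hno
  · exfalso
    have h1 : y ∈ nameVal G₂ τ₂ := by rw [hx₂, ← hx₁]; exact hW.mem hG₁ hp
    obtain ⟨r, hr, h2, h3⟩ := Wi.of_mem hG₂ hq hτ₂ hy h1
    exact hN r (hG₂.1.1 r hr) h2 h3
  · have hchar : ∀ y, y ∈ x ↔ ∃ r, ZFSet.pair r p ∈ F₁.le ∧ Wi V F₁ τ₁ r y := by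
      intro y
      constructor
      · intro hy
        obtain ⟨r, _, h1, h2⟩ := Wi.of_mem hG₁ hp hτ₁ (hsub y hy) (by rwa [hx₁])
        exact ⟨r, h1, h2⟩
      · rintro ⟨r, h1, h2⟩
        have hyV : y ∈ V := by
          obtain ⟨_, _, _, _, _, _, h3⟩ := h2
          exact h3.inV.2.2
        have : InV V y := ⟨hyV⟩
        obtain ⟨r', hr', h3⟩ := gdense hG₂ hq (fun r' => Wi V F₂ τ₂ r' y) inferInstance (by
          intro q' hq'
          by_contra hcon
          push Not at hcon
          exact hno r (F₁.le_dom _ _ h1).1 q' (F₂.le_dom _ _ hq').1 h1 hq'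
            ⟨y, hyV, h2, fun r'' _ h4 => hcon r'' h4⟩)
        rw [← hx₂]
        exact h3.mem hG₂ hr'
    have : InV V p := ⟨trV hP₁.out hpP⟩
    obtain ⟨b, hb, hbm⟩ := replV (prodV hP₁.out (sUnionV (sUnionV hτ₁)))
      (fun i y => ∃ r, r ∈ F₁.P ∧ ∃ π, π ∈ V ∧ (i = ZFSet.pair r π ∧ ZFSet.pair r p ∈ F₁.le ∧
        Fo V F₁ r π y ∧ ∃ s, s ∈ V ∧ (ZFSet.pair π s ∈ τ₁ ∧ ZFSet.pair r s ∈ F₁.le)))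
      inferInstance
      (by
        rintro i - y - y' - ⟨r, _, π, _, rfl, _, h1, _⟩ ⟨r', _, π', _, h2, _, h3, _⟩
        obtain ⟨rfl, rfl⟩ := ZFSet.pair_inj.1 h2
        exact Fo.func' π r y y' h1 h3)
    convert hb using 1
    ext y
    rw [hchar, hbm]
    constructor
    · rintro ⟨r, h1, π, hπ, s, hs, h2, h3, h4⟩
      have hr := (F₁.le_dom _ _ h1).1
      refine ⟨h4.inV.2.2, ZFSet.pair r π, ZFSet.pair_mem_prod.2 ⟨hr, ?_⟩, r, hr, π, hπ, rfl, h1,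
        h4, s, hs, h2, h3⟩
      exact ZFSet.mem_sUnion_of_mem (z := {π}) (by simp)
        (ZFSet.mem_sUnion_of_mem (z := ZFSet.pair π s) (by simp [ZFSet.pair]) h2)
    · rintro ⟨_, i, _, r, hr, π, hπ, _, h1, h4, s, hs, h2, h3⟩
      exact ⟨r, h1, π, hπ, s, hs, h2, h3, h4⟩

end product

/-- if `G₁ × G₂` is generic for the product forcing `P₁ × P₂` over `V`, then
`V[G₁] ∩ V[G₂] = V`. -/
theorem statement14 (V : Set ZFSet) (hV : IsZFCModel V) (hcount : V.Countable)
    (F₁ F₂ : ForcingNotion) (hF₁ : F₁.InModel V) (hF₂ : F₂.InModel V)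
    (G₁ G₂ : Set ZFSet) (hgen : IsProductGeneric V F₁ F₂ G₁ G₂) :
    genExt V G₁ ∩ genExt V G₂ = V := by
  have : ZModel V := ⟨hV⟩
  have : InV V F₁.P := ⟨hF₁.1⟩
  have : InV V F₁.le := ⟨hF₁.2⟩
  have : InV V F₂.P := ⟨hF₂.1⟩
  have : InV V F₂.le := ⟨hF₂.2⟩
  obtain ⟨⟨p, hp⟩, ⟨q, hq⟩⟩ := prod_nonempty hgen
  ext x
  constructor
  · rintro ⟨h1, h2⟩
    exact inter_subset hgen x h1 h2
  · intro hx
    exact ⟨subset_genExt p (trV hF₁.1 (hgen.1.1 p hp)) G₁ hp hx,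
      subset_genExt q (trV hF₂.1 (hgen.2.1.1 q hq)) G₂ hq hx⟩
end

section
/- Let L contain unary predicates P, Q, unary functions π₁, π₂, and unary predicates Q_k for k < ω. Let M have universe P^M ∪ Q^M with P^M = ω and Q^M = {(n,m,α) : n,m < ω, α ≤ ω, (n S m → α < ω)} for a fixed graph relation S on ω interpreting arithmetic, with π₁, π₂ the coordinate projections and Q_k^M = {(n,m,k)}. Then Th(M) admits quantifier elimination and is ω-stable. -/
open FirstOrder FirstOrder.Language

/-- The unary relation symbols: `P`, `Q`, and `Q_k` for `k < ω`. -/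
inductive Rel15 : Type
  | P : Rel15
  | Q : Rel15
  | Qk (k : ℕ) : Rel15

/-- Function symbols: two unary functions `π₁`, `π₂` (coded by `Bool`). -/
def Fn15 : ℕ → Type
  | 1 => Bool
  | _ => Empty

def Rl15 : ℕ → Type
  | 1 => Rel15
  | _ => Empty

/-- The language `L = {P, Q, π₁, π₂} ∪ {Q_k : k < ω}`. -/
def L15 : FirstOrder.Language.{0,0} := ⟨Fn15, Rl15⟩

/-- The universe of `M`: `P^M = ω` together with
`Q^M = {(n,m,α) : n,m < ω, α ≤ ω, (n S m → α < ω)}`. -/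
def M15 (S : ℕ → ℕ → Prop) : Type :=
  ℕ ⊕ {p : ℕ × ℕ × ℕ∞ // S p.1 p.2.1 → p.2.2 ≠ ⊤}

/-- The `L15`-structure on `M15 S`: `π₁`, `π₂` are the coordinate projections on `Q^M` (and
the identity on `P^M`), `P` and `Q` name the two sorts, and `Q_k` names the triples whose
last coordinate is `k`. -/
instance struc15 (S : ℕ → ℕ → Prop) : L15.Structure (M15 S) where
  funMap {n} f x :=
    match n, f with
    | 1, b => match x 0 with
      | Sum.inl k => Sum.inl k
      | Sum.inr y => Sum.inl (if (show Bool from b) then y.1.1 else y.1.2.1)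
  RelMap {n} r x :=
    match n, r with
    | 1, Rel15.P => ∃ k : ℕ, x 0 = Sum.inl k
    | 1, Rel15.Q => ∃ y, x 0 = Sum.inr y
    | 1, Rel15.Qk k => ∃ y, x 0 = Sum.inr y ∧ y.1.2.2 = (k : ℕ∞)

/-- Semantic quantifier elimination for a theory: every formula is equivalent, in all models
of `T`, to a quantifier-free formula. -/
def HasQE {L : FirstOrder.Language.{0,0}} (T : L.Theory) : Prop :=
  ∀ (n : ℕ) (φ : L.Formula (Fin n)), ∃ ψ : L.Formula (Fin n), BoundedFormula.IsQF ψ ∧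
    ∀ (M : Theory.ModelType.{0,0,0} T) (v : Fin n → M),
      Formula.Realize φ v ↔ Formula.Realize ψ v

/-- `T` is ω-stable: over every countable model of `T` there are only countably many
complete 1-types. -/
def OmegaStable {L : FirstOrder.Language.{0,0}} (T : L.Theory) : Prop :=
  ∀ M : Theory.ModelType.{0,0,0} T, Countable M →
    Countable ((L.elementaryDiagram M).CompleteType (Fin 1))

namespace QE15

open Structure

def symP : L15.Relations 1 := Rel15.P
def symQ : L15.Relations 1 := Rel15.Q
def symK (k : ℕ) : L15.Relations 1 := Rel15.Qk k
def symF (b : Bool) : L15.Functions 1 := b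

def isP {A : Type} [L15.Structure A] (x : A) : Prop := RelMap symP ![x]
def isQ {A : Type} [L15.Structure A] (x : A) : Prop := RelMap symQ ![x]
def isK {A : Type} [L15.Structure A] (k : ℕ) (x : A) : Prop := RelMap (symK k) ![x]
def pr {A : Type} [L15.Structure A] (b : Bool) (x : A) : A := funMap (symF b) ![x]

/-- The axioms used. -/
structure Good (A : Type) [L15.Structure A] : Prop where
  q_iff : ∀ x : A, isQ x ↔ ¬ isP x
  p_pr : ∀ b, ∀ x : A, isP (pr b x)
  pr_p : ∀ b, ∀ x : A, isP x → pr b x = x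
  k_not : ∀ k, ∀ x : A, isK k x → ¬ isP x
  k_disj : ∀ k j, k ≠ j → ∀ x : A, isK k x → ¬ isK j x
  k_ex : ∀ k, ∀ c d : A, isP c → isP d → ∃ x : A, isK k x ∧ pr true x = c ∧ pr false x = d
  k_uniq : ∀ k, ∀ x y : A, isK k x → isK k y → pr true x = pr true y →
    pr false x = pr false y → x = y
  p_inf : ∀ n : ℕ, ∀ xs : Fin n → A, ∃ y : A, isP y ∧ ∀ i, xs i ≠ y

theorem good_M15 (S : ℕ → ℕ → Prop) : Good (M15 S) where
  q_iff x := by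
    rcases x with x | x
    · refine iff_of_false ?_ (fun h => h ⟨x, rfl⟩)
      rintro ⟨y, hy⟩
      cases hy
    · refine iff_of_true ⟨x, rfl⟩ ?_
      rintro ⟨y, hy⟩
      cases hy
  p_pr b x := by
    rcases x with x | x
    · exact ⟨_, rfl⟩
    · exact ⟨_, rfl⟩
  pr_p b x h := by
    obtain ⟨k, hk⟩ := h
    simp only [Matrix.cons_val_zero] at hk
    subst hk
    rfl
  k_not k x h h' := by
    obtain ⟨y, hy, _⟩ := h
    obtain ⟨z, hz⟩ := h'
    rw [hz] at hy
    cases hy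
  k_disj k j hkj x h h' := by
    obtain ⟨y, hy, h1⟩ := h
    obtain ⟨z, hz, h2⟩ := h'
    rw [hz] at hy
    cases hy
    rw [h1] at h2
    exact hkj (by exact_mod_cast h2)
  k_ex k c d hc hd := by
    obtain ⟨c', hc⟩ := hc
    obtain ⟨d', hd⟩ := hd
    simp only [Matrix.cons_val_zero] at hc hd
    subst hc hd
    refine ⟨Sum.inr ⟨(c', d', (k : ℕ∞)), fun _ => by simp⟩, ⟨_, rfl, rfl⟩, rfl, rfl⟩
  k_uniq k x y hx hy h1 h2 := by
    obtain ⟨⟨⟨x1, x2, x3⟩, hx0⟩, hx, hx'⟩ := hx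
    obtain ⟨⟨⟨y1, y2, y3⟩, hy0⟩, hy, hy'⟩ := hy
    simp only [Matrix.cons_val_zero] at hx hy
    subst hx hy
    have e1 : x1 = y1 := Sum.inl.inj h1
    have e2 : x2 = y2 := Sum.inl.inj h2
    simp only at hx' hy'
    subst e1 e2 hx' hy'
    rfl
  p_inf n xs := by
    obtain ⟨y, hy⟩ := ((Set.finite_range xs).preimage
      (f := (Sum.inl : ℕ → M15 S)) Sum.inl_injective.injOn).exists_notMem
    exact ⟨Sum.inl y, ⟨_, rfl⟩, fun i hi => hy ⟨i, hi⟩⟩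

section sentences

variable {A : Type} [L15.Structure A]

def fP {α n} (t : L15.Term (α ⊕ Fin n)) : L15.BoundedFormula α n := symP.boundedFormula₁ t
def fQ {α n} (t : L15.Term (α ⊕ Fin n)) : L15.BoundedFormula α n := symQ.boundedFormula₁ t
def fK {α n} (k : ℕ) (t : L15.Term (α ⊕ Fin n)) : L15.BoundedFormula α n :=
  (symK k).boundedFormula₁ t
def tF {α} (b : Bool) (t : L15.Term α) : L15.Term α := (symF b).apply₁ t

variable {α : Type} {n : ℕ} (v : α → A) (xs : Fin n → A)

@[simp] theorem realize_fP (t : L15.Term (α ⊕ Fin n)) :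
    (fP t).Realize v xs ↔ isP (t.realize (Sum.elim v xs)) := BoundedFormula.realize_rel₁
@[simp] theorem realize_fQ (t : L15.Term (α ⊕ Fin n)) :
    (fQ t).Realize v xs ↔ isQ (t.realize (Sum.elim v xs)) := BoundedFormula.realize_rel₁
@[simp] theorem realize_fK (k : ℕ) (t : L15.Term (α ⊕ Fin n)) :
    (fK k t).Realize v xs ↔ isK k (t.realize (Sum.elim v xs)) := BoundedFormula.realize_rel₁
@[simp] theorem realize_tF (b : Bool) (t : L15.Term α) :
    (tF b t).realize v = pr b (t.realize v) := Term.realize_functions_apply₁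

end sentences

section transfer
variable {A B : Type} [L15.Structure A] [L15.Structure B]

theorem Good.transfer (hA : Good A) (h : ∀ φ : L15.Sentence, A ⊨ φ → B ⊨ φ) : Good B where
  q_iff := by
    have := h (∀' ((fQ &0).iff (fP &0).not)) (by
      simpa [Sentence.Realize, Formula.Realize, Fin.snoc] using hA.q_iff)
    simpa [Sentence.Realize, Formula.Realize, Fin.snoc] using this
  p_pr b := by
    have := h (∀' (fP (tF b &0))) (by
      simpa [Sentence.Realize, Formula.Realize, Fin.snoc] using hA.p_pr b)
    simpa [Sentence.Realize, Formula.Realize, Fin.snoc] using this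
  pr_p b := by
    have := h (∀' (fP &0 ⟹ (tF b &0 =' &0))) (by
      simpa [Sentence.Realize, Formula.Realize, Fin.snoc] using hA.pr_p b)
    simpa [Sentence.Realize, Formula.Realize, Fin.snoc] using this
  k_not k := by
    have := h (∀' (fK k &0 ⟹ (fP &0).not)) (by
      simpa [Sentence.Realize, Formula.Realize, Fin.snoc] using hA.k_not k)
    simpa [Sentence.Realize, Formula.Realize, Fin.snoc] using this
  k_disj k j hkj := by
    have := h (∀' (fK k &0 ⟹ (fK j &0).not)) (by
      simpa [Sentence.Realize, Formula.Realize, Fin.snoc] using hA.k_disj k j hkj)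
    simpa [Sentence.Realize, Formula.Realize, Fin.snoc] using this
  k_ex k := by
    have := h (∀' ∀' (fP &0 ⟹ (fP &1 ⟹ ∃' (fK k &2 ⊓ ((tF true &2 =' &0) ⊓ (tF false &2 =' &1)))))) (by
      simpa [Sentence.Realize, Formula.Realize, Fin.snoc] using hA.k_ex k)
    simpa [Sentence.Realize, Formula.Realize, Fin.snoc] using this
  k_uniq k := by
    have := h (∀' ∀' (fK k &0 ⟹ (fK k &1 ⟹ ((tF true &0 =' tF true &1) ⟹
      ((tF false &0 =' tF false &1) ⟹ (&0 =' &1)))))) (by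
      simpa [Sentence.Realize, Formula.Realize, Fin.snoc] using hA.k_uniq k)
    simpa [Sentence.Realize, Formula.Realize, Fin.snoc] using this
  p_inf n := by
    have key : ∀ (C : Type) [L15.Structure C],
        (C ⊨ (BoundedFormula.alls (∃' (fP (Term.var (Sum.inr (Fin.last n))) ⊓
        BoundedFormula.iInf (fun i : Fin n => ((Term.var (Sum.inr i.castSucc)) ='
          (Term.var (Sum.inr (Fin.last n)))).not))) : L15.Sentence)) ↔
        ∀ xs : Fin n → C, ∃ y : C, isP y ∧ ∀ i, xs i ≠ y := by
      intro C _
      rw [Sentence.Realize]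
      simp [BoundedFormula.realize_alls]
    exact (key B).1 (h _ ((key A).2 (hA.p_inf n)))

end transfer

section backforth
variable {A B : Type} [L15.Structure A] [L15.Structure B]

/-- Finite partial isomorphisms of `K`-reducts. -/
structure PIso (K : ℕ) (R : Set (A × B)) : Prop where
  fin : R.Finite
  closed : ∀ b, ∀ p ∈ R, (pr b p.1, pr b p.2) ∈ R
  inj : ∀ p ∈ R, ∀ q ∈ R, p.1 = q.1 ↔ p.2 = q.2
  presP : ∀ p ∈ R, (isP p.1 ↔ isP p.2)
  presK : ∀ p ∈ R, ∀ k < K, (isK k p.1 ↔ isK k p.2)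

theorem PIso.symm {K : ℕ} {R : Set (A × B)} (h : PIso K R) :
    PIso K (Prod.swap '' R) where
  fin := h.fin.image _
  closed := by
    rintro b _ ⟨p, hp, rfl⟩
    exact ⟨_, h.closed b p hp, rfl⟩
  inj := by
    rintro _ ⟨p, hp, rfl⟩ _ ⟨q, hq, rfl⟩
    exact (h.inj p hp q hq).symm
  presP := by
    rintro _ ⟨p, hp, rfl⟩
    exact (h.presP p hp).symm
  presK := by
    rintro _ ⟨p, hp, rfl⟩ k hk
    exact (h.presK p hp k hk).symm

/-- Adding one new pair. -/
theorem PIso.insert {K : ℕ} {R : Set (A × B)} (h : PIso K R) (a : A) (b : B)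
    (ha : ∀ p ∈ R, p.1 ≠ a) (hb : ∀ p ∈ R, p.2 ≠ b)
    (hcl : ∀ c, (pr c a, pr c b) ∈ Insert.insert (a, b) R)
    (hP : isP a ↔ isP b) (hK : ∀ k < K, (isK k a ↔ isK k b)) :
    PIso K (Insert.insert (a, b) R) where
  fin := h.fin.insert _
  closed := by
    rintro c p (rfl | hp)
    · exact hcl c
    · exact Or.inr (h.closed c p hp)
  inj := by
    rintro p (rfl | hp) q (rfl | hq)
    · simp
    · exact iff_of_false (fun e => ha q hq e.symm) (fun e => hb q hq e.symm)
    · exact iff_of_false (fun e => ha p hp e) (fun e => hb p hp e)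
    · exact h.inj p hp q hq
  presP := by
    rintro p (rfl | hp)
    · exact hP
    · exact h.presP p hp
  presK := by
    rintro p (rfl | hp)
    · exact hK
    · exact h.presK p hp

theorem PIso.extP {K : ℕ} {R : Set (A × B)} (h : PIso K R) (hA : Good A) (hB : Good B)
    (a : A) (ha : isP a) : ∃ R', R ⊆ R' ∧ PIso K R' ∧ ∃ b, (a, b) ∈ R' := by
  by_cases hd : ∃ p ∈ R, p.1 = a
  · obtain ⟨⟨x, y⟩, hp, rfl⟩ := hd
    exact ⟨R, subset_rfl, h, y, hp⟩
  · push Not at hd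
    obtain ⟨b, hb, hfresh⟩ : ∃ b : B, isP b ∧ ∀ p ∈ R, p.2 ≠ b := by
      have hf : Finite R := h.fin
      obtain ⟨n, ⟨e⟩⟩ := Finite.exists_equiv_fin R
      obtain ⟨y, hy, hy'⟩ := hB.p_inf n (fun i => (e.symm i).1.2)
      refine ⟨y, hy, fun p hp => ?_⟩
      simpa using hy' (e ⟨p, hp⟩)
    refine ⟨_, Set.subset_insert (a, b) R, h.insert a b hd hfresh ?_ (iff_of_true ha hb) ?_, b,
      Set.mem_insert _ _⟩
    · intro c
      rw [hA.pr_p c a ha, hB.pr_p c b hb]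
      exact Set.mem_insert _ _
    · intro k _
      exact iff_of_false (fun h' => hA.k_not k a h' ha) (fun h' => hB.k_not k b h' hb)

theorem Good.fiber_fresh (hB : Good B) (K : ℕ) (c d : B) (hc : isP c) (hd : isP d)
    (F : Set B) (hF : F.Finite) :
    ∃ b, b ∉ F ∧ pr true b = c ∧ pr false b = d ∧ ¬ isP b ∧ ∀ k < K, ¬ isK k b := by
  choose f hf using fun k => hB.k_ex k c d hc hd
  have hinj : Function.Injective f := by
    intro i j hij
    by_contra hne
    exact hB.k_disj i j hne (f i) (hf i).1 (hij ▸ (hf j).1)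
  obtain ⟨j, hj⟩ := ((hF.preimage hinj.injOn).union (Set.finite_Iio K)).exists_notMem
  simp only [Set.mem_union, Set.mem_preimage, Set.mem_Iio, not_or, not_lt] at hj
  exact ⟨f j, hj.1, (hf j).2.1, (hf j).2.2, hB.k_not j _ (hf j).1, fun k hk hk' =>
    hB.k_disj k j (by omega) _ hk' (hf j).1⟩

theorem PIso.ext {K : ℕ} {R : Set (A × B)} (h : PIso K R) (hA : Good A) (hB : Good B)
    (a : A) : ∃ R', R ⊆ R' ∧ PIso K R' ∧ ∃ b, (a, b) ∈ R' := by
  by_cases ha : isP a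
  · exact h.extP hA hB a ha
  obtain ⟨R1, hR1, h1, c, hc⟩ := h.extP hA hB (pr true a) (hA.p_pr _ _)
  obtain ⟨R2, hR2, h2, d, hd⟩ := h1.extP hA hB (pr false a) (hA.p_pr _ _)
  replace hc := hR2 hc
  have hcP : isP c := (h2.presP _ hc).1 (hA.p_pr _ _)
  have hdP : isP d := (h2.presP _ hd).1 (hA.p_pr _ _)
  by_cases hdom : ∃ p ∈ R2, p.1 = a
  · obtain ⟨⟨x, y⟩, hp, rfl⟩ := hdom
    exact ⟨R2, hR1.trans hR2, h2, y, hp⟩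
  push Not at hdom
  suffices ∃ b, (∀ p ∈ R2, p.2 ≠ b) ∧ pr true b = c ∧ pr false b = d ∧ ¬ isP b ∧
      ∀ k < K, (isK k a ↔ isK k b) by
    obtain ⟨b, hb, e1, e2, hbP, hbK⟩ := this
    refine ⟨_, (hR1.trans hR2).trans (Set.subset_insert (a, b) R2),
      h2.insert a b hdom hb ?_ (iff_of_false ha hbP) hbK, b, Set.mem_insert _ _⟩
    rintro (_ | _)
    · rw [e2]; exact Or.inr hd
    · rw [e1]; exact Or.inr hc
  by_cases hk : ∃ k < K, isK k a
  · obtain ⟨k, hkK, hka⟩ := hk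
    obtain ⟨b, hbk, e1, e2⟩ := hB.k_ex k c d hcP hdP
    refine ⟨b, ?_, e1, e2, hB.k_not k b hbk, ?_⟩
    · rintro ⟨x, y⟩ hp rfl
      refine hdom _ hp (hA.k_uniq k x a ((h2.presK _ hp k hkK).2 hbk) hka ?_ ?_)
      · exact (h2.inj _ (h2.closed true _ hp) _ hc).2 e1
      · exact (h2.inj _ (h2.closed false _ hp) _ hd).2 e2
    · intro j _
      by_cases hjk : j = k
      · subst hjk; exact iff_of_true hka hbk
      · exact iff_of_false (fun h' => hA.k_disj j k hjk a h' hka)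
          (fun h' => hB.k_disj j k hjk b h' hbk)
  · push Not at hk
    obtain ⟨b, hb, e1, e2, hbP, hbK⟩ := hB.fiber_fresh K c d hcP hdP (Prod.snd '' R2)
      (h2.fin.image _)
    exact ⟨b, fun p hp e => hb ⟨p, hp, e⟩, e1, e2, hbP,
      fun k hkK => iff_of_false (hk k hkK) (hbK k hkK)⟩

theorem PIso.ext' {K : ℕ} {R : Set (A × B)} (h : PIso K R) (hA : Good A) (hB : Good B)
    (b : B) : ∃ R', R ⊆ R' ∧ PIso K R' ∧ ∃ a, (a, b) ∈ R' := by
  obtain ⟨R', hR, h', a, ha⟩ := h.symm.ext hB hA b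
  refine ⟨_, ?_, h'.symm, a, ⟨_, ha, rfl⟩⟩
  intro p hp
  exact ⟨p.swap, hR ⟨p, hp, rfl⟩, rfl⟩

theorem term_mem {γ : Type} (t : L15.Term γ) : ∃ s : Finset γ,
    ∀ (A B : Type) [L15.Structure A] [L15.Structure B] (K : ℕ) (R : Set (A × B)), PIso K R →
    ∀ (v : γ → A) (w : γ → B), (∀ i ∈ s, (v i, w i) ∈ R) → (t.realize v, t.realize w) ∈ R := by
  induction t with
  | var i => exact ⟨{i}, fun A B _ _ K R h v w hvw => hvw i (by simp)⟩
  | @func l f ts ih =>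
    match l, f, ts, ih with
    | 0, f, _, _ => exact f.elim
    | 1, f, ts, ih =>
      obtain ⟨s, hs⟩ := ih 0
      refine ⟨s, fun A B _ _ K R h v w hvw => ?_⟩
      have := h.closed f _ (hs A B K R h v w hvw)
      have e : ∀ (C : Type) [L15.Structure C] (u : γ → C),
          (Term.func f ts).realize u = pr f ((ts 0).realize u) := by
        intro C _ u
        rw [Term.realize]
        unfold pr
        refine congrArg (funMap _) ?_
        funext i
        rw [Subsingleton.elim i 0]
        rfl
      rw [e, e]
      exact this
    | (n + 2), f, _, _ => exact f.elim

end backforth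

/-- Bound for the predicates `Q_k` occurring in a relation symbol. -/
def relBound : Rel15 → ℕ
  | .P => 0
  | .Q => 0
  | .Qk k => k + 1

theorem invariance {α : Type} {n : ℕ} (φ : L15.BoundedFormula α n) :
    ∃ (K : ℕ) (s : Finset α), ∀ (A B : Type) [L15.Structure A] [L15.Structure B],
    Good A → Good B → ∀ (K' : ℕ) (R : Set (A × B)), K ≤ K' → PIso K' R →
    ∀ (v : α → A) (w : α → B) (xs : Fin n → A) (ys : Fin n → B),
      (∀ i ∈ s, (v i, w i) ∈ R) → (∀ j, (xs j, ys j) ∈ R) →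
      (φ.Realize v xs ↔ φ.Realize w ys) := by
  classical
  have aux : ∀ {n : ℕ} (t : L15.Term (α ⊕ Fin n)), ∃ s : Finset α,
      ∀ (A B : Type) [L15.Structure A] [L15.Structure B] (K : ℕ) (R : Set (A × B)), PIso K R →
      ∀ (v : α → A) (w : α → B) (xs : Fin n → A) (ys : Fin n → B),
      (∀ i ∈ s, (v i, w i) ∈ R) → (∀ j, (xs j, ys j) ∈ R) →
      (t.realize (Sum.elim v xs), t.realize (Sum.elim w ys)) ∈ R := by
    intro n t
    obtain ⟨s, hs⟩ := term_mem t
    refine ⟨s.toLeft, fun A B _ _ K R h v w xs ys hvw hxy => hs A B K R h _ _ ?_⟩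
    rintro (i | j) hi
    · exact hvw i (by simpa using hi)
    · exact hxy j
  induction φ with
  | falsum => exact ⟨0, ∅, fun A B _ _ _ _ K' R _ _ v w xs ys _ _ => Iff.rfl⟩
  | @equal n t u =>
    obtain ⟨s, hs⟩ := aux t
    obtain ⟨s', hs'⟩ := aux u
    refine ⟨0, s ∪ s', fun A B _ _ hA hB K R _ h v w xs ys hvw hxy => ?_⟩
    exact h.inj _ (hs A B K R h v w xs ys (fun i hi => hvw i (by simp [hi])) hxy) _
      (hs' A B K R h v w xs ys (fun i hi => hvw i (by simp [hi])) hxy)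
  | @rel n l r ts =>
    match l, r, ts with
    | 0, r, _ => exact r.elim
    | 1, r, ts =>
      obtain ⟨s, hs⟩ := aux (ts 0)
      have e : ∀ (C : Type) [L15.Structure C] (u : α → C) (zs : Fin n → C),
          (BoundedFormula.rel r ts).Realize u zs ↔
            RelMap r ![(ts 0).realize (Sum.elim u zs)] := by
        intro C _ u zs
        rw [BoundedFormula.Realize]
        apply iff_of_eq
        congr 1
        funext i
        rw [Subsingleton.elim i 0]
        rfl
      refine ⟨relBound r, s,
        fun A B _ _ hA hB K R hK h v w xs ys hvw hxy => ?_⟩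
      have hm := hs A B K R h v w xs ys hvw hxy
      rw [e, e]
      clear e
      match r, hK with
      | Rel15.P, _ => exact h.presP _ hm
      | Rel15.Q, _ => exact (hA.q_iff _).trans ((not_congr (h.presP _ hm)).trans (hB.q_iff _).symm)
      | Rel15.Qk k, hK => exact h.presK _ hm k hK
    | (l + 2), r, _ => exact r.elim
  | imp φ ψ ih1 ih2 =>
    obtain ⟨K1, s1, h1⟩ := ih1
    obtain ⟨K2, s2, h2⟩ := ih2
    refine ⟨max K1 K2, s1 ∪ s2, fun A B _ _ hA hB K R hK h v w xs ys hvw hxy => ?_⟩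
    exact imp_congr
      (h1 A B hA hB K R (le_trans (le_max_left _ _) hK) h v w xs ys
        (fun i hi => hvw i (by simp [hi])) hxy)
      (h2 A B hA hB K R (le_trans (le_max_right _ _) hK) h v w xs ys
        (fun i hi => hvw i (by simp [hi])) hxy)
  | all φ ih =>
    obtain ⟨K1, s1, h1⟩ := ih
    refine ⟨K1, s1, fun A B _ _ hA hB K R hK h v w xs ys hvw hxy => ?_⟩
    have snoc : ∀ (R' : Set (A × B)) (a : A) (b : B), R ⊆ R' → (a, b) ∈ R' →
        ∀ j, ((Fin.snoc xs a : Fin (_ + 1) → A) j, (Fin.snoc ys b : Fin (_ + 1) → B) j) ∈ R' := by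
      intro R' a b hR hab j
      refine Fin.lastCases ?_ (fun j => ?_) j
      · simpa using hab
      · simpa using hR (hxy j)
    constructor
    · intro hall b
      obtain ⟨R', hR, h', a, hab⟩ := h.ext' hA hB b
      exact (h1 A B hA hB K R' hK h' v w _ _ (fun i hi => hR (hvw i hi))
        (snoc R' a b hR hab)).1 (hall a)
    · intro hall a
      obtain ⟨R', hR, h', b, hab⟩ := h.ext hA hB a
      exact (h1 A B hA hB K R' hK h' v w _ _ (fun i hi => hR (hvw i hi))
        (snoc R' a b hR hab)).2 (hall b)

/-- Optional projection. -/
def opr {A : Type} [L15.Structure A] : Option Bool → A → A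
  | none, x => x
  | some b, x => pr b x

/-- Agreement on atomic formulas. -/
structure Agree {A B : Type} [L15.Structure A] [L15.Structure B] {ι : Type} (K : ℕ)
    (v : ι → A) (w : ι → B) : Prop where
  aP : ∀ i, (isP (v i) ↔ isP (w i))
  aK : ∀ i, ∀ k < K, (isK k (v i) ↔ isK k (w i))
  aE : ∀ i j o o', (opr o (v i) = opr o' (v j) ↔ opr o (w i) = opr o' (w j))

theorem Agree.pIso {A B : Type} [L15.Structure A] [L15.Structure B] {ι : Type} [Finite ι] {K : ℕ}
    {v : ι → A} {w : ι → B} (h : Agree K v w) (hA : Good A) (hB : Good B) :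
    PIso K (Set.range fun p : ι × Option Bool => (opr p.2 (v p.1), opr p.2 (w p.1))) where
  fin := Set.finite_range _
  closed := by
    rintro b _ ⟨⟨i, o⟩, rfl⟩
    cases o with
    | none => exact ⟨(i, some b), rfl⟩
    | some c =>
      refine ⟨(i, some c), ?_⟩
      simp only [opr]
      rw [hA.pr_p b _ (hA.p_pr c _), hB.pr_p b _ (hB.p_pr c _)]
  inj := by
    rintro _ ⟨⟨i, o⟩, rfl⟩ _ ⟨⟨j, o'⟩, rfl⟩
    exact h.aE i j o o'
  presP := by
    rintro _ ⟨⟨i, o⟩, rfl⟩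
    cases o with
    | none => exact h.aP i
    | some c => exact iff_of_true (hA.p_pr c _) (hB.p_pr c _)
  presK := by
    rintro _ ⟨⟨i, o⟩, rfl⟩ k hk
    cases o with
    | none => exact h.aK i k hk
    | some c =>
      exact iff_of_false (fun h' => hA.k_not k _ h' (hA.p_pr c _))
        (fun h' => hB.k_not k _ h' (hB.p_pr c _))

/-- Abstract boolean combination lemma. -/
theorem bool_comb (T : L15.Theory) (n : ℕ) (l : List (L15.Formula (Fin n)))
    (hl : ∀ φ ∈ l, BoundedFormula.IsQF φ) :
    ∀ (X : (Σ M : Theory.ModelType.{0,0,0} T, Fin n → M) → Prop),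
      (∀ x y, (∀ φ ∈ l, (Formula.Realize φ x.2 ↔ Formula.Realize φ y.2)) → (X x ↔ X y)) →
      ∃ ψ : L15.Formula (Fin n), BoundedFormula.IsQF ψ ∧ ∀ x, X x ↔ Formula.Realize ψ x.2 := by
  induction l with
  | nil =>
    intro X hX
    by_cases h : ∃ x, X x
    · obtain ⟨x, hx⟩ := h
      exact ⟨⊤, BoundedFormula.IsQF.top, fun y => iff_of_true ((hX x y (by simp)).1 hx) (by simp)⟩
    · push Not at h
      exact ⟨⊥, BoundedFormula.isQF_bot, fun y => iff_of_false (h y) (by simp)⟩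
  | cons a l ih =>
    intro X hX
    have ih' := ih (fun φ hφ => hl φ (by simp [hφ]))
    have ha := hl a (by simp)
    let r : (Σ M : Theory.ModelType.{0,0,0} T, Fin n → M) →
      (Σ M : Theory.ModelType.{0,0,0} T, Fin n → M) → Prop :=
      fun x y => ∀ φ ∈ l, (Formula.Realize φ x.2 ↔ Formula.Realize φ y.2)
    obtain ⟨ψ1, q1, h1⟩ := ih' (fun x => ∃ y, r x y ∧ Formula.Realize a y.2 ∧ X y) (by
      intro x y hxy
      constructor
      · rintro ⟨z, hz, hh⟩
        exact ⟨z, fun φ hφ => (hxy φ hφ).symm.trans (hz φ hφ), hh⟩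
      · rintro ⟨z, hz, hh⟩
        exact ⟨z, fun φ hφ => (hxy φ hφ).trans (hz φ hφ), hh⟩)
    obtain ⟨ψ0, q0, h0⟩ := ih' (fun x => ∃ y, r x y ∧ ¬ Formula.Realize a y.2 ∧ X y) (by
      intro x y hxy
      constructor
      · rintro ⟨z, hz, hh⟩
        exact ⟨z, fun φ hφ => (hxy φ hφ).symm.trans (hz φ hφ), hh⟩
      · rintro ⟨z, hz, hh⟩
        exact ⟨z, fun φ hφ => (hxy φ hφ).trans (hz φ hφ), hh⟩)
    refine ⟨(a ⊓ ψ1) ⊔ (a.not ⊓ ψ0), (ha.inf q1).sup (ha.not.inf q0), fun x => ?_⟩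
    rw [Formula.realize_sup, Formula.realize_inf, Formula.realize_inf, Formula.realize_not,
      ← h1, ← h0]
    constructor
    · intro hx
      by_cases hax : Formula.Realize a x.2
      · exact Or.inl ⟨hax, x, fun _ _ => Iff.rfl, hax, hx⟩
      · exact Or.inr ⟨hax, x, fun _ _ => Iff.rfl, hax, hx⟩
    · rintro (⟨hax, y, hr, hay, hy⟩ | ⟨hax, y, hr, hay, hy⟩)
      · refine (hX x y ?_).2 hy
        rintro φ hφ
        rcases List.mem_cons.1 hφ with rfl | hφ
        · exact iff_of_true hax hay
        · exact hr φ hφ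
      · refine (hX x y ?_).2 hy
        rintro φ hφ
        rcases List.mem_cons.1 hφ with rfl | hφ
        · exact iff_of_false hax hay
        · exact hr φ hφ

def ot {α : Type} (i : α) : Option Bool → L15.Term (α ⊕ Fin 0)
  | none => Term.var (Sum.inl i)
  | some b => tF b (Term.var (Sum.inl i))

theorem realize_ot {A : Type} [L15.Structure A] {α : Type} (i : α) (o : Option Bool) (v : α → A)
    (xs : Fin 0 → A) : (ot i o).realize (Sum.elim v xs) = opr o (v i) := by
  cases o <;> simp [ot, opr]

theorem good_of_model (S : ℕ → ℕ → Prop) (N : Type) [L15.Structure N]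
    [h : N ⊨ L15.completeTheory (M15 S)] : Good N :=
  (good_M15 S).transfer fun _ hφ => Theory.realize_sentence_of_mem (L15.completeTheory (M15 S)) hφ

theorem qe (S : ℕ → ℕ → Prop) : HasQE (L15.completeTheory (M15 S)) := by
  intro n φ
  obtain ⟨K, s, hinv⟩ := invariance φ
  let atoms : Set (L15.Formula (Fin n)) :=
    (Set.range fun i : Fin n => (fP (ot i none) : L15.BoundedFormula (Fin n) 0)) ∪
    (Set.range fun p : Fin n × Fin K => (fK p.2 (ot p.1 none) : L15.BoundedFormula (Fin n) 0)) ∪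
    (Set.range fun p : Fin n × Fin n × Option Bool × Option Bool =>
      (Term.bdEqual (ot p.1 p.2.2.1) (ot p.2.1 p.2.2.2) : L15.BoundedFormula (Fin n) 0))
  have hfin : atoms.Finite :=
    ((Set.finite_range _).union (Set.finite_range _)).union (Set.finite_range _)
  obtain ⟨ψ, hψ, h⟩ := bool_comb (L15.completeTheory (M15 S)) n hfin.toFinset.toList (by
    intro χ hχ
    simp only [Finset.mem_toList, Set.Finite.mem_toFinset] at hχ
    rcases hχ with (⟨i, rfl⟩ | ⟨i, rfl⟩) | ⟨i, rfl⟩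
    · exact (BoundedFormula.IsAtomic.rel _ _).isQF
    · exact (BoundedFormula.IsAtomic.rel _ _).isQF
    · exact (BoundedFormula.IsAtomic.equal _ _).isQF) (fun x => Formula.Realize φ x.2) (by
    rintro ⟨M, v⟩ ⟨N, w⟩ hag
    simp only [Finset.mem_toList, Set.Finite.mem_toFinset] at hag
    have hM : Good M := good_of_model S M
    have hN : Good N := good_of_model S N
    have hA : Agree K v w := by
      refine ⟨fun i => ?_, fun i k hk => ?_, fun i j o o' => ?_⟩
      · have := hag _ (Or.inl (Or.inl ⟨i, rfl⟩))
        simpa [Formula.Realize, ot] using this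
      · have := hag _ (Or.inl (Or.inr ⟨(i, ⟨k, hk⟩), rfl⟩))
        simpa [Formula.Realize, ot] using this
      · have := hag _ (Or.inr ⟨(i, j, o, o'), rfl⟩)
        simpa only [Formula.Realize, BoundedFormula.realize_bdEqual, realize_ot] using this
    exact hinv M N hM hN K _ le_rfl (hA.pIso hM hN) v w _ _
      (fun i _ => ⟨(i, none), rfl⟩) (fun j => j.elim0))
  exact ⟨ψ, hψ, fun M v => h ⟨M, v⟩⟩

/-- A realization of a type over `M` inside a good extension. -/
structure Rlz (M : Type) [L15.Structure M] where
  N : Type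
  str : L15.Structure N
  good : Good N
  e : M → N
  inj : Function.Injective e
  eP : ∀ m, isP (e m) ↔ isP m
  eK : ∀ k m, isK k (e m) ↔ isK k m
  eF : ∀ o m, opr o (e m) = e (opr o m)
  a : N

/-- The value of a formula at a realization. -/
def Rlz.val {M : Type} [L15.Structure M] (X : Rlz M) (φ : L15.Formula (M ⊕ Fin 1)) : Prop :=
  letI := X.str
  φ.Realize (Sum.elim X.e (fun _ => X.a))

abbrev Data (M : Type) : Type :=
  Prop × Option ℕ × (Option Bool → Option M) × (Option Bool → Option Bool → Prop)

/-- `d` describes the realization `X`. -/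
def Rlz.Desc {M : Type} [L15.Structure M] (X : Rlz M) (d : Data M) : Prop :=
  letI := X.str
  (isP X.a ↔ d.1) ∧ (∀ k, isK k X.a ↔ d.2.1 = some k) ∧
  (∀ o m, X.e m = opr o X.a ↔ d.2.2.1 o = some m) ∧
  (∀ o o', opr o X.a = opr o' X.a ↔ d.2.2.2 o o')

theorem opt_of_uniq {α : Type} (p : α → Prop) (h : ∀ x y, p x → p y → x = y) :
    ∃ o : Option α, ∀ x, p x ↔ o = some x := by
  by_cases hx : ∃ x, p x
  · obtain ⟨x, hx⟩ := hx
    refine ⟨some x, fun y => ⟨fun hy => by rw [h x y hx hy], fun hy => ?_⟩⟩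
    cases hy
    exact hx
  · push Not at hx
    exact ⟨none, fun y => iff_of_false (hx y) (by simp)⟩

theorem Rlz.exists_desc {M : Type} [L15.Structure M] (X : Rlz M) : ∃ d, X.Desc d := by
  let := X.str
  obtain ⟨k, hk⟩ := opt_of_uniq (fun k => isK k X.a) (fun i j hi hj => by
    by_contra hne
    exact X.good.k_disj i j hne _ hi hj)
  choose f hf using fun o => opt_of_uniq (fun m => X.e m = opr o X.a)
    (fun x y hx hy => X.inj (hx.trans hy.symm))
  exact ⟨(isP X.a, k, f, fun o o' => opr o X.a = opr o' X.a), Iff.rfl, hk, hf, fun _ _ => Iff.rfl⟩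

theorem Rlz.val_eq {M : Type} [L15.Structure M] (X Y : Rlz M) (d : Data M)
    (hX : X.Desc d) (hY : Y.Desc d) (φ : L15.Formula (M ⊕ Fin 1)) : X.val φ ↔ Y.val φ := by
  let := X.str
  let := Y.str
  obtain ⟨K, s, hinv⟩ := invariance φ
  obtain ⟨x1, x2, x3, x4⟩ := hX
  obtain ⟨y1, y2, y3, y4⟩ := hY
  have hag : Agree K (fun i : s => Sum.elim X.e (fun _ => X.a) i.1)
      (fun i : s => Sum.elim Y.e (fun _ => Y.a) i.1) := by
    refine ⟨?_, ?_, ?_⟩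
    · rintro ⟨m | m, hm⟩
      · exact (X.eP m).trans (Y.eP m).symm
      · exact x1.trans y1.symm
    · rintro ⟨m | m, hm⟩ k hk
      · exact (X.eK k m).trans (Y.eK k m).symm
      · exact (x2 k).trans (y2 k).symm
    · rintro ⟨m | m, hm⟩ ⟨m' | m', hm'⟩ o o'
      · simp only [Sum.elim_inl, X.eF, Y.eF, X.inj.eq_iff, Y.inj.eq_iff]
      · simp only [Sum.elim_inl, Sum.elim_inr, X.eF, Y.eF]
        exact (x3 _ _).trans (y3 _ _).symm
      · simp only [Sum.elim_inl, Sum.elim_inr, X.eF, Y.eF]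
        exact (eq_comm.trans ((x3 _ _).trans (y3 _ _).symm)).trans eq_comm
      · exact (x4 o o').trans (y4 o o').symm
  exact hinv X.N Y.N X.good Y.good K _ le_rfl (hag.pIso X.good Y.good) _ _ _ _
    (fun i hi => ⟨(⟨i, hi⟩, none), rfl⟩) (fun j => j.elim0)

theorem comp_vec1 {A B : Type} (f : A → B) (x : A) : f ∘ ![x] = ![f x] := by
  funext i
  rw [Subsingleton.elim i 0]
  rfl

theorem exists_rlz (M : Type) [L15.Structure M] [Nonempty M] (hM : Good M)
    (p : (L15.elementaryDiagram M).CompleteType (Fin 1)) :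
    ∃ X : Rlz M, ∀ φ : (L15[[M]])[[Fin 1]].Sentence, φ ∈ p ↔
      X.val (BoundedFormula.constantsVarsEquiv (Formula.equivSentence.symm φ)) := by
  obtain ⟨N, v, hv⟩ := Theory.exists_modelType_is_realized_in _ p
  letI : L15.Structure N := (L15.lhomWithConstants M).reduct N
  haveI : (L15.lhomWithConstants M).IsExpansionOn N := LHom.isExpansionOn_reduct _ _
  let e : M ↪ₑ[L15] N := ElementaryEmbedding.ofModelsElementaryDiagram L15 M N
  refine ⟨⟨N, inferInstance, hM.transfer fun φ hφ => (e.map_sentence φ).1 hφ, e, e.injective,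
    ?_, ?_, ?_, v 0⟩, ?_⟩
  · intro m
    have := e.map_rel symP ![m]
    rw [comp_vec1] at this
    exact this
  · intro k m
    have := e.map_rel (symK k) ![m]
    rw [comp_vec1] at this
    exact this
  · intro o m
    cases o with
    | none => rfl
    | some b =>
      have := e.map_fun (symF b) ![m]
      rw [comp_vec1] at this
      exact this.symm
  · intro φ
    rw [← hv, Theory.CompleteType.mem_typeOf]
    have h1 : v = fun _ => v 0 := by
      funext i
      rw [Subsingleton.elim i 0]
    rw [h1]
    exact BoundedFormula.realize_constantsVarsEquiv.symm

theorem stable (S : ℕ → ℕ → Prop) : OmegaStable (L15.completeTheory (M15 S)) := by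
  intro M hc
  have hM : Good M := good_of_model S M
  choose X hX using exists_rlz M hM
  choose d hd using fun p => (X p).exists_desc
  refine Function.Injective.countable (f := d) ?_
  intro p q hpq
  refine SetLike.ext fun φ => ?_
  rw [hX, hX]
  exact (X p).val_eq (X q) (d p) (hd p) (hpq ▸ hd q) _

end QE15

/-- for any (symmetric) graph relation `S` on `ω`, the theory of the structure
`M15 S` admits quantifier elimination and is ω-stable. -/
theorem statement15 (S : ℕ → ℕ → Prop) (hsymm : ∀ n m, S n m → S m n) :
    HasQE (L15.completeTheory (M15 S)) ∧ OmegaStable (L15.completeTheory (M15 S)) :=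
  ⟨QE15.qe S, QE15.stable S⟩
end
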